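/- For each integer n ≥ 3 there exist a metric space (X,d), a homeomorphism from X onto the Euclidean n-sphere Sⁿ, and a point x₀ ∈ X such that X is Ahlfors n-regular and linearly locally contractible, every point of X \ {x₀} has for every ε > 0 an open neighborhood that is (1+ε)-bilipschitz homeomorphic to an open subset of ℝⁿ, and yet there is no quasisymmetric homeomorphism from X onto Sⁿ, i.e. there is no homeomorphism f : X → Sⁿ together with a homeomorphism η : [0,∞) → [0,∞) satisfying d(f(x),f(y))/d(f(x),f(z)) ≤ η(d(x,y)/d(x,z)) for all triples of distinct points x,y,z ∈ X. -/

import Mathlib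

open Metric MeasureTheory
open scoped ENNReal NNReal

noncomputable section

/-- The Euclidean `n`-sphere: the unit sphere in `ℝ^(n+1)` with the induced metric. -/
abbrev EucSphere (n : ℕ) :=
  ↥(Metric.sphere (0 : EuclideanSpace ℝ (Fin (n + 1))) 1)

/-- The `d`-dimensional Hausdorff measure of a subset of a metric space
(with respect to the Borel σ-algebra of the metric). -/
noncomputable def hausdorffM (X : Type) [MetricSpace X] (d : ℝ) (s : Set X) : ℝ≥0∞ :=
  letI : MeasurableSpace X := borel X
  haveI : BorelSpace X := ⟨rfl⟩
  MeasureTheory.Measure.hausdorffMeasure d s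

/-- A metric space is Ahlfors `n`-regular if the Hausdorff `n`-measure of every ball
of radius `0 < r ≤ diam X` is comparable to `r^n`. -/
def AhlforsRegular (X : Type) [MetricSpace X] (n : ℕ) : Prop :=
  ∃ C : ℝ, 1 ≤ C ∧ ∀ (x : X) (r : ℝ), 0 < r → r ≤ Metric.diam (Set.univ : Set X) →
    ENNReal.ofReal (C⁻¹ * r ^ n) ≤ hausdorffM X n (Metric.ball x r) ∧
      hausdorffM X n (Metric.ball x r) ≤ ENNReal.ofReal (C * r ^ n)

/-- A metric space is linearly locally contractible if there is `C ≥ 1` such that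
every ball `B(x,r)` with `r < diam X / C` is contractible inside `B(x, C r)`. -/
def LinearlyLocallyContractible (X : Type) [MetricSpace X] : Prop :=
  ∃ C : ℝ, 1 ≤ C ∧ ∀ (x : X) (r : ℝ), 0 < r → r < Metric.diam (Set.univ : Set X) / C →
    ∃ (h : Metric.ball x r ⊆ Metric.ball x (C * r)) (y : Metric.ball x (C * r)),
      ContinuousMap.Homotopic
        ⟨Set.inclusion h, continuous_inclusion h⟩
        (ContinuousMap.const _ y)

/-- A homeomorphism-type map between metric spaces is quasiconformal if the metric
distortion ratio `H_f(x,r)` has `limsup_{r → 0⁺} H_f(x,r) ≤ H < ∞` at every point. -/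
def IsQuasiconformal {X Y : Type*} [MetricSpace X] [MetricSpace Y] (f : X → Y) : Prop :=
  ∃ H : ℝ≥0∞, H < ⊤ ∧ ∀ x : X,
    Filter.limsup
      (fun r : ℝ =>
        (⨆ y ∈ {y : X | dist x y ≤ r}, edist (f x) (f y)) /
          ⨅ y ∈ {y : X | r ≤ dist x y}, edist (f x) (f y))
      (nhdsWithin 0 (Set.Ioi (0 : ℝ))) ≤ H

/-- A map between metric spaces is quasisymmetric if there is a homeomorphism
`η : [0,∞) → [0,∞)` controlling all ratios of distances of triples of distinct points. -/
def IsQuasisymmetric {X Y : Type*} [MetricSpace X] [MetricSpace Y] (f : X → Y) : Prop :=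
  ∃ η : ℝ≥0 ≃ₜ ℝ≥0, ∀ x y z : X, x ≠ y → x ≠ z → y ≠ z →
    nndist (f x) (f y) / nndist (f x) (f z) ≤ η (nndist x y / nndist x z)

/-- `x` has, for every `ε > 0`, an open neighborhood admitting a `(1+ε)`-bilipschitz
homeomorphism onto an open subset of Euclidean `n`-space. -/
def AlmostSmoothAt (X : Type) [MetricSpace X] (n : ℕ) (x : X) : Prop :=
  ∀ ε : ℝ, 0 < ε → ∃ U : Set X, IsOpen U ∧ x ∈ U ∧
    ∃ V : Set (EuclideanSpace ℝ (Fin n)), IsOpen V ∧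
      ∃ g : U ≃ V, ∀ a b : U,
        (1 + ε)⁻¹ * dist a b ≤ dist (g a : EuclideanSpace ℝ (Fin n)) (g b) ∧
          dist (g a : EuclideanSpace ℝ (Fin n)) (g b) ≤ (1 + ε) * dist a b

/-- A metric is a length metric in the approximate-midpoint sense. -/
def IsApproxLengthMetric (X : Type) [MetricSpace X] : Prop :=
  ∀ (x y : X) (ε : ℝ), 0 < ε →
    ∃ z : X, dist x z ≤ dist x y / 2 + ε ∧ dist z y ≤ dist x y / 2 + ε

end

section partC1

section flatness
open Topology Filter

/-- `l` is flat with respect to the jump data `c` over the height function `y`. -/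
def Flat {D G : Type*} [TopologicalSpace D] [Group G] (y : D → ℝ) (c l : D → G) : Prop :=
  ∀ d, (y d < 1 → ∀ᶠ d' in 𝓝 d, l d' = l d) ∧
    (0 < y d → ∀ᶠ d' in 𝓝 d, l d' * (c d')⁻¹ = l d * (c d)⁻¹)

lemma Flat.comp {D D' G : Type*} [TopologicalSpace D] [TopologicalSpace D'] [Group G]
    {y : D → ℝ} {c l : D → G} (hl : Flat y c l) {h : D' → D} (hh : Continuous h) :
    Flat (y ∘ h) (c ∘ h) (l ∘ h) := fun d =>
  ⟨fun hd => hh.continuousAt.eventually ((hl (h d)).1 hd),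
   fun hd => hh.continuousAt.eventually ((hl (h d)).2 hd)⟩

lemma Flat.ratio {D G : Type*} [TopologicalSpace D] [PreconnectedSpace D] [Group G]
    {y : D → ℝ} {c l l' : D → G} (hl : Flat y c l) (hl' : Flat y c l') (a b : D) :
    l a * (l' a)⁻¹ = l b * (l' b)⁻¹ := by
  have : IsLocallyConstant (fun d => l d * (l' d)⁻¹) := by
    rw [IsLocallyConstant.iff_eventually_eq]
    intro d
    rcases lt_or_ge (y d) 1 with h | h
    · filter_upwards [(hl d).1 h, (hl' d).1 h] with e h1 h2
      rw [h1, h2]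
    · filter_upwards [(hl d).2 (by linarith), (hl' d).2 (by linarith)] with e h1 h2
      have : ∀ e, l e * (l' e)⁻¹ = (l e * (c e)⁻¹) * (l' e * (c e)⁻¹)⁻¹ := by
        intro e; group
      rw [this e, this d, h1, h2]
  exact this.apply_eq_of_isPreconnected isPreconnected_univ (Set.mem_univ _) (Set.mem_univ _)

lemma exists_flat_section {D G : Type*} [TopologicalSpace D] [SimplyConnectedSpace D]
    [LocallyPathConnectedSpace D] [Group G] {U V : Set D} (hU : IsOpen U) (hV : IsOpen V)
    (hUV : ∀ d, d ∈ U ∨ d ∈ V) (c : D → G)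
    (hc : ∀ d ∈ U, d ∈ V → ∀ᶠ d' in 𝓝 d, c d' = c d) :
    ∃ l : D → G, (∀ d ∈ U, ∀ᶠ d' in 𝓝 d, l d' = l d) ∧
      (∀ d ∈ V, ∀ᶠ d' in 𝓝 d, l d' * (c d')⁻¹ = l d * (c d)⁻¹) := by
  classical
  let _ : TopologicalSpace G := ⊥
  have : DiscreteTopology G := ⟨rfl⟩
  let cc : Bool → D → G := fun b d => if b then 1 else c d
  let bs : Bool → Set D := fun b => if b then U else V
  have hcc : ∀ i j : Bool, ∀ d ∈ bs i ∩ bs j,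
      ∀ᶠ d' in 𝓝 d, cc i d' * (cc j d')⁻¹ = cc i d * (cc j d)⁻¹ := by
    rintro (_ | _) (_ | _) d ⟨h1, h2⟩
    · simp [cc]
    · filter_upwards [hc d h2 h1] with e he
      simp [cc, he]
    · filter_upwards [hc d h1 h2] with e he
      simp [cc, he]
    · simp [cc]
  let Z : FiberBundleCore Bool D G :=
    { baseSet := bs
      isOpen_baseSet := by rintro (_ | _) <;> simpa [bs]
      indexAt := fun d => if d ∈ U then true else false
      mem_baseSet_at := by
        intro d
        by_cases h : d ∈ U
        · simp [bs, h]
        · simpa [bs, h] using (hUV d).resolve_left h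
      coordChange := fun i j d v => v * (cc i d * (cc j d)⁻¹)
      coordChange_self := by intros; simp
      continuousOn_coordChange := by
        rintro i j ⟨d, v⟩ ⟨hd, -⟩
        apply ContinuousAt.continuousWithinAt
        refine ContinuousAt.mul continuousAt_snd ?_
        refine ContinuousAt.comp (f := Prod.fst)
          (g := fun d => cc i d * (cc j d)⁻¹) ?_ continuousAt_fst
        exact continuousAt_const.congr ((hcc i j d hd).mono fun _ h => h.symm)
      coordChange_comp := by intros; group }
  have hcov : IsCoveringMap (Bundle.TotalSpace.proj : Bundle.TotalSpace G Z.Fiber → D) :=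
    FiberBundle.isCoveringMap (F := G)
  obtain ⟨a₀⟩ : Nonempty D := inferInstance
  obtain ⟨F, ⟨-, hF⟩, -⟩ := hcov.existsUnique_continuousMap_lifts (ContinuousMap.id D) a₀
    (⟨a₀, (1 : G)⟩ : Bundle.TotalSpace G Z.Fiber) rfl
  have hF1 : ∀ d, (F d).1 = d := fun d => congrFun hF d
  let m : D → G := fun d => (F d).2
  let l : D → G := fun d => m d * cc (Z.indexAt (F d).1) (F d).1
  have key : ∀ i : Bool, ∀ d ∈ bs i, ∀ᶠ d' in 𝓝 d, l d' * (cc i d')⁻¹ = l d * (cc i d)⁻¹ := by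
    intro i d hd
    have h1 : ContinuousAt (Z.localTriv i) (F d) :=
      (Z.localTriv i).continuousAt (by
        rw [(Z.localTriv i).mem_source]; change (F d).1 ∈ bs i; rw [hF1]; exact hd)
    have h2 : ContinuousAt (fun d => (Z.localTriv i (F d)).2) d :=
      continuousAt_snd.comp (h1.comp (f := F) F.continuous.continuousAt)
    have h3 : ∀ e, (Z.localTriv i (F e)).2 = l e * (cc i e)⁻¹ := by
      intro e
      change m e * (cc (Z.indexAt (F e).1) (F e).1 * (cc i (F e).1)⁻¹) = _
      simp only [l, hF1 e]
      group
    simp only [h3] at h2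
    have := h2.eventually (IsOpen.mem_nhds (isOpen_discrete {l d * (cc i d)⁻¹}) rfl)
    exact this
  refine ⟨l, fun d hd => ?_, fun d hd => ?_⟩
  · simpa [cc] using key true d (by simpa [bs] using hd)
  · simpa [cc] using key false d (by simpa [bs] using hd)

lemma exists_flat {D G : Type*} [TopologicalSpace D] [SimplyConnectedSpace D]
    [LocallyPathConnectedSpace D] [Group G] {y : D → ℝ} (hy : Continuous y) (c : D → G)
    (hc : ∀ d, 0 < y d → y d < 1 → ∀ᶠ d' in 𝓝 d, c d' = c d) :
    ∃ l : D → G, Flat y c l := by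
  obtain ⟨l, h1, h2⟩ := exists_flat_section (U := {d | y d < 1}) (V := {d | 0 < y d})
    (isOpen_lt hy continuous_const) (isOpen_lt continuous_const hy)
    (fun d => by
      rcases lt_or_ge (y d) 1 with h | h
      · exact Or.inl h
      · exact Or.inr (show 0 < y d by linarith)) c (fun d h1 h2 => hc d h2 h1)
  exact ⟨l, fun d => ⟨h1 d, h2 d⟩⟩

end flatness

end partC1

section partC2

section maps
open Topology Filter Real

/-- The model space. -/
abbrev WW (k : ℕ) := ℝ × ℝ × ℝ × EuclideanSpace ℝ (Fin k)

/-- The twisting angle. -/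
noncomputable def th (x : ℝ) : ℝ :=
  2 * π * (smoothTransition (8 * (x + 1) + 1 / 2) + smoothTransition (8 * (x - 1) + 1 / 2))

lemma th_contDiff : ContDiff ℝ 1 th := by
  unfold th
  have h : ContDiff ℝ 1 smoothTransition := smoothTransition.contDiff (n := 1)
  fun_prop

lemma st_half : smoothTransition (1 / 2) = 1 / 2 := by
  have h : 0 < expNegInvGlue (1 / 2) := expNegInvGlue.pos_of_pos (by norm_num)
  have h2 : (1 : ℝ) - 1 / 2 = 1 / 2 := by norm_num
  rw [smoothTransition, h2]
  field_simp
  norm_num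

lemma st_mono : Monotone smoothTransition := by
  have hm : Monotone expNegInvGlue := by
    intro a b hab
    rcases le_or_gt a 0 with ha | ha
    · rw [expNegInvGlue.zero_of_nonpos ha]; exact expNegInvGlue.nonneg b
    · have hb : 0 < b := by linarith
      rw [expNegInvGlue, expNegInvGlue, if_neg (not_le.2 ha), if_neg (not_le.2 hb)]
      apply Real.exp_le_exp.2
      have := inv_anti₀ ha hab
      linarith
  intro a b hab
  have h1 := hm hab
  have h2 : expNegInvGlue (1 - b) ≤ expNegInvGlue (1 - a) := hm (by linarith)
  have pa := smoothTransition.pos_denom a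
  have pb := smoothTransition.pos_denom b
  rw [smoothTransition, smoothTransition, div_le_div_iff₀ pa pb]
  have e1 := expNegInvGlue.nonneg a
  have e2 := expNegInvGlue.nonneg (1 - b)
  nlinarith [mul_le_mul h1 h2 e2 (expNegInvGlue.nonneg b)]

lemma th_gap0 {x : ℝ} (h : x ≤ -1 - 1 / 16) : th x = 0 := by
  rw [th, smoothTransition.zero_of_nonpos (by linarith),
    smoothTransition.zero_of_nonpos (by linarith)]
  ring

lemma th_gap1 {x : ℝ} (h : -1 + 1 / 16 ≤ x) (h' : x ≤ 1 - 1 / 16) : th x = 2 * π := by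
  rw [th, smoothTransition.one_of_one_le (by linarith),
    smoothTransition.zero_of_nonpos (by linarith)]
  ring

lemma th_gap2 {x : ℝ} (h : 1 + 1 / 16 ≤ x) : th x = 2 * (2 * π) := by
  rw [th, smoothTransition.one_of_one_le (by linarith),
    smoothTransition.one_of_one_le (by linarith)]
  ring

lemma sin_gap {x : ℝ} (h : 1 / 16 ≤ |x - 1|) (h' : 1 / 16 ≤ |x + 1|) :
    sin (th x) = 0 ∧ cos (th x) = 1 := by
  rcases le_abs.1 h with h | h
  · rw [th_gap2 (by linarith)]
    exact ⟨by simpa using sin_nat_mul_two_pi_sub 0 2, by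
      simpa using cos_nat_mul_two_pi 2⟩
  · rcases le_abs.1 h' with h' | h'
    · rw [th_gap1 (by linarith) (by linarith)]; simp
    · rw [th_gap0 (by linarith)]; simp

lemma st_le_half {x : ℝ} (h : x ≤ 1 / 2) : smoothTransition x ≤ 1 / 2 :=
  st_half ▸ st_mono h

lemma half_le_st {x : ℝ} (h : 1 / 2 ≤ x) : 1 / 2 ≤ smoothTransition x :=
  st_half ▸ st_mono h

/-- description of the angle near a column -/
lemma th_col {c x : ℝ} (hc : c = -1 ∨ c = 1) (h : |x - c| < 1 / 8) :
    (x ≤ c → 0 ≤ sin (th x)) ∧ (c ≤ x → sin (th x) ≤ 0) ∧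
    (x = c → sin (th x) = 0 ∧ cos (th x) = -1) := by
  have hpi := pi_pos
  obtain ⟨u, hu0, hu1, hs, hcs, h1, h2⟩ : ∃ u : ℝ, 0 ≤ u ∧ u ≤ 1 ∧
      sin (th x) = sin (2 * π * u) ∧ cos (th x) = cos (2 * π * u) ∧
      (x ≤ c → u ≤ 1 / 2) ∧ (c ≤ x → 1 / 2 ≤ u) := by
    rw [abs_lt] at h
    rcases hc with rfl | rfl
    · refine ⟨smoothTransition (8 * (x + 1) + 1 / 2), smoothTransition.nonneg _,
        smoothTransition.le_one _, ?_, ?_, fun h => st_le_half (by linarith),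
        fun h => half_le_st (by linarith)⟩
      all_goals rw [th, smoothTransition.zero_of_nonpos (x := 8 * (x - 1) + 1 / 2) (by linarith),
        add_zero]
    · refine ⟨smoothTransition (8 * (x - 1) + 1 / 2), smoothTransition.nonneg _,
        smoothTransition.le_one _, ?_, ?_, fun h => st_le_half (by linarith),
        fun h => half_le_st (by linarith)⟩
      all_goals rw [th, smoothTransition.one_of_one_le (x := 8 * (x + 1) + 1 / 2) (by linarith)]
      · rw [mul_add, mul_one, add_comm, sin_add_two_pi]
      · rw [mul_add, mul_one, add_comm, cos_add_two_pi]
  refine ⟨fun h => ?_, fun h => ?_, fun h => ?_⟩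
  · rw [hs]
    apply sin_nonneg_of_nonneg_of_le_pi
    · positivity
    · nlinarith [h1 h]
  · rw [hs, ← sin_sub_two_pi]
    apply sin_nonpos_of_nonpos_of_neg_pi_le
    · nlinarith
    · nlinarith [h2 h]
  · have : u = 1 / 2 := le_antisymm (h1 h.le) (h2 h.ge)
    rw [hs, hcs, this]
    have : 2 * π * (1 / 2) = π := by ring
    rw [this]; simp

/-- The cubic reparametrization. -/
noncomputable def fY (y : ℝ) : ℝ := (y + y ^ 3) / 8

lemma fY_mono : StrictMono fY := by
  intro a b hab
  have : a ^ 3 < b ^ 3 := (Odd.strictMono_pow (by decide)) hab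
  unfold fY; linarith

lemma fY_cont : Continuous fY := by unfold fY; fun_prop

lemma fY_surj : Function.Surjective fY := by
  apply fY_cont.surjective
  · apply tendsto_atTop_mono' atTop (f₁ := fun y : ℝ => y / 8)
    · filter_upwards [eventually_ge_atTop 0] with y hy
      have : 0 ≤ y ^ 3 := by positivity
      unfold fY; linarith
    · exact tendsto_id.atTop_div_const (by norm_num)
  · apply tendsto_atBot_mono' atBot (f₁ := fun y : ℝ => y / 8)
    · filter_upwards [eventually_le_atBot 0] with y hy
      have : y ^ 3 ≤ 0 := by
        have := pow_nonneg (neg_nonneg.2 hy) 3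
        nlinarith
      unfold fY; linarith
    · exact tendsto_id.atBot_div_const (by norm_num)

/-- `fY` as a homeomorphism. -/
noncomputable def fH : ℝ ≃ₜ ℝ := (fY_mono.orderIsoOfSurjective fY fY_surj).toHomeomorph

lemma fH_apply (y : ℝ) : fH y = fY y := rfl

lemma fH_symm_lt {a b : ℝ} : fH.symm a < b ↔ a < fY b := by
  rw [← fH_apply]; exact (fY_mono.orderIsoOfSurjective fY fY_surj).symm_apply_lt

lemma lt_fH_symm {a b : ℝ} : b < fH.symm a ↔ fY b < a := by
  rw [← fH_apply]; exact (fY_mono.orderIsoOfSurjective fY fY_surj).lt_symm_apply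

lemma fH_contDiff : ContDiff ℝ 1 fH := by
  have : (fH : ℝ → ℝ) = fY := rfl
  rw [this]; unfold fY; fun_prop

lemma fH_symm_contDiff : ContDiff ℝ 1 fH.symm := by
  apply Homeomorph.contDiff_symm_deriv fH (f' := fun y => (1 + 3 * y ^ 2) / 8)
  · intro x; positivity
  · intro x
    change HasDerivAt fY _ x
    unfold fY
    have h := ((hasDerivAt_id x).add (hasDerivAt_pow 3 x)).div_const 8
    convert! h using 1
  · exact fH_contDiff

variable {k : ℕ}

/-- rotated coordinate -/
noncomputable def cY (w : WW k) : ℝ := w.2.1 * cos (th w.1) + w.2.2.1 * sin (th w.1)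
/-- rotated coordinate -/
noncomputable def cZ (w : WW k) : ℝ := -w.2.1 * sin (th w.1) + w.2.2.1 * cos (th w.1)

lemma cY_contDiff : ContDiff ℝ 1 (cY (k := k)) := by
  have := th_contDiff
  unfold cY; fun_prop

lemma cZ_contDiff : ContDiff ℝ 1 (cZ (k := k)) := by
  have := th_contDiff
  unfold cZ; fun_prop

lemma cY_sq_cZ (w : WW k) : cY w ^ 2 + cZ w ^ 2 = w.2.1 ^ 2 + w.2.2.1 ^ 2 := by
  unfold cY cZ
  have := sin_sq_add_cos_sq (th w.1)
  linear_combination (w.2.1 ^ 2 + w.2.2.1 ^ 2) * this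

/-- The shrinking map. -/
noncomputable def phi (w : WW k) : WW k :=
  (cZ w * (5 / 4), fH.symm (cY w), w.1 / 80, (1 / 2 : ℝ) • w.2.2.2)

/-- The expanding map. -/
noncomputable def psi (w : WW k) : WW k :=
  (80 * w.2.2.1,
    fY w.2.1 * cos (th (80 * w.2.2.1)) - (4 / 5 * w.1) * sin (th (80 * w.2.2.1)),
    fY w.2.1 * sin (th (80 * w.2.2.1)) + (4 / 5 * w.1) * cos (th (80 * w.2.2.1)),
    (2 : ℝ) • w.2.2.2)

lemma cY_psi (w : WW k) : cY (psi w) = fY w.2.1 := by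
  have := sin_sq_add_cos_sq (th (80 * w.2.2.1))
  simp only [cY, psi]
  linear_combination fY w.2.1 * this

lemma cZ_psi (w : WW k) : cZ (psi w) = 4 / 5 * w.1 := by
  have := sin_sq_add_cos_sq (th (80 * w.2.2.1))
  simp only [cZ, psi]
  linear_combination (4 / 5 * w.1) * this

/-- The expanding map as an equivalence. -/
noncomputable def psiE : WW k ≃ WW k where
  toFun := psi
  invFun := phi
  left_inv w := by
    rw [phi, cY_psi, cZ_psi]
    obtain ⟨x, y, z, q⟩ := w
    have : fH.symm (fY y) = y := fH.symm_apply_apply y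
    simp [psi, this, smul_smul]
    ring
  right_inv w := by
    have h := sin_sq_add_cos_sq (th w.1)
    have h1 : fY (fH.symm (cY w)) = cY w := fH.apply_symm_apply _
    have h2 : 80 * (w.1 / 80) = w.1 := by ring
    have h3 : (4 / 5 : ℝ) * (cZ w * (5 / 4)) = cZ w := by ring
    simp only [psi, phi, h1, h2, h3]
    obtain ⟨x, y, z, q⟩ := w
    simp only [cY, cZ] at *
    refine Prod.ext rfl (Prod.ext ?_ (Prod.ext ?_ ?_))
    · change _ = y; linear_combination y * h
    · change _ = z; linear_combination z * h
    · change _ = q; simp [smul_smul]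

lemma phi_contDiff : ContDiff ℝ 1 (phi (k := k)) := by
  have h1 := cY_contDiff (k := k)
  have h2 := cZ_contDiff (k := k)
  have h3 := fH_symm_contDiff
  unfold phi
  simp only [div_eq_mul_inv]
  fun_prop

lemma psi_contDiff : ContDiff ℝ 1 (psi (k := k)) := by
  have h1 := th_contDiff
  have h2 : ContDiff ℝ 1 fY := fH_contDiff
  unfold psi
  fun_prop

/-- The compact core. -/
def EE (k : ℕ) : Set (WW k) :=
  {w | |w.1| ≤ 4 ∧ |w.2.1| ≤ 3 ∧ |w.2.2.1| ≤ 1 / 10 ∧ ‖w.2.2.2‖ ≤ 1 ∧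
    (|w.1 - 1| < 1 / 8 → 1 ≤ |w.2.1|) ∧ (|w.1 + 1| < 1 / 8 → 1 ≤ |w.2.1|)}

/-- An open subset of the core. -/
def EO (k : ℕ) : Set (WW k) :=
  {w | |w.1| < 4 ∧ |w.2.1| < 3 ∧ |w.2.2.1| < 1 / 10 ∧ ‖w.2.2.2‖ < 1 ∧
    (1 / 8 < |w.1 - 1| ∨ 1 < |w.2.1|) ∧ (1 / 8 < |w.1 + 1| ∨ 1 < |w.2.1|)}

lemma EO_sub : EO k ⊆ interior (EE k) := by
  apply interior_maximal
  · rintro w ⟨h1, h2, h3, h4, h5, h6⟩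
    exact ⟨h1.le, h2.le, h3.le, h4.le, fun h => (h5.resolve_left (by linarith)).le,
      fun h => (h6.resolve_left (by linarith)).le⟩
  · simp only [EO, Set.ofPred_and, Set.ofPred_or]
    refine IsOpen.inter ?_ <| IsOpen.inter ?_ <| IsOpen.inter ?_ <| IsOpen.inter ?_ <|
      IsOpen.inter (IsOpen.union ?_ ?_) (IsOpen.union ?_ ?_)
    all_goals exact isOpen_lt (by fun_prop) (by fun_prop)

lemma EE_closed : IsClosed (EE k) := by
  simp only [EE, imp_iff_not_or, Set.ofPred_and, Set.ofPred_or, not_lt]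
  refine IsClosed.inter ?_ <| IsClosed.inter ?_ <| IsClosed.inter ?_ <| IsClosed.inter ?_ <|
    IsClosed.inter (IsClosed.union ?_ ?_) (IsClosed.union ?_ ?_)
  all_goals exact isClosed_le (by fun_prop) (by fun_prop)

lemma EE_compact : IsCompact (EE k) := by
  have hb : IsCompact (Metric.closedBall (0 : WW k) 4) := isCompact_closedBall _ _
  refine hb.of_isClosed_subset EE_closed ?_
  rintro w ⟨h1, h2, h3, h4, -, -⟩
  rw [mem_closedBall_zero_iff, Prod.norm_def, Prod.norm_def, Prod.norm_def]
  simp only [Real.norm_eq_abs]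
  refine max_le h1 (max_le ?_ (max_le ?_ ?_)) <;> linarith

lemma phi_EE {w : WW k} (hw : w ∈ EE k) : phi w ∈ EO k := by
  obtain ⟨h1, h2, h3, h4, h5, h6⟩ := hw
  have hsq := cY_sq_cZ w
  have hy2 : w.2.1 ^ 2 ≤ 9 := by rw [← sq_abs]; nlinarith [abs_nonneg w.2.1]
  have hz2 : w.2.2.1 ^ 2 ≤ 1 / 100 := by rw [← sq_abs]; nlinarith [abs_nonneg w.2.2.1]
  have hY : |cY w| < 3.1 := abs_lt_of_sq_lt_sq (by nlinarith [sq_nonneg (cZ w)]) (by norm_num)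
  have hZ : |cZ w| < 3.1 := abs_lt_of_sq_lt_sq (by nlinarith [sq_nonneg (cY w)]) (by norm_num)
  have key : ¬ (|fH.symm (cY w)| ≤ 1 ∧ (|cZ w * (5 / 4) - 1| ≤ 1 / 8 ∨ |cZ w * (5 / 4) + 1| ≤ 1 / 8)) := by
    rintro ⟨ha, hb⟩
    have hb' : 0.7 ≤ |cZ w| ∧ |cZ w| ≤ 0.9 := by
      rcases hb with hb | hb
      · rw [abs_le] at hb
        have : 0 ≤ cZ w := by nlinarith
        rw [abs_of_nonneg this]; constructor <;> nlinarith
      · rw [abs_le] at hb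
        have : cZ w ≤ 0 := by nlinarith
        rw [abs_of_nonpos this]; constructor <;> nlinarith
    have ha' : |cY w| ≤ 1 / 4 := by
      rw [abs_le] at ha ⊢
      have a1 := not_lt.1 (mt fH_symm_lt.2 (not_lt.2 ha.1))
      have a2 := not_lt.1 (mt lt_fH_symm.2 (not_lt.2 ha.2))
      norm_num [fY] at a1 a2
      constructor <;> linarith
    by_cases hx : 1 / 8 ≤ |w.1 - 1| ∧ 1 / 8 ≤ |w.1 + 1|
    · obtain ⟨s0, c1⟩ := sin_gap (x := w.1) (by linarith) (by linarith)
      have : cZ w = w.2.2.1 := by simp [cZ, s0, c1]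
      rw [this] at hb'
      linarith
    · have hy1 : 1 ≤ |w.2.1| := by
        by_contra hcon
        exact hx ⟨not_lt.1 (mt h5 hcon), not_lt.1 (mt h6 hcon)⟩
      have e1 : cY w ^ 2 ≤ 1 / 16 := by rw [← sq_abs]; nlinarith [abs_nonneg (cY w)]
      have e2 : cZ w ^ 2 ≤ 0.81 := by rw [← sq_abs]; nlinarith [abs_nonneg (cZ w)]
      have e3 : 1 ≤ w.2.1 ^ 2 := by rw [← sq_abs]; nlinarith
      nlinarith [sq_nonneg w.2.2.1]
  refine ⟨?_, ?_, ?_, ?_, ?_, ?_⟩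
  · rw [abs_lt] at hZ ⊢; constructor <;> simp only [phi] <;> linarith
  · rw [abs_lt] at hY ⊢
    constructor
    · exact lt_fH_symm.2 (by norm_num [fY]; linarith)
    · exact fH_symm_lt.2 (by norm_num [fY]; linarith)
  · rw [abs_le] at h1; rw [abs_lt]; constructor <;> simp only [phi] <;> linarith
  · simp only [phi, norm_smul]; norm_num; linarith
  · by_contra hcon
    push Not at hcon
    exact key ⟨hcon.2, Or.inl hcon.1⟩
  · by_contra hcon
    push Not at hcon
    exact key ⟨hcon.2, Or.inr hcon.1⟩

/-- The dilation. -/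
noncomputable def tauE : WW k ≃ WW k where
  toFun w := (100 : ℝ) • w
  invFun w := (1 / 100 : ℝ) • w
  left_inv w := by simp [smul_smul]
  right_inv w := by simp [smul_smul]

lemma tau_EE {w : WW k} (hw : w ∈ EE k) : (1 / 100 : ℝ) • w ∈ EO k := by
  obtain ⟨h1, h2, h3, h4, h5, h6⟩ := hw
  rw [abs_le] at h1 h2 h3
  refine ⟨?_, ?_, ?_, ?_, Or.inl ?_, Or.inl ?_⟩
  · simp only [Prod.smul_fst, smul_eq_mul]; rw [abs_lt]; constructor <;> linarith
  · simp only [Prod.smul_fst, Prod.smul_snd, smul_eq_mul]; rw [abs_lt]; constructor <;> linarith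
  · simp only [Prod.smul_fst, Prod.smul_snd, smul_eq_mul]; rw [abs_lt]; constructor <;> linarith
  · simp only [Prod.smul_snd, norm_smul]; norm_num; linarith
  · simp only [Prod.smul_fst, smul_eq_mul]; rw [lt_abs]; right; linarith
  · simp only [Prod.smul_fst, smul_eq_mul]; rw [lt_abs]; left; linarith

end maps

end partC2

section partC3

section transfer
open Topology Filter Real

variable {k : ℕ} {G : Type*} [Group G]

/-- The jump function. -/
noncomputable def jf (a b : G) (x : ℝ) : G :=
  if x < -1 then 1 else if x < 1 then a else a * b

/-- lower comparison element -/
noncomputable def rlow (a b : G) (c : ℝ) (w : WW k) : G :=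
  if 0 < cY w then (a * b)⁻¹ * jf a b (phi w).1 else if w.1 < c then 1 else (a * b)⁻¹

/-- upper comparison element -/
noncomputable def rup (a b : G) (c : ℝ) (w : WW k) : G :=
  if 0 < cY w then (if w.1 < c then a⁻¹ else a⁻¹ * (a * b)⁻¹) * jf a b (phi w).1 else a⁻¹

/-- first component of the induced map -/
def wa (a b : G) : G := (b * a)⁻¹ * (a * b)
/-- second component of the induced map -/
def wb (a b : G) : G := (a * b)⁻¹ * wa a b * (a * b)

/-- gauge near a column -/
noncomputable def colK (a b : G) (c : ℝ) (p v : G) (w : WW k) : G :=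
  if w.2.1 < 0 then (rlow a b c w)⁻¹ * p else (rup a b c w)⁻¹ * p * (if w.1 < c then 1 else v)

/-- gauge transformation -/
noncomputable def kap (a b : G) (w : WW k) : G :=
  if |w.1 + 1| < 1 / 8 then colK a b (-1) 1 (wa a b) w
  else if |w.1 - 1| < 1 / 8 then colK a b 1 (a * b) (wb a b) w
  else if w.1 < -1 then 1 else if w.1 < 1 then a * b else a * b * (a * b)

lemma phi1_lt {w : WW k} : (phi w).2.1 < 1 ↔ cY w < 1 / 4 := by
  rw [show (1 / 4 : ℝ) = fY 1 by norm_num [fY]]; exact fH_symm_lt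

lemma phi1_pos {w : WW k} : 0 < (phi w).2.1 ↔ 0 < cY w := by
  conv_rhs => rw [show (0 : ℝ) = fY 0 by norm_num [fY]]
  exact lt_fH_symm

lemma jf_low (a b : G) {x : ℝ} (h : x < -1) : jf a b x = 1 := by simp [jf, h]
lemma jf_mid (a b : G) {x : ℝ} (h : -1 ≤ x) (h' : x < 1) : jf a b x = a := by
  simp [jf, not_lt.2 h, h']
lemma jf_high (a b : G) {x : ℝ} (h : 1 ≤ x) : jf a b x = a * b := by
  simp [jf, not_lt.2 h, not_lt.2 (by linarith : -1 ≤ x)]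

lemma phi_gap {w : WW k} (hw : w ∈ EE k) (h : 1 / 16 ≤ |w.1 - 1|) (h' : 1 / 16 ≤ |w.1 + 1|) :
    cY w = w.2.1 ∧ -1 ≤ (phi w).1 ∧ (phi w).1 < 1 := by
  obtain ⟨s0, c1⟩ := sin_gap h h'
  have h3 := abs_le.1 hw.2.2.1
  refine ⟨by simp [cY, s0, c1], ?_, ?_⟩ <;> simp [phi, cZ, s0, c1] <;> linarith

lemma kap_gap (a b : G) {w : WW k} (hw : w ∈ EE k) (h : 1 / 16 ≤ |w.1 - 1|)
    (h' : 1 / 16 ≤ |w.1 + 1|) :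
    kap a b w = if w.1 < -1 then 1 else if w.1 < 1 then a * b else a * b * (a * b) := by
  obtain ⟨hY, hx1, hx2⟩ := phi_gap hw h h'
  unfold kap
  split_ifs with h1 h2 h3 h4 h5 h6 h7
  · have := abs_lt.1 h1
    have hy := hw.2.2.2.2.2 h1
    simp only [colK, rlow, rup, hY, h2, if_true, jf_mid a b hx1 hx2]
    split_ifs with e1 e2 e3
    · linarith
    · simp
    · simp
    · exfalso; rw [abs_of_nonneg (by linarith)] at hy; linarith
  · have := abs_lt.1 h1
    have hy := hw.2.2.2.2.2 h1
    simp only [colK, rlow, rup, hY, h2, if_false, jf_mid a b hx1 hx2]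
    split_ifs with e1 e2 e3
    · linarith
    · simp
    · simp [wa, mul_assoc]
    · exfalso; rw [abs_of_nonneg (by linarith)] at hy; linarith
  · have := abs_lt.1 h1; linarith
  · have := abs_lt.1 h4; linarith
  · have := abs_lt.1 h4
    have hy := hw.2.2.2.2.1 h4
    simp only [colK, rlow, rup, hY, h6, if_true, jf_mid a b hx1 hx2]
    split_ifs with e1 e2 e3
    · linarith
    · simp
    · simp
    · exfalso; rw [abs_of_nonneg (by linarith)] at hy; linarith
  · have := abs_lt.1 h4
    have hy := hw.2.2.2.2.1 h4
    simp only [colK, rlow, rup, hY, h6, if_false, jf_mid a b hx1 hx2]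
    split_ifs with e1 e2 e3
    · linarith
    · simp
    · simp [wa, wb, mul_assoc]
    · exfalso; rw [abs_of_nonneg (by linarith)] at hy; linarith
  all_goals rfl

lemma phi1 (w : WW k) : (phi w).1 = cZ w * (5 / 4) := rfl

lemma col_zero {w : WW k} (h : cY w = 0) : cZ w * sin (th w.1) = -w.2.1 := by
  have := sin_sq_add_cos_sq (th w.1)
  simp only [cY, cZ] at *
  linear_combination (-w.2.1) * this + cos (th w.1) * h

section
variable {D : Type*} [TopologicalSpace D] {f : D → WW k} (hf : Continuous f) {a b : G} {l : D → G}
  (hl : Flat (fun d => (phi (f d)).2.1) (fun d => jf a b (phi (f d)).1) l)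
include hf hl

lemma rlow_flat {c : ℝ} (hc : c = -1 ∨ c = 1) {d : D} (hx : |(f d).1 - c| < 1 / 8)
    (hy : (f d).2.1 ≤ -1) :
    ∀ᶠ d' in 𝓝 d, l d' * (rlow a b c (f d'))⁻¹ = l d * (rlow a b c (f d))⁻¹ := by
  have cx : Continuous fun d => (f d).1 := by fun_prop
  have cYc : Continuous fun d => cY (f d) := cY_contDiff.continuous.comp hf
  have cZc : Continuous fun d => cZ (f d) := cZ_contDiff.continuous.comp hf
  obtain ⟨t1, t2, t3⟩ := th_col hc hx
  have hne : cY (f d) ≤ 0 → (f d).1 ≠ c := by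
    intro h h'
    obtain ⟨s, e⟩ := t3 h'
    simp [cY, s, e] at h
    linarith
  have hs1 := sin_le_one (th (f d).1)
  have hs2 := neg_one_le_sin (th (f d).1)
  rcases lt_trichotomy (cY (f d)) 0 with h | h | h
  · have h1 := (hl d).1 (phi1_lt.2 (by linarith))
    have e1 := cYc.continuousAt.eventually (gt_mem_nhds h)
    rcases lt_or_gt_of_ne (hne h.le) with h2 | h2
    · filter_upwards [h1, e1, cx.continuousAt.eventually (gt_mem_nhds h2)] with d' f1 f2 f3
      simp [rlow, f1, not_lt.2 f2.le, not_lt.2 h.le, h2, f3]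
    · filter_upwards [h1, e1, cx.continuousAt.eventually (lt_mem_nhds h2)] with d' f1 f2 f3
      simp [rlow, f1, not_lt.2 f2.le, not_lt.2 h.le, not_lt.2 h2.le, not_lt.2 f3.le]
  · have h1 := (hl d).1 (phi1_lt.2 (by linarith))
    have hz := col_zero h
    rcases lt_or_gt_of_ne (hne h.le) with h2 | h2
    · have hZ : 0.9 < cZ (f d) := by nlinarith [t1 h2.le]
      filter_upwards [h1, cZc.continuousAt.eventually (lt_mem_nhds hZ),
        cx.continuousAt.eventually (gt_mem_nhds h2)] with d' f1 f2 f3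
      have : jf a b (phi (f d')).1 = a * b := jf_high _ _ (by rw [phi1]; linarith)
      simp [rlow, f1, h, h2, f3, this]
    · have hZ : cZ (f d) < -0.9 := by nlinarith [t2 h2.le]
      filter_upwards [h1, cZc.continuousAt.eventually (gt_mem_nhds hZ),
        cx.continuousAt.eventually (lt_mem_nhds h2)] with d' f1 f2 f3
      have : jf a b (phi (f d')).1 = 1 := jf_low _ _ (by rw [phi1]; linarith)
      simp [rlow, f1, h, not_lt.2 h2.le, not_lt.2 f3.le, this]
  · have h1 := (hl d).2 (phi1_pos.2 h)
    filter_upwards [h1, cYc.continuousAt.eventually (lt_mem_nhds h)] with d' f1 f2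
    simp only [rlow, f2, h, if_true, mul_inv_rev (a * b)⁻¹, ← mul_assoc, f1]

lemma rup_flat {c : ℝ} (hc : c = -1 ∨ c = 1) {d : D} (hx : |(f d).1 - c| < 1 / 8)
    (hy : 1 ≤ (f d).2.1) :
    ∀ᶠ d' in 𝓝 d, l d' * (rup a b c (f d'))⁻¹ = l d * (rup a b c (f d))⁻¹ := by
  have cx : Continuous fun d => (f d).1 := by fun_prop
  have cYc : Continuous fun d => cY (f d) := cY_contDiff.continuous.comp hf
  have cZc : Continuous fun d => cZ (f d) := cZ_contDiff.continuous.comp hf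
  obtain ⟨t1, t2, t3⟩ := th_col hc hx
  have hne : 0 ≤ cY (f d) → (f d).1 ≠ c := by
    intro h h'
    obtain ⟨s, e⟩ := t3 h'
    simp [cY, s, e] at h
    linarith
  have hs1 := sin_le_one (th (f d).1)
  have hs2 := neg_one_le_sin (th (f d).1)
  rcases lt_trichotomy (cY (f d)) 0 with h | h | h
  · have h1 := (hl d).1 (phi1_lt.2 (by linarith))
    filter_upwards [h1, cYc.continuousAt.eventually (gt_mem_nhds h)] with d' f1 f2
    simp [rup, f1, not_lt.2 f2.le, not_lt.2 h.le]
  · have h1 := (hl d).1 (phi1_lt.2 (by linarith))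
    have hz := col_zero h
    rcases lt_or_gt_of_ne (hne h.ge) with h2 | h2
    · have hZ : cZ (f d) < -0.9 := by nlinarith [t1 h2.le]
      filter_upwards [h1, cZc.continuousAt.eventually (gt_mem_nhds hZ),
        cx.continuousAt.eventually (gt_mem_nhds h2)] with d' f1 f2 f3
      have : jf a b (phi (f d')).1 = 1 := jf_low _ _ (by rw [phi1]; linarith)
      simp [rup, f1, h, f3, this]
    · have hZ : 0.9 < cZ (f d) := by nlinarith [t2 h2.le]
      filter_upwards [h1, cZc.continuousAt.eventually (lt_mem_nhds hZ),
        cx.continuousAt.eventually (lt_mem_nhds h2)] with d' f1 f2 f3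
      have : jf a b (phi (f d')).1 = a * b := jf_high _ _ (by rw [phi1]; linarith)
      simp [rup, f1, h, not_lt.2 f3.le, this, mul_assoc]
  · have h1 := (hl d).2 (phi1_pos.2 h)
    have e1 := cYc.continuousAt.eventually (lt_mem_nhds h)
    rcases lt_or_gt_of_ne (hne h.le) with h2 | h2
    · filter_upwards [h1, e1, cx.continuousAt.eventually (gt_mem_nhds h2)] with d' f1 f2 f3
      simp only [rup, f2, h, h2, f3, if_true, mul_inv_rev a⁻¹, ← mul_assoc, f1]
    · filter_upwards [h1, e1, cx.continuousAt.eventually (lt_mem_nhds h2)] with d' f1 f2 f3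
      simp only [rup, f2, h, not_lt.2 h2.le, not_lt.2 f3.le, if_true, if_false,
        mul_inv_rev (a⁻¹ * (a * b)⁻¹), ← mul_assoc (l _), f1]

/-- The transfer lemma. -/
lemma flat_transfer (hE : ∀ d, f d ∈ EE k) :
    Flat (fun d => (f d).2.1) (fun d => jf (wa a b) (wb a b) (f d).1)
      (fun d => l d * kap a b (f d)) := by
  have cx : Continuous fun d => (f d).1 := by fun_prop
  have cy : Continuous fun d => (f d).2.1 := by fun_prop
  have col : ∀ (c : ℝ) (p v : G) (d : D), (c = -1 ∨ c = 1) → |(f d).1 - c| < 1 / 8 →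
      1 ≤ |(f d).2.1| → (∀ᶠ d' in 𝓝 d, kap a b (f d') = colK a b c p v (f d')) →
      (∃ u : G, ∀ᶠ d' in 𝓝 d, jf (wa a b) (wb a b) (f d').1 =
        u * (if (f d').1 < c then 1 else v)) →
      ((f d).2.1 < 1 → ∀ᶠ d' in 𝓝 d, l d' * kap a b (f d') = l d * kap a b (f d)) ∧
      (0 < (f d).2.1 → ∀ᶠ d' in 𝓝 d, l d' * kap a b (f d') * (jf (wa a b) (wb a b) (f d').1)⁻¹ =
        l d * kap a b (f d) * (jf (wa a b) (wb a b) (f d).1)⁻¹) := by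
    intro c p v d hc hx hy hK ⟨u, hu⟩
    constructor
    · intro h
      have hy' : (f d).2.1 ≤ -1 := by
        rcases le_abs.1 hy with h' | h' <;> linarith
      filter_upwards [rlow_flat hf hl hc hx hy', hK,
        cy.continuousAt.eventually (gt_mem_nhds (by linarith : (f d).2.1 < 0))] with d' e1 e2 e3
      rw [e2, hK.self_of_nhds]
      simp only [colK, e3, (by linarith : (f d).2.1 < 0), if_true, ← mul_assoc, e1]
    · intro h
      have hy' : 1 ≤ (f d).2.1 := by
        rcases le_abs.1 hy with h' | h' <;> linarith
      filter_upwards [rup_flat hf hl hc hx hy', hK, hu,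
        cy.continuousAt.eventually (lt_mem_nhds h)] with d' e1 e2 e3 e4
      rw [e2, hK.self_of_nhds, e3, hu.self_of_nhds]
      simp only [colK, not_lt.2 e4.le, not_lt.2 h.le, if_false, mul_inv_rev u, ← mul_assoc, e1,
        mul_inv_cancel_right]
  intro d
  have hEd := hE d
  by_cases h1 : |(f d).1 + 1| < 1 / 8
  · apply col (-1) 1 (wa a b) d (Or.inl rfl) (by simpa using h1) (hEd.2.2.2.2.2 h1)
    · filter_upwards [(cx.add continuous_const).abs.continuousAt.eventually (gt_mem_nhds h1)]
        with d' e
      replace e : |(f d').1 + 1| < 1 / 8 := e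
      rw [kap, if_pos e]
    · refine ⟨1, ?_⟩
      filter_upwards [cx.continuousAt.eventually (gt_mem_nhds
        (by have := abs_lt.1 h1; linarith : (f d).1 < 1))] with d' e
      simp [jf, e]
  by_cases h2 : |(f d).1 - 1| < 1 / 8
  · apply col 1 (a * b) (wb a b) d (Or.inr rfl) h2 (hEd.2.2.2.2.1 h2)
    · filter_upwards [(cx.sub continuous_const).abs.continuousAt.eventually (gt_mem_nhds h2)]
        with d' e
      replace e : |(f d').1 - 1| < 1 / 8 := e
      have : ¬ |(f d').1 + 1| < 1 / 8 := by
        have := abs_lt.1 e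
        intro h
        have := abs_lt.1 h
        linarith
      rw [kap, if_neg this, if_pos e]
    · refine ⟨wa a b, ?_⟩
      filter_upwards [cx.continuousAt.eventually (lt_mem_nhds
        (by have := abs_lt.1 h2; linarith : -1 < (f d).1))] with d' e
      simp only [jf, not_lt.2 e.le, if_false]
      split_ifs <;> simp
  · have g1 : 1 / 16 < |(f d).1 + 1| := by linarith
    have g2 : 1 / 16 < |(f d).1 - 1| := by linarith
    have e1 := (cx.add continuous_const).abs.continuousAt.eventually (lt_mem_nhds g1)
    have e2 := (cx.sub continuous_const).abs.continuousAt.eventually (lt_mem_nhds g2)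
    have n1 : (f d).1 ≠ -1 := by intro h; rw [h] at g1; norm_num at g1
    have n2 : (f d).1 ≠ 1 := by intro h; rw [h] at g2; norm_num at g2
    have s1 : ∀ᶠ d' in 𝓝 d, ((f d').1 < -1 ↔ (f d).1 < -1) := by
      rcases lt_or_gt_of_ne n1 with h | h
      · filter_upwards [cx.continuousAt.eventually (gt_mem_nhds h)] with d' e
        simp [e, h]
      · filter_upwards [cx.continuousAt.eventually (lt_mem_nhds h)] with d' e
        simp [not_lt.2 e.le, not_lt.2 h.le]
    have s2 : ∀ᶠ d' in 𝓝 d, ((f d').1 < 1 ↔ (f d).1 < 1) := by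
      rcases lt_or_gt_of_ne n2 with h | h
      · filter_upwards [cx.continuousAt.eventually (gt_mem_nhds h)] with d' e
        simp [e, h]
      · filter_upwards [cx.continuousAt.eventually (lt_mem_nhds h)] with d' e
        simp [not_lt.2 e.le, not_lt.2 h.le]
    have kc : ∀ᶠ d' in 𝓝 d, kap a b (f d') = kap a b (f d) := by
      filter_upwards [e1, e2, s1, s2] with d' e1 e2 s1 s2
      rw [kap_gap a b (hE d') e2.le e1.le, kap_gap a b hEd g2.le g1.le]
      simp only [s1, s2]
    have jc : ∀ᶠ d' in 𝓝 d, jf (wa a b) (wb a b) (f d').1 = jf (wa a b) (wb a b) (f d).1 := by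
      filter_upwards [s1, s2] with d' s1 s2
      simp only [jf, s1, s2]
    have lc : ∀ᶠ d' in 𝓝 d, l d' = l d := by
      rcases lt_or_ge (cY (f d)) (1 / 4) with h | h
      · exact (hl d).1 (phi1_lt.2 h)
      · have hg := phi_gap hEd g2.le g1.le
        filter_upwards [(hl d).2 (phi1_pos.2 (by linarith)), e1, e2] with d' r e1 e2
        have hg' := phi_gap (hE d') e2.le e1.le
        rw [jf_mid a b hg.2.1 hg.2.2, jf_mid a b hg'.2.1 hg'.2.2] at r
        exact mul_right_cancel r
    constructor
    · intro _
      filter_upwards [kc, lc] with d' e1 e2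
      rw [e1, e2]
    · intro _
      filter_upwards [kc, lc, jc] with d' e1 e2 e3
      rw [e1, e2, e3]

end

section holonomy
open Topology Filter Real
variable {k : ℕ} {G : Type*} [Group G]

/-- base loop -/
noncomputable def gam (k : ℕ) (t : ℝ) : WW k :=
  (-1 + 1.5 * cos (π * t), 1.5 * sin (π * t), 0, 0)

lemma gam_cont : Continuous (gam k) := by unfold gam; fun_prop

lemma gam_EE (t : ℝ) : gam k t ∈ EE k := by
  have h := sin_sq_add_cos_sq (π * t)
  have h1 := abs_le.1 (abs_cos_le_one (π * t))
  have h2 := abs_le.1 (abs_sin_le_one (π * t))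
  refine ⟨?_, ?_, ?_, ?_, ?_, ?_⟩ <;> simp only [gam]
  · rw [abs_le]; constructor <;> linarith
  · rw [abs_le]; constructor <;> linarith
  · norm_num
  · norm_num
  · intro h; have := abs_lt.1 h; linarith
  · intro h; have := abs_lt.1 h
    apply le_of_sq_le_sq _ (abs_nonneg _)
    rw [sq_abs]
    nlinarith

lemma const_Icc {p q : ℝ} (hpq : p ≤ q) {u : ℝ → G}
    (h : ∀ t ∈ Set.Icc p q, ∀ᶠ t' in 𝓝 t, u t' = u t) : u p = u q := by
  let _ : TopologicalSpace G := ⊥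
  have : DiscreteTopology G := ⟨rfl⟩
  have hc : ContinuousOn u (Set.Icc p q) := fun t ht =>
    (continuousAt_const.congr ((h t ht).mono fun _ h => h.symm)).continuousWithinAt
  exact isPreconnected_Icc.constant hc (Set.left_mem_Icc.2 hpq) (Set.right_mem_Icc.2 hpq)

/-- closed flat sections along the base loop force triviality -/
lemma gam_hol {a b : G} {l : ℝ → G}
    (hl : Flat (fun t => (gam k t).2.1) (fun t => jf a b (gam k t).1) l) (h1 : l (-1) = l 1) :
    a = 1 := by
  have hpi := pi_pos
  have c0 : Continuous fun t => (gam k t).1 := by have := gam_cont (k := k); fun_prop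
  have e1 : l (-1) = l 0 := by
    apply const_Icc (by norm_num)
    rintro t ⟨h1, h2⟩
    refine (hl t).1 ?_
    have : sin (π * t) ≤ 0 := sin_nonpos_of_nonpos_of_neg_pi_le (by nlinarith) (by nlinarith)
    simp only [gam]; linarith
  have e2 : l 0 * (jf a b (gam k 0).1)⁻¹ = l 1 * (jf a b (gam k 1).1)⁻¹ := by
    apply const_Icc (u := fun t => l t * (jf a b (gam k t).1)⁻¹) (by norm_num)
    rintro t ⟨h1, h2⟩
    have hs : 0 ≤ sin (π * t) := sin_nonneg_of_nonneg_of_le_pi (by nlinarith) (by nlinarith)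
    rcases hs.lt_or_eq with hs | hs
    · exact (hl t).2 (by simp only [gam]; linarith)
    · have f1 := (hl t).1 (by simp only [gam]; rw [← hs]; norm_num)
      have hc := sin_sq_add_cos_sq (π * t)
      rw [← hs] at hc
      have hc' : (cos (π * t) - 1) * (cos (π * t) + 1) = 0 := by linear_combination hc
      rcases mul_eq_zero.1 hc' with h | h
      · have hx : (gam k t).1 = 1 / 2 := by simp only [gam]; linarith
        filter_upwards [f1, c0.continuousAt.eventually (lt_mem_nhds (by rw [hx]; norm_num :
          -1 < (gam k t).1)), c0.continuousAt.eventually (gt_mem_nhds (by rw [hx]; norm_num :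
          (gam k t).1 < 1))] with t' g1 g2 g3
        rw [g1, jf_mid _ _ g2.le g3, hx, jf_mid _ _ (by norm_num) (by norm_num)]
      · have hx : (gam k t).1 = -5 / 2 := by simp only [gam]; linarith
        filter_upwards [f1, c0.continuousAt.eventually (gt_mem_nhds (by rw [hx]; norm_num :
          (gam k t).1 < -1))] with t' g1 g3
        rw [g1, jf_low _ _ g3, hx, jf_low _ _ (by norm_num)]
  rw [jf_mid _ _ (by norm_num [gam]) (by norm_num [gam]), jf_low _ _ (by norm_num [gam]), ← h1,
    ← e1] at e2
  simpa using e2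

/-- the induced map on holonomy data -/
def hW (p : G × G) : G × G := (wa p.1 p.2, wb p.1 p.2)

lemma phi_EE' {w : WW k} (hw : w ∈ EE k) : phi w ∈ EE k := interior_subset (EO_sub (phi_EE hw))

lemma phi_iter_EE (m : ℕ) {w : WW k} (hw : w ∈ EE k) : phi^[m] w ∈ EE k := by
  induction m with
  | zero => exact hw
  | succ m ih => rw [Function.iterate_succ_apply']; exact phi_EE' ih

lemma hol_iter (m : ℕ) : ∀ (p : G × G) (l : ℝ → G),
    Flat (fun t => (phi^[m] (gam k t)).2.1) (fun t => jf p.1 p.2 (phi^[m] (gam k t)).1) l →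
    l (-1) = l 1 → (hW^[m] p).1 = 1 := by
  induction m with
  | zero => intro p l hl h; exact gam_hol hl h
  | succ m ih =>
    intro p l hl h
    rw [Function.iterate_succ_apply]
    simp only [Function.iterate_succ_apply'] at hl
    have hc : Continuous fun t => phi^[m] (gam k t) :=
      ((phi_contDiff (k := k)).continuous.iterate m).comp gam_cont
    have := flat_transfer hc hl (fun t => phi_iter_EE m (gam_EE t))
    refine ih (hW p) _ this ?_
    have : gam k (-1) = gam k 1 := by simp [gam]
    simp only [h, this]

lemma noNull_aux (p : G × G) (hp : ∀ m, (hW^[m] p).1 ≠ 1) (m : ℕ) (H : ℝ × ℝ → WW k)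
    (hH : Continuous H) (hE : ∀ d, phi^[m] (H d) ∈ EE k) (h0 : ∀ t, H (t, 0) = gam k t)
    (h1 : ∀ t, H (t, 1) = H (0, 1)) (hper : ∀ s, H (-1, s) = H (1, s)) : False := by
  have hc : Continuous fun d => phi^[m] (H d) :=
    ((phi_contDiff (k := k)).continuous.iterate m).comp hH
  have cx : Continuous fun d => (phi^[m] (H d)).1 := by fun_prop
  obtain ⟨l, hl⟩ := exists_flat (y := fun d => (phi^[m] (H d)).2.1) (by fun_prop)
    (fun d => jf p.1 p.2 (phi^[m] (H d)).1) (by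
      intro d hy0 hy1
      have hEd := hE d
      have g1 : ¬ |(phi^[m] (H d)).1 - 1| < 1 / 8 := fun h => by
        have := hEd.2.2.2.2.1 h
        rw [abs_of_pos hy0] at this; linarith
      have g2 : ¬ |(phi^[m] (H d)).1 + 1| < 1 / 8 := fun h => by
        have := hEd.2.2.2.2.2 h
        rw [abs_of_pos hy0] at this; linarith
      rcases lt_trichotomy (phi^[m] (H d)).1 (-1) with h | h | h
      · filter_upwards [cx.continuousAt.eventually (gt_mem_nhds h)] with d' e
        rw [jf_low _ _ h, jf_low _ _ e]
      · rw [h] at g2; norm_num at g2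
      rcases lt_trichotomy (phi^[m] (H d)).1 1 with h' | h' | h'
      · filter_upwards [cx.continuousAt.eventually (lt_mem_nhds h),
          cx.continuousAt.eventually (gt_mem_nhds h')] with d' e e'
        rw [jf_mid _ _ h.le h', jf_mid _ _ e.le e']
      · rw [h'] at g1; norm_num at g1
      · filter_upwards [cx.continuousAt.eventually (lt_mem_nhds h')] with d' e
        rw [jf_high _ _ h'.le, jf_high _ _ e.le])
  have F0 := hl.comp (h := fun t : ℝ => (t, (0 : ℝ))) (by fun_prop)
  have F1 := hl.comp (h := fun t : ℝ => (t, (1 : ℝ))) (by fun_prop)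
  have S0 := hl.comp (h := fun t : ℝ => ((-1 : ℝ), t)) (by fun_prop)
  have S1 := hl.comp (h := fun t : ℝ => ((1 : ℝ), t)) (by fun_prop)
  simp only [Function.comp_def, h0] at F0
  simp only [Function.comp_def, h1] at F1
  simp only [Function.comp_def, hper] at S0
  simp only [Function.comp_def] at S1
  have C1 : Flat (fun t : ℝ => (phi^[m] (H (0, 1))).2.1)
      (fun t : ℝ => jf p.1 p.2 (phi^[m] (H (0, 1))).1) (fun _ => (1 : G)) := by
    intro d; exact ⟨fun _ => Eventually.of_forall fun _ => rfl,
      fun _ => Eventually.of_forall fun _ => rfl⟩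
  have r1 := F1.ratio C1 (-1) 1
  have r2 := S0.ratio S1 0 1
  simp only [inv_one, mul_one] at r1
  rw [r1, mul_inv_cancel, mul_inv_eq_one] at r2
  exact hp m (hol_iter m p _ F0 r2)

/-- explicit holonomy data -/
def ga : Equiv.Perm (Fin 5) := ⟨![0, 1, 3, 4, 2], ![0, 1, 4, 2, 3], by decide, by decide⟩
/-- explicit holonomy data -/
def gb : Equiv.Perm (Fin 5) := ⟨![1, 2, 0, 3, 4], ![2, 0, 1, 3, 4], by decide, by decide⟩

set_option maxRecDepth 100000 in
lemma hW_period : hW^[6] (ga, gb) = (ga, gb) := by decide +kernel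

set_option maxRecDepth 100000 in
lemma hW_small : ∀ i : Fin 6, (hW^[i] (ga, gb)).1 ≠ 1 := by decide +kernel

lemma hW_ne (m : ℕ) : (hW^[m] (ga, gb)).1 ≠ 1 := by
  have h : (hW^[6 * (m / 6)]) (ga, gb) = (ga, gb) := by
    rw [Function.iterate_mul]
    generalize m / 6 = q
    induction q with
    | zero => rfl
    | succ q ih => rw [Function.iterate_succ_apply, hW_period, ih]
  have h2 := hW_small ⟨m % 6, Nat.mod_lt _ (by norm_num)⟩
  conv => enter [1, 1]; rw [← Nat.mod_add_div m 6, Function.iterate_add_apply, h]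
  exact h2

/-- The base loop is essential in the complement of all iterated preimages. -/
lemma noNull (m : ℕ) (H : ℝ × ℝ → WW k)
    (hH : Continuous H) (hE : ∀ d, phi^[m] (H d) ∈ EE k) (h0 : ∀ t, H (t, 0) = gam k t)
    (h1 : ∀ t, H (t, 1) = H (0, 1)) (hper : ∀ s, H (-1, s) = H (1, s)) : False :=
  noNull_aux (ga, gb) hW_ne m H hH hE h0 h1 hper

end holonomy
end transfer

end partC3

section partC4

section exhaustion
open Topology Filter Real
variable {k : ℕ}

/-- weighted box -/
def PN (R : ℝ) (w : WW k) : Prop :=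
  |w.1| ≤ R ∧ 2 * |w.2.1| ≤ R ∧ 4 * |w.2.2.1| ≤ R ∧ ‖w.2.2.2‖ ≤ R

lemma cYZ_le (w : WW k) : |cY w| ≤ |w.2.1| + |w.2.2.1| ∧ |cZ w| ≤ |w.2.1| + |w.2.2.1| := by
  have key : ∀ u v s c : ℝ, |s| ≤ 1 → |c| ≤ 1 → |u * s + v * c| ≤ |u| + |v| := by
    intro u v s c hs hc
    calc |u * s + v * c| ≤ |u * s| + |v * c| := abs_add_le _ _
      _ = |u| * |s| + |v| * |c| := by rw [abs_mul, abs_mul]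
      _ ≤ |u| + |v| := by nlinarith [abs_nonneg u, abs_nonneg v]
  constructor
  · exact key _ _ _ _ (abs_cos_le_one _) (abs_sin_le_one _)
  · rw [← abs_neg w.2.1]
    exact key _ _ _ _ (abs_sin_le_one _) (abs_cos_le_one _)

lemma PN_phi {R : ℝ} (hR : 8 ≤ R) {w : WW k} (h : PN R w) : PN R (phi w) := by
  obtain ⟨h1, h2, h3, h4⟩ := h
  obtain ⟨hY, hZ⟩ := cYZ_le w
  refine ⟨?_, ?_, ?_, ?_⟩
  · simp only [phi, abs_mul]; norm_num; linarith
  · have hf : |cY w| ≤ fY (R / 2) := by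
      have : fY (R / 2) = R / 2 * (1 + (R / 2) ^ 2) / 8 := by unfold fY; ring
      rw [this]
      nlinarith [mul_nonneg (by linarith : (0:ℝ) ≤ R) (by nlinarith : (0:ℝ) ≤ (R/2)^2 - 16)]
    have hn : fY (-(R / 2)) = -fY (R / 2) := by unfold fY; ring
    have : |fH.symm (cY w)| ≤ R / 2 := by
      rw [abs_le] at hf ⊢
      constructor
      · by_contra hc
        have := fH_symm_lt.1 (not_le.1 hc); linarith
      · by_contra hc
        have := lt_fH_symm.1 (not_le.1 hc); linarith
    simp only [phi]; linarith
  · simp only [phi, abs_div]; norm_num; linarith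
  · simp only [phi, norm_smul]; norm_num; linarith [norm_nonneg w.2.2.2]

lemma PN_tau {R : ℝ} {w : WW k} (h : PN R w) : PN (R / 100) ((1 / 100 : ℝ) • w) := by
  obtain ⟨h1, h2, h3, h4⟩ := h
  refine ⟨?_, ?_, ?_, ?_⟩ <;>
  simp only [Prod.smul_fst, Prod.smul_snd, smul_eq_mul, abs_mul, norm_smul] <;> norm_num <;>
  linarith

lemma PN_mono {R R' : ℝ} (h : R ≤ R') {w : WW k} (hw : PN R w) : PN R' w :=
  ⟨hw.1.trans h, hw.2.1.trans h, hw.2.2.1.trans h, hw.2.2.2.trans h⟩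

lemma PN_EE {w : WW k} (h : PN 0.08 w) : w ∈ EE k := by
  obtain ⟨h1, h2, h3, h4⟩ := h
  have h1' := abs_le.1 h1
  refine ⟨by linarith, by linarith, by linarith, by linarith, fun h => ?_, fun h => ?_⟩
  · have := abs_lt.1 h; linarith
  · have := abs_lt.1 h; linarith

/-- the two expanding maps -/
noncomputable def sE (k : ℕ) (b : Bool) : WW k ≃ WW k := if b then tauE else psiE

lemma exhaust {σ : ℕ → Bool} (hσ : ∀ j, ∃ i, j ≤ i ∧ σ i = true) {u : ℕ → WW k}
    (hu : ∀ j, u (j + 1) = (sE k (σ j)).symm (u j)) : ∃ j, u j ∈ EE k := by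
  have step : ∀ j R, 8 ≤ R → PN R (u j) → PN R (u (j + 1)) := by
    intro j R hR h
    rw [hu]
    cases hb : σ j
    · exact PN_phi hR h
    · exact PN_mono (by linarith) (PN_tau h)
  have stepτ : ∀ j R, σ j = true → PN R (u j) → PN (R / 100) (u (j + 1)) := by
    intro j R hb h
    rw [hu, hb]
    exact PN_tau h
  have steps : ∀ i j R, 8 ≤ R → j ≤ i → PN R (u j) → PN R (u i) := by
    intro i j R hR hij h
    induction i, hij using Nat.le_induction with
    | base => exact h
    | succ i _ ih => exact step i R hR ih
  obtain ⟨R, hR, h0⟩ : ∃ R, 8 ≤ R ∧ PN R (u 0) := by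
    refine ⟨max 8 (|(u 0).1| + 2 * |(u 0).2.1| + 4 * |(u 0).2.2.1| + ‖(u 0).2.2.2‖),
      le_max_left _ _, ?_⟩
    apply PN_mono (le_max_right _ _)
    have a1 := abs_nonneg (u 0).1
    have a2 := abs_nonneg (u 0).2.1
    have a3 := abs_nonneg (u 0).2.2.1
    have a4 := norm_nonneg (u 0).2.2.2
    refine ⟨?_, ?_, ?_, ?_⟩ <;> linarith
  have main : ∀ m : ℕ, ∃ j, PN (max 8 (R / 100 ^ m)) (u j) := by
    intro m
    induction m with
    | zero => exact ⟨0, PN_mono (by simp) h0⟩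
    | succ m ih =>
      obtain ⟨j, hj⟩ := ih
      obtain ⟨i, hi, hb⟩ := hσ j
      refine ⟨i + 1, PN_mono ?_ (stepτ i _ hb (steps i j _ (le_max_left _ _) hi hj))⟩
      rcases le_total 8 (R / 100 ^ m) with h | h
      · rw [max_eq_right h]
        apply le_max_of_le_right
        rw [pow_succ, div_div]
      · rw [max_eq_left h]; exact le_max_of_le_left (by norm_num)
  obtain ⟨m, hm⟩ := pow_unbounded_of_one_lt R (by norm_num : (1 : ℝ) < 100)
  obtain ⟨j, hj⟩ := main m
  obtain ⟨i, hi, hb⟩ := hσ j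
  refine ⟨i + 1, PN_EE (PN_mono ?_ (stepτ i _ hb (steps i j _ (le_max_left _ _) hi hj)))⟩
  have : R / 100 ^ m ≤ 1 := (div_le_one (by positivity)).2 hm.le
  rw [max_eq_left (by linarith)]; norm_num

end exhaustion

section nullhomotopy
open Topology Filter Real OnePoint
open scoped unitInterval

/-- complement in the one point compactification -/
def cpl {W : Type*} (S : Set W) : Set (OnePoint W) := {p | ∀ w ∈ S, p ≠ (w : OnePoint W)}

lemma infty_cpl {W : Type*} (S : Set W) : (OnePoint.infty : OnePoint W) ∈ cpl S :=
  fun _ _ => OnePoint.infty_ne_coe _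

lemma coe_cpl {W : Type*} {S : Set W} {w : W} : (w : OnePoint W) ∈ cpl S ↔ w ∉ S := by
  constructor
  · intro h hw; exact h w hw rfl
  · intro h v hv e; rw [OnePoint.coe_eq_coe] at e; exact h (e ▸ hv)

lemma cpl_mono {W : Type*} {S T : Set W} (h : S ⊆ T) : cpl T ⊆ cpl S :=
  fun _ hp w hw => hp w (h hw)

set_option linter.unusedSectionVars false

variable {W : Type*} [NormedAddCommGroup W] [NormedSpace ℝ W] [FiniteDimensional ℝ W]

lemma contAt_infty {Y : Type*} [TopologicalSpace Y] {u : Y → OnePoint W} {y : Y} (hy : u y = OnePoint.infty)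
    (h : ∀ R : ℝ, ∀ᶠ y' in 𝓝 y, ∀ w : W, u y' = w → R ≤ ‖w‖) : ContinuousAt u y := by
  have : ProperSpace W := FiniteDimensional.proper_real W
  intro s hs
  rw [hy] at hs
  obtain ⟨t, ht1, ht2, ht3⟩ := mem_nhds_iff.1 hs
  have hK := (OnePoint.isOpen_iff_of_mem ht3).1 ht2
  obtain ⟨R, hR⟩ := hK.2.isBounded.exists_norm_le
  rw [Filter.mem_map]
  filter_upwards [h (R + 1)] with y' h'
  apply ht1
  by_contra hc
  induction hu : u y' using OnePoint.rec with
  | infty => exact hc (hu ▸ ht3)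
  | coe w =>
    have h1 := hR w (by rw [hu] at hc; exact hc)
    have h2 := h' w hu
    linarith

lemma ev_infty {Y : Type*} [TopologicalSpace Y] {u : Y → OnePoint W} {y : Y} (hu : ContinuousAt u y)
    (hy : u y = OnePoint.infty) (R : ℝ) : ∀ᶠ y' in 𝓝 y, ∀ w : W, u y' = w → R ≤ ‖w‖ := by
  have : ProperSpace W := FiniteDimensional.proper_real W
  have ho : IsOpen (cpl (Metric.closedBall (0 : W) R)) := by
    rw [OnePoint.isOpen_iff_of_mem (infty_cpl _)]
    have : (((↑) : W → OnePoint W) ⁻¹' cpl (Metric.closedBall (0 : W) R))ᶜ =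
        Metric.closedBall 0 R := by
      ext w; simp only [Set.mem_compl_iff, Set.mem_preimage, coe_cpl, not_not]
    rw [this]
    exact ⟨Metric.isClosed_closedBall, isCompact_closedBall _ _⟩
  filter_upwards [hu.eventually (ho.mem_nhds (hy ▸ infty_cpl _))] with y' h w hw
  rw [hw] at h
  have := coe_cpl.1 h
  rw [mem_closedBall_zero_iff, not_le] at this
  exact this.le

/-- radial push to infinity -/
noncomputable def push (t : ℝ) : OnePoint W → OnePoint W
  | OnePoint.infty => OnePoint.infty
  | OnePoint.some w => if t < 1 then ((1 - t)⁻¹ • w : W) else OnePoint.infty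

omit [FiniteDimensional ℝ W] in
lemma push_coe (t : ℝ) (w : W) :
    push t (w : OnePoint W) = if t < 1 then (((1 - t)⁻¹ • w : W) : OnePoint W) else OnePoint.infty := rfl

omit [FiniteDimensional ℝ W] in
lemma push_infty (t : ℝ) : push t (OnePoint.infty : OnePoint W) = OnePoint.infty := rfl

lemma contAt_coe {Y Z : Type*} [TopologicalSpace Y] [TopologicalSpace Z] {u : Y × OnePoint W → Z}
    {y : Y} {w : W} (h : ContinuousAt (fun q : Y × W => u (q.1, (q.2 : OnePoint W))) (y, w)) :
    ContinuousAt u (y, (w : OnePoint W)) := by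
  have := (Topology.IsOpenEmbedding.id (X := Y)).prodMap (OnePoint.isOpenEmbedding_coe (X := W))
  exact (this.continuousAt_iff (g := u) (x := (y, w))).1 h

lemma push_cont (t : I) {p : OnePoint W} (hp : p ≠ ((0 : W) : OnePoint W)) :
    ContinuousAt (fun q : I × OnePoint W => push (q.1 : ℝ) q.2) (t, p) := by
  induction p using OnePoint.rec with
  | infty =>
    refine contAt_infty (push_infty (t : ℝ)) ?_
    intro R
    filter_upwards [ev_infty (u := Prod.snd) (y := (t, (OnePoint.infty : OnePoint W))) continuousAt_snd rfl R]
      with q hq w hw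
    obtain ⟨s, p⟩ := q
    induction p using OnePoint.rec with
    | infty => exact absurd hw (OnePoint.infty_ne_coe _)
    | coe v =>
      have hv := hq v rfl
      dsimp only at hw
      rw [push_coe] at hw
      split_ifs at hw with hs
      · rw [OnePoint.coe_eq_coe] at hw
        rw [← hw, norm_smul]
        have h1 : 1 ≤ (1 - (s : ℝ))⁻¹ := (one_le_inv₀ (by linarith)).2 (by linarith [s.2.1])
        have h2 : ‖(1 - (s : ℝ))⁻¹‖ = (1 - (s : ℝ))⁻¹ := by
          rw [Real.norm_eq_abs, abs_of_nonneg (by linarith)]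
        rw [h2]
        nlinarith [norm_nonneg v]
      · exact absurd hw (OnePoint.infty_ne_coe _)
  | coe w =>
    apply contAt_coe
    rcases lt_or_ge (t : ℝ) 1 with ht | ht
    · have h1 : ContinuousAt (fun q : I × W => (((1 - (q.1 : ℝ))⁻¹ • q.2 : W) : OnePoint W))
          (t, w) := by
        apply (OnePoint.continuous_coe).continuousAt.comp
        apply ContinuousAt.smul _ continuousAt_snd
        apply ContinuousAt.inv₀ (by fun_prop)
        simp only; linarith
      apply h1.congr
      have h2 : ∀ᶠ q : I × W in 𝓝 (t, w), (q.1 : ℝ) < 1 := by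
        apply ContinuousAt.eventually_lt (by fun_prop) continuousAt_const (by exact ht)
      filter_upwards [h2] with q hq
      rw [push_coe, if_pos hq]
    · apply contAt_infty
      · dsimp only
        rw [push_coe, if_neg (not_lt.2 ht)]
      intro R
      have hw : w ≠ 0 := fun h => hp (by rw [h])
      have hw' := norm_pos_iff.2 hw
      have ht1 : (t : ℝ) = 1 := le_antisymm t.2.2 ht
      have h2 : ∀ᶠ q : I × W in 𝓝 (t, w), R * (1 - (q.1 : ℝ)) < ‖q.2‖ := by
        apply ContinuousAt.eventually_lt (by fun_prop) (by fun_prop)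
        simp only [ht1]; simpa using hw'
      filter_upwards [h2] with q hq v hv
      rw [push_coe] at hv
      split_ifs at hv with hs
      · rw [OnePoint.coe_eq_coe] at hv
        have h0 : 0 < 1 - (q.1 : ℝ) := by linarith
        rw [← hv, norm_smul, norm_inv, Real.norm_eq_abs, abs_of_pos h0, inv_mul_eq_div,
          le_div_iff₀ h0]
        exact hq.le
      · exact absurd hv (OnePoint.infty_ne_coe _)

/-- the inclusion of complements, as a continuous map -/
def cInc {W : Type*} [TopologicalSpace W] {S T : Set W} (h : S ⊆ T) : C(cpl T, cpl S) :=
  ⟨Set.inclusion (cpl_mono h), continuous_inclusion _⟩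

lemma null_star {B E : Set W} (hEB : E ⊆ B) (h0 : (0 : W) ∈ B)
    (hB : ∀ w, w ∉ B → ∀ c : ℝ, 1 ≤ c → c • w ∉ B) :
    ContinuousMap.Homotopic (cInc hEB) (ContinuousMap.const _ ⟨OnePoint.infty, infty_cpl E⟩) := by
  have hmem : ∀ (t : I) (p : OnePoint W), p ∈ cpl B → push (t : ℝ) p ∈ cpl E := by
    intro t p hp
    induction p using OnePoint.rec with
    | infty => exact infty_cpl _
    | coe w =>
      rw [push_coe]
      split_ifs with hs
      · rw [coe_cpl] at hp ⊢
        intro h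
        exact hB w hp _ ((one_le_inv₀ (by linarith)).2 (by linarith [t.2.1])) (hEB h)
      · exact infty_cpl _
  refine ⟨⟨⟨fun q => ⟨push (q.1 : ℝ) q.2.1, hmem q.1 _ q.2.2⟩, ?_⟩, ?_, ?_⟩⟩
  · apply Continuous.subtype_mk
    rw [continuous_iff_continuousAt]
    rintro ⟨t, p, hp⟩
    have h1 := push_cont t (p := p) (fun h => hp 0 h0 h)
    exact ContinuousAt.comp (f := fun q : I × cpl B => (q.1, q.2.1))
      (g := fun q : I × OnePoint W => push (q.1 : ℝ) q.2) h1 (by fun_prop)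
  · rintro ⟨p, hp⟩
    apply Subtype.ext
    induction p using OnePoint.rec with
    | infty => rfl
    | coe w => simp [push_coe, cInc]
  · rintro ⟨p, hp⟩
    apply Subtype.ext
    induction p using OnePoint.rec with
    | infty => rfl
    | coe w => simp [push_coe]

/-- extension of a bounded perturbation -/
noncomputable def ext1 (T : I × W → W) : I × OnePoint W → OnePoint W
  | (_, OnePoint.infty) => OnePoint.infty
  | (t, OnePoint.some w) => (T (t, w) : OnePoint W)

omit [NormedSpace ℝ W] [FiniteDimensional ℝ W] in
lemma ext1_coe (T : I × W → W) (t : I) (w : W) : ext1 T (t, (w : OnePoint W)) = T (t, w) := rfl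

omit [NormedSpace ℝ W] [FiniteDimensional ℝ W] in
lemma ext1_infty (T : I × W → W) (t : I) : ext1 T (t, (OnePoint.infty : OnePoint W)) = OnePoint.infty := rfl

lemma ext1_cont {T : I × W → W} (hT : Continuous T) {M : ℝ} (hM : ∀ t w, ‖T (t, w) - w‖ ≤ M) :
    Continuous (ext1 T) := by
  rw [continuous_iff_continuousAt]
  rintro ⟨t, p⟩
  induction p using OnePoint.rec with
  | infty =>
    apply contAt_infty (ext1_infty _ _)
    intro R
    filter_upwards [ev_infty (u := Prod.snd) (y := (t, (OnePoint.infty : OnePoint W))) continuousAt_snd rfl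
      (R + M)] with q hq w hw
    obtain ⟨s, p⟩ := q
    induction p using OnePoint.rec with
    | infty => exact absurd hw (OnePoint.infty_ne_coe _)
    | coe v =>
      have hv := hq v rfl
      rw [ext1_coe, OnePoint.coe_eq_coe] at hw
      have h1 := hM s v
      rw [hw] at h1
      have h2 : ‖v‖ ≤ ‖w‖ + ‖w - v‖ := by
        have := norm_sub_le w (w - v)
        simpa using this
      linarith
  | coe w =>
    apply contAt_coe
    exact (OnePoint.continuous_coe.comp hT).continuousAt

lemma null_two {S B E : Set W} (hEB : E ⊆ B) (h0 : (0 : W) ∈ B)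
    (hB : ∀ w, w ∉ B → ∀ c : ℝ, 1 ≤ c → c • w ∉ B) (hES : E ⊆ S)
    {T : I × W → W} (hT : Continuous T) {M : ℝ} (hM : ∀ t w, ‖T (t, w) - w‖ ≤ M)
    (hT0 : ∀ w, T (0, w) = w) (hTE : ∀ t w, w ∉ S → T (t, w) ∉ E)
    (hTB : ∀ w, w ∉ S → T (1, w) ∉ B) :
    ContinuousMap.Homotopic (cInc hES) (ContinuousMap.const _ ⟨OnePoint.infty, infty_cpl E⟩) := by
  have hc := ext1_cont hT hM
  have m1 : ∀ (t : I) (p : OnePoint W), p ∈ cpl S → ext1 T (t, p) ∈ cpl E := by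
    intro t p hp
    induction p using OnePoint.rec with
    | infty => exact infty_cpl _
    | coe w => exact coe_cpl.2 (hTE t w (coe_cpl.1 hp))
  have m2 : ∀ (p : OnePoint W), p ∈ cpl S → ext1 T (1, p) ∈ cpl B := by
    intro p hp
    induction p using OnePoint.rec with
    | infty => exact infty_cpl _
    | coe w => exact coe_cpl.2 (hTB w (coe_cpl.1 hp))
  let g : C(cpl S, cpl B) := ⟨fun p => ⟨ext1 T (1, p.1), m2 _ p.2⟩, by fun_prop⟩
  have h1 : ContinuousMap.Homotopic (cInc hES) ((cInc hEB).comp g) := by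
    refine ⟨⟨⟨fun q => ⟨ext1 T (q.1, q.2.1), m1 q.1 _ q.2.2⟩, by fun_prop⟩, ?_, ?_⟩⟩
    · rintro ⟨p, hp⟩
      apply Subtype.ext
      induction p using OnePoint.rec with
      | infty => rfl
      | coe w => simp [ext1_coe, cInc, hT0]
    · rintro ⟨p, hp⟩
      rfl
  refine h1.trans ?_
  exact (null_star hEB h0 hB).comp (ContinuousMap.Homotopic.refl g)

end nullhomotopy

end partC4

section partC5
open Topology Filter Real OnePoint
open scoped unitInterval

section nullspec
variable {k : ℕ}

def BX (k : ℕ) : Set (WW k) :=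
  {w | |w.1| ≤ 4 ∧ |w.2.1| ≤ 3 ∧ |w.2.2.1| ≤ 1 / 10 ∧ ‖w.2.2.2‖ ≤ 1}

lemma EE_BX : EE k ⊆ BX k := fun _ hw => ⟨hw.1, hw.2.1, hw.2.2.1, hw.2.2.2.1⟩

lemma zero_BX : (0 : WW k) ∈ BX k := by
  refine ⟨?_, ?_, ?_, ?_⟩ <;> simp

lemma BX_star (w : WW k) (hw : w ∉ BX k) (c : ℝ) (hc : 1 ≤ c) : c • w ∉ BX k := by
  intro h
  apply hw
  obtain ⟨h1, h2, h3, h4⟩ := h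
  have hc' : |c| = c := abs_of_nonneg (by linarith)
  simp only [Prod.smul_fst, Prod.smul_snd, smul_eq_mul, abs_mul, norm_smul, Real.norm_eq_abs,
    hc'] at h1 h2 h3 h4
  refine ⟨?_, ?_, ?_, ?_⟩
  · nlinarith [abs_nonneg w.1]
  · nlinarith [abs_nonneg w.2.1]
  · nlinarith [abs_nonneg w.2.2.1]
  · nlinarith [norm_nonneg w.2.2.2]

noncomputable def bmp (a b u : ℝ) : ℝ := max 0 (min 1 ((b - u) / (b - a)))

lemma bmp_one {a b u : ℝ} (hab : a < b) (h : u ≤ a) : bmp a b u = 1 := by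
  unfold bmp
  rw [min_eq_left, max_eq_right zero_le_one]
  rw [le_div_iff₀ (by linarith)]; linarith

lemma bmp_zero {a b u : ℝ} (hab : a < b) (h : b ≤ u) : bmp a b u = 0 := by
  unfold bmp
  apply max_eq_left
  apply min_le_of_right_le
  apply div_nonpos_of_nonpos_of_nonneg <;> linarith

lemma bmp_nonneg (a b u : ℝ) : 0 ≤ bmp a b u := le_max_left _ _
lemma bmp_le (a b u : ℝ) : bmp a b u ≤ 1 := max_le zero_le_one (min_le_left _ _)

lemma bmp_cont (a b : ℝ) : Continuous (bmp a b) := by unfold bmp; fun_prop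

noncomputable def kpp (w : WW k) : ℝ :=
  max (-1) (min 1 (cZ w / (7 / 10))) * (bmp 4 8 |w.1| * bmp 1 2 ‖w.2.2.2‖ *
    bmp (1 / 4) (15 / 4) |cY w| * bmp (9 / 10) (16 / 5) |cZ w|)

lemma kap_cont : Continuous (kpp (k := k)) := by
  have h1 := (cY_contDiff (k := k)).continuous
  have h2 := (cZ_contDiff (k := k)).continuous
  unfold kpp
  have b1 := bmp_cont 4 8
  have b2 := bmp_cont 1 2
  have b3 := bmp_cont (1 / 4) (15 / 4)
  have b4 := bmp_cont (9 / 10) (16 / 5)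
  fun_prop

lemma kap_bd (w : WW k) : |kpp w| ≤ 1 := by
  unfold kpp
  have key : ∀ a b c d e : ℝ, |a| ≤ 1 → 0 ≤ b → b ≤ 1 → 0 ≤ c → c ≤ 1 → 0 ≤ d → d ≤ 1 → 0 ≤ e →
      e ≤ 1 → |a * (b * c * d * e)| ≤ 1 := by
    intro a b c d e ha hb hb' hc hc' hd hd' he he'
    rw [abs_mul, abs_of_nonneg (by positivity : 0 ≤ b * c * d * e)]
    have h1 : b * c ≤ 1 := mul_le_one₀ hb' hc hc'
    have h2 : b * c * d ≤ 1 := mul_le_one₀ h1 hd hd'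
    have h3 : b * c * d * e ≤ 1 := mul_le_one₀ h2 he he'
    exact mul_le_one₀ ha (by positivity) h3
  apply key _ _ _ _ _ ?_ (bmp_nonneg _ _ _) (bmp_le _ _ _) (bmp_nonneg _ _ _) (bmp_le _ _ _)
    (bmp_nonneg _ _ _) (bmp_le _ _ _) (bmp_nonneg _ _ _) (bmp_le _ _ _)
  rw [abs_le]
  exact ⟨le_max_left _ _, max_le (by norm_num) (min_le_left _ _)⟩

noncomputable def TT (q : I × WW k) : WW k :=
  (q.2.1, q.2.2.1, q.2.2.2.1 + q.1 * (2 * kpp q.2), q.2.2.2.2)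

lemma TT_cont : Continuous (TT (k := k)) := by
  have := kap_cont (k := k)
  unfold TT; fun_prop

lemma TT_bd (t : I) (w : WW k) : ‖TT (t, w) - w‖ ≤ 2 := by
  have h : TT (t, w) - w = (0, 0, t * (2 * kpp w), 0) := by
    unfold TT
    refine Prod.ext ?_ (Prod.ext ?_ (Prod.ext ?_ ?_)) <;> simp
  rw [h, Prod.norm_mk, Prod.norm_mk, Prod.norm_mk]
  have h1 : ‖(t : ℝ) * (2 * kpp w)‖ ≤ 2 := by
    rw [norm_mul, norm_mul, Real.norm_eq_abs, Real.norm_eq_abs, Real.norm_eq_abs, abs_of_nonneg t.2.1]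
    rw [abs_of_pos (by norm_num : (0:ℝ) < 2)]
    have := kap_bd w
    have h2 := mul_le_one₀ t.2.2 (abs_nonneg _) this
    linarith
  simpa using h1

lemma phi_notEE {w : WW k} (h : phi w ∉ EE k) :
    8 < |w.1| ∨ 15 / 4 < |cY w| ∨ 16 / 5 < |cZ w| ∨ 2 < ‖w.2.2.2‖ ∨
    (∃ e : ℝ, (e = 1 ∨ e = -1) ∧ 7 / 10 < e * cZ w ∧ e * cZ w < 9 / 10 ∧ |cY w| < 1 / 4) := by
  by_contra hc
  push Not at hc
  obtain ⟨h1, h2, h3, h4, h5⟩ := hc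
  apply h
  have f3 : fY 3 = 15 / 4 := by unfold fY; norm_num
  have f3' : fY (-3) = -(15 / 4) := by unfold fY; norm_num
  have f1 : fY 1 = 1 / 4 := by unfold fY; norm_num
  have f1' : fY (-1) = -(1 / 4) := by unfold fY; norm_num
  have Y1 : |fH.symm (cY w)| < 1 → |cY w| < 1 / 4 := by
    intro h
    rw [abs_lt] at h ⊢
    rw [fH_symm_lt, lt_fH_symm, f1, f1'] at h
    exact h
  refine ⟨?_, ?_, ?_, ?_, ?_, ?_⟩
  · change |cZ w * (5 / 4)| ≤ 4
    rw [abs_mul, abs_of_pos (by norm_num : (0:ℝ) < 5 / 4)]; linarith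
  · change |fH.symm (cY w)| ≤ 3
    rw [abs_le] at h2 ⊢
    rw [← not_lt, ← not_lt, fH_symm_lt, lt_fH_symm, f3, f3', not_lt, not_lt]
    exact h2
  · change |w.1 / 80| ≤ 1 / 10
    rw [abs_div, abs_of_pos (by norm_num : (0:ℝ) < 80)]; linarith
  · change ‖(1 / 2 : ℝ) • w.2.2.2‖ ≤ 1
    rw [norm_smul]; norm_num; linarith
  · change |cZ w * (5 / 4) - 1| < 1 / 8 → 1 ≤ |fH.symm (cY w)|
    intro hz
    by_contra hy
    rw [abs_lt] at hz
    have := h5 1 (Or.inl rfl) (by linarith) (by linarith)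
    linarith [Y1 (not_le.1 hy)]
  · change |cZ w * (5 / 4) + 1| < 1 / 8 → 1 ≤ |fH.symm (cY w)|
    intro hz
    by_contra hy
    rw [abs_lt] at hz
    have := h5 (-1) (Or.inr rfl) (by linarith) (by linarith)
    linarith [Y1 (not_le.1 hy)]

lemma TT_kap0 {w : WW k} (h : kpp w = 0) (t : I) : TT (t, w) = w := by
  unfold TT; simp [h]

lemma notBX_of_sq {w : WW k} (h : 10 < cY w ^ 2 + cZ w ^ 2) : w ∉ BX k := by
  rintro ⟨-, h2, h3, -⟩
  rw [cY_sq_cZ] at h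
  rw [abs_le] at h2 h3
  nlinarith

lemma TT_main {w : WW k} (h : phi w ∉ EE k) (t : I) :
    TT (t, w) ∉ EE k ∧ TT (1, w) ∉ BX k := by
  have triv : kpp w = 0 → w ∉ BX k → TT (t, w) ∉ EE k ∧ TT (1, w) ∉ BX k := by
    intro h1 h2
    rw [TT_kap0 h1, TT_kap0 h1]
    exact ⟨fun h => h2 (EE_BX h), h2⟩
  rcases phi_notEE h with h1 | h1 | h1 | h1 | ⟨e, he, h1, h2, h3⟩
  · apply triv
    · unfold kpp; rw [bmp_zero (by norm_num) h1.le]; ring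
    · intro h; linarith [h.1]
  · apply triv
    · unfold kpp; rw [bmp_zero (a := 1 / 4) (by norm_num) h1.le]; ring
    · apply notBX_of_sq; rw [← sq_abs (cY w)]; nlinarith [sq_nonneg (cZ w)]
  · apply triv
    · unfold kpp; rw [bmp_zero (a := 9 / 10) (by norm_num) h1.le]; ring
    · apply notBX_of_sq; rw [← sq_abs (cZ w)]; nlinarith [sq_nonneg (cY w)]
  · apply triv
    · unfold kpp; rw [bmp_zero (a := 1) (u := ‖w.2.2.2‖) (by norm_num) h1.le]; ring
    · intro h; linarith [h.2.2.2]
  · by_cases hx : |w.1| ≤ 4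
    swap
    · exact ⟨fun h => hx h.1, fun h => hx h.1⟩
    by_cases hq : ‖w.2.2.2‖ ≤ 1
    swap
    · exact ⟨fun h => hq h.2.2.2.1, fun h => hq h.2.2.2⟩
    have hk : kpp w = e := by
      unfold kpp
      have hz : |cZ w| ≤ 9 / 10 := by
        rcases he with rfl | rfl <;> rw [abs_le] <;> constructor <;> linarith
      rw [bmp_one (by norm_num) hx, bmp_one (by norm_num) hq, bmp_one (by norm_num) h3.le,
        bmp_one (by norm_num) hz]
      rcases he with rfl | rfl
      · rw [min_eq_left, max_eq_right] <;> [norm_num; norm_num; skip]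
        rw [le_div_iff₀ (by norm_num)]; linarith
      · rw [max_eq_left]
        · norm_num
        apply min_le_of_right_le
        rw [div_le_iff₀ (by norm_num)]; linarith
    have hsq := cY_sq_cZ w
    have e2 : e ^ 2 = 1 := by rcases he with rfl | rfl <;> norm_num
    have hZ : cZ w ^ 2 ≤ 81 / 100 := by
      have : (e * cZ w) ^ 2 = cZ w ^ 2 := by rw [mul_pow, e2, one_mul]
      rw [← this]; nlinarith
    have hY : cY w ^ 2 ≤ 1 / 16 := by rw [← sq_abs]; nlinarith [abs_nonneg (cY w)]
    have hy1 : |w.2.1| < 1 := by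
      rw [← sq_lt_one_iff_abs_lt_one]; nlinarith [sq_nonneg w.2.2.1]
    have hz1 : |w.2.2.1| < 1 := by
      rw [← sq_lt_one_iff_abs_lt_one]; nlinarith [sq_nonneg w.2.1]
    constructor
    · rintro ⟨g1, g2, g3, g4, g5, g6⟩
      change |w.1 - 1| < 1 / 8 → 1 ≤ |w.2.1| at g5
      change |w.1 + 1| < 1 / 8 → 1 ≤ |w.2.1| at g6
      have x1 : 1 / 16 ≤ |w.1 - 1| := by
        by_contra hh; linarith [g5 (by linarith)]
      have x2 : 1 / 16 ≤ |w.1 + 1| := by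
        by_contra hh; linarith [g6 (by linarith)]
      obtain ⟨s0, c1⟩ := sin_gap x1 x2
      have hz : cZ w = w.2.2.1 := by unfold cZ; rw [s0, c1]; ring
      change |w.2.2.1 + t * (2 * kpp w)| ≤ 1 / 10 at g3
      rw [hk] at g3
      rw [hz] at h1
      have := t.2.1
      rw [abs_le] at g3
      rcases he with rfl | rfl <;> linarith
    · rintro ⟨g1, g2, g3, g4⟩
      change |w.2.2.1 + ((1 : I) : ℝ) * (2 * kpp w)| ≤ 1 / 10 at g3
      rw [hk] at g3
      rw [abs_le] at g3
      rw [abs_lt] at hz1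
      simp only [Set.Icc.coe_one] at g3
      rcases he with rfl | rfl <;> linarith

lemma sE_sub (b : Bool) : EE k ⊆ {w | (sE k b).symm w ∈ EE k} := by
  intro w hw
  cases b
  · have h := interior_subset (EO_sub (phi_EE hw)); exact h
  · have h := interior_subset (EO_sub (tau_EE hw)); exact h

lemma null_b (b : Bool) :
    ContinuousMap.Homotopic (cInc (sE_sub (k := k) b))
      (ContinuousMap.const _ ⟨OnePoint.infty, infty_cpl (EE k)⟩) := by
  cases b
  · apply null_two EE_BX zero_BX BX_star _ TT_cont TT_bd
    · intro w; unfold TT; simp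
    · intro t w hw; exact (TT_main hw t).1
    · intro w hw; exact (TT_main hw 0).2
  · have hB : BX k ⊆ {w | (sE k true).symm w ∈ EE k} := by
      rintro w ⟨h1, h2, h3, h4⟩
      change (1 / 100 : ℝ) • w ∈ EE k
      have hx : |(1 / 100 : ℝ) * w.1| ≤ 1 / 25 := by
        rw [abs_mul, abs_of_pos (by norm_num : (0:ℝ) < 1 / 100)]; linarith
      have hx' := abs_le.1 hx
      refine ⟨?_, ?_, ?_, ?_, ?_, ?_⟩
      · change |(1 / 100 : ℝ) * w.1| ≤ 4; linarith
      · change |(1 / 100 : ℝ) * w.2.1| ≤ 3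
        rw [abs_mul, abs_of_pos (by norm_num : (0:ℝ) < 1 / 100)]; linarith
      · change |(1 / 100 : ℝ) * w.2.2.1| ≤ 1 / 10
        rw [abs_mul, abs_of_pos (by norm_num : (0:ℝ) < 1 / 100)]; linarith
      · change ‖(1 / 100 : ℝ) • w.2.2.2‖ ≤ 1
        rw [norm_smul]; norm_num; linarith
      · change |(1 / 100 : ℝ) * w.1 - 1| < 1 / 8 → _
        intro h; rw [abs_lt] at h; linarith
      · change |(1 / 100 : ℝ) * w.1 + 1| < 1 / 8 → _
        intro h; rw [abs_lt] at h; linarith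
    exact (null_star EE_BX zero_BX BX_star).comp (ContinuousMap.Homotopic.refl (cInc hB))

end nullspec

end partC5

section partA1
open Topology Filter Real OnePoint

section dat

/-- iterated change of charts -/
def Psi {W : Type} (s : Bool → W ≃ W) (σ : ℕ → Bool) : ℕ → (W ≃ W)
  | 0 => Equiv.refl W
  | j + 1 => (s (σ j)).trans (Psi s σ j)

/-- the dynamical data -/
structure Dat (W : Type) [NormedAddCommGroup W] [NormedSpace ℝ W] where
  s : Bool → W ≃ W
  σ : ℕ → Bool
  E : Set W
  sC : ∀ b, ContDiff ℝ 1 (s b)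
  tC : ∀ b, ContDiff ℝ 1 (s b).symm
  Ec : IsCompact E
  En : E.Nonempty
  Ei : ∀ b, ∀ e ∈ E, (s b).symm e ∈ interior E
  exh : ∀ w, ∃ j, (Psi s σ j).symm w ∈ E

variable {W : Type} [NormedAddCommGroup W] [NormedSpace ℝ W]

namespace Dat
variable (D : Dat W)

def P (j : ℕ) : W ≃ W := Psi D.s D.σ j

lemma P_zero : D.P 0 = Equiv.refl W := rfl
lemma P_succ (j : ℕ) (z : W) : D.P (j + 1) z = D.P j (D.s (D.σ j) z) := rfl
lemma P_succ_symm (j : ℕ) (z : W) :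
    (D.P (j + 1)).symm z = (D.s (D.σ j)).symm ((D.P j).symm z) := rfl

lemma P_contDiff (j : ℕ) : ContDiff ℝ 1 (D.P j) := by
  induction j with
  | zero => exact contDiff_id
  | succ j ih => exact ih.comp (D.sC _)

lemma P_symm_contDiff (j : ℕ) : ContDiff ℝ 1 (D.P j).symm := by
  induction j with
  | zero => exact contDiff_id
  | succ j ih => exact (D.tC _).comp ih

def Ph (j : ℕ) : W ≃ₜ W where
  toEquiv := D.P j
  continuous_toFun := (D.P_contDiff j).continuous
  continuous_invFun := (D.P_symm_contDiff j).continuous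

def S (j : ℕ) : Set W := {x | (D.P j).symm x ∈ D.E}

lemma mem_S {j : ℕ} {x : W} : x ∈ D.S j ↔ (D.P j).symm x ∈ D.E := Iff.rfl

lemma S_succ (j : ℕ) : D.S j ⊆ D.S (j + 1) := fun x hx =>
  show (D.P (j + 1)).symm x ∈ D.E from interior_subset (D.Ei _ _ hx)

lemma S_mono {i j : ℕ} (h : i ≤ j) : D.S i ⊆ D.S j :=
  monotone_nat_of_le_succ (f := D.S) D.S_succ h

lemma S_compact (j : ℕ) : IsCompact (D.S j) := by
  have : D.S j = (D.Ph j) '' D.E := by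
    ext x
    constructor
    · intro h; exact ⟨_, h, (D.P j).apply_symm_apply x⟩
    · rintro ⟨z, hz, rfl⟩
      change (D.P j).symm (D.P j z) ∈ D.E
      rwa [Equiv.symm_apply_apply]
  rw [this]
  exact D.Ec.image (D.Ph j).continuous

/-- the shell in chart coordinates -/
def Z (j : ℕ) : Set W := {z | z ∈ D.E ∧ ∀ i, i + 1 = j → D.P j z ∉ D.S i}

lemma exists_Z (x : W) : ∃ j z, z ∈ D.Z j ∧ D.P j z = x ∧ ∀ i, x ∈ D.S i → j ≤ i := by
  classical
  have h := D.exh x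
  refine ⟨Nat.find h, (D.P (Nat.find h)).symm x, ⟨Nat.find_spec h, ?_⟩,
    (D.P _).apply_symm_apply x, ?_⟩
  · intro i hi
    rw [Equiv.apply_symm_apply]
    exact Nat.find_min h (by omega)
  · intro i hi; exact Nat.find_min' h hi

lemma Z_not_S {i j : ℕ} {z : W} (hz : z ∈ D.Z j) (h : i < j) : D.P j z ∉ D.S i := by
  intro h'
  obtain ⟨l, rfl⟩ : ∃ l, j = l + 1 := ⟨j - 1, by omega⟩
  exact hz.2 l rfl (D.S_mono (by omega) h')

lemma Z_nonempty [Nontrivial W] [FiniteDimensional ℝ W] (j : ℕ) : (D.Z j).Nonempty := by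
  cases j with
  | zero =>
    obtain ⟨e, he⟩ := D.En
    exact ⟨e, he, fun i hi => absurd hi (by omega)⟩
  | succ j =>
    by_contra hc
    rw [Set.not_nonempty_iff_eq_empty] at hc
    have hsub : D.E ⊆ interior D.E := by
      intro e he
      by_contra hi
      have : e ∈ D.Z (j + 1) := by
        refine ⟨he, ?_⟩
        intro i hij h
        obtain rfl : i = j := by omega
        rw [mem_S, P_succ, Equiv.symm_apply_apply] at h
        apply hi
        have := D.Ei (D.σ i) _ h
        rwa [Equiv.symm_apply_apply] at this
      rw [hc] at this
      exact this
    have ho : IsOpen D.E := by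
      rw [← interior_eq_iff_isOpen]; exact Set.Subset.antisymm interior_subset hsub
    have hcl : IsClopen D.E := ⟨D.Ec.isClosed, ho⟩
    have := hcl.eq_univ D.En
    have hc := D.Ec
    rw [this] at hc
    exact NoncompactSpace.noncompact_univ hc

end Dat

/-- the metric estimates -/
structure Est (D : Dat W) {X : Type} [MetricSpace X] (e : OnePoint W ≃ₜ X) (c δ L : ℝ) : Prop where
  c0 : 0 < c
  d0 : 0 < δ
  d1 : δ ≤ 1
  L1 : 1 ≤ L
  up : ∀ j, ∀ z ∈ D.Z j, ∀ z' ∈ Metric.ball z δ, ∀ z'' ∈ Metric.ball z δ,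
    dist (e (D.P j z' : W)) (e (D.P j z'' : W)) ≤ L * (1 / 2) ^ j * dist z' z''
  lo : ∀ j, ∀ z ∈ D.Z j, ∀ z' ∈ Metric.ball z δ, ∀ z'' ∈ Metric.ball z δ,
    c * (1 / 2) ^ j * dist z' z'' ≤ dist (e (D.P j z' : W)) (e (D.P j z'' : W))
  far : ∀ j, ∀ z ∈ D.Z j, ∀ ρ ≤ δ, ∀ p : X, (∀ z' ∈ Metric.ball z ρ, p ≠ e (D.P j z' : W)) →
    c * (1 / 2) ^ j * ρ ≤ dist (e (D.P j z : W)) p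
  inf : ∀ j, ∀ x : W, x ∉ D.S j → dist (e (x : OnePoint W)) (e OnePoint.infty) ≤ L * (1 / 2) ^ j

namespace Est
variable {D : Dat W} {X : Type} [MetricSpace X] {e : OnePoint W ≃ₜ X} {c δ L : ℝ}

lemma inf_lo (h : Est D e c δ L) {j : ℕ} {x : W} (hx : x ∈ D.S j) :
    c * δ * (1 / 2) ^ j ≤ dist (e (x : OnePoint W)) (e OnePoint.infty) := by
  obtain ⟨i, z, hz, rfl, hi⟩ := D.exists_Z x
  have h1 := h.far i z hz δ le_rfl (e OnePoint.infty) (fun z' _ hh =>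
    OnePoint.infty_ne_coe _ (e.injective hh))
  have h2 : ((1 : ℝ) / 2) ^ j ≤ (1 / 2) ^ i :=
    pow_le_pow_of_le_one (by norm_num) (by norm_num) (hi j hx)
  have := mul_le_mul_of_nonneg_left h2 (mul_pos h.c0 h.d0).le
  linarith

/-- distance to infinity from a shell -/
lemma inf_up (h : Est D e c δ L) : ∃ M, 1 ≤ M ∧ ∀ j, ∀ z ∈ D.Z j,
    dist (e (D.P j z : W)) (e OnePoint.infty) ≤ M * (1 / 2) ^ j := by
  have : CompactSpace X := e.compactSpace
  have hb : Bornology.IsBounded (Set.univ : Set X) := isCompact_univ.isBounded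
  have hL := h.L1
  have hd : 0 ≤ Metric.diam (Set.univ : Set X) := Metric.diam_nonneg
  refine ⟨2 * L + Metric.diam (Set.univ : Set X), by linarith, ?_⟩
  intro j z hz
  cases j with
  | zero =>
    have := Metric.dist_le_diam_of_mem hb (Set.mem_univ (e (D.P 0 z : W))) (Set.mem_univ (e OnePoint.infty))
    rw [pow_zero]; linarith
  | succ j =>
    have := h.inf j _ (hz.2 j rfl)
    have h2 : (0 : ℝ) < (1 / 2) ^ j := by positivity
    rw [pow_succ]
    nlinarith

end Est
end dat

end partA1

section partA2
open Topology Filter Real OnePoint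

section llc
variable {W : Type} [NormedAddCommGroup W] [NormedSpace ℝ W]

lemma Dat.sub (D : Dat W) (b : Bool) : D.E ⊆ {w | (D.s b).symm w ∈ D.E} :=
  fun _ hw => by have h := interior_subset (D.Ei b _ hw); exact h

lemma Dat.level_null (D : Dat W)
    (hn : ∀ b, ContinuousMap.Homotopic (cInc (D.sub b))
      (ContinuousMap.const _ ⟨OnePoint.infty, infty_cpl D.E⟩)) (m : ℕ) :
    ContinuousMap.Homotopic (cInc (D.S_succ m))
      (ContinuousMap.const _ ⟨OnePoint.infty, infty_cpl (D.S m)⟩) := by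
  let Φ := (D.Ph m).onePointCongr
  have c1 : ∀ w : W, Φ.symm (w : OnePoint W) = ((D.P m).symm w : W) := fun w => rfl
  have c2 : ∀ w : W, Φ (w : OnePoint W) = (D.P m w : W) := fun w => rfl
  have c3 : Φ OnePoint.infty = OnePoint.infty := rfl
  have c4 : Φ.symm OnePoint.infty = OnePoint.infty := rfl
  have m1 : ∀ p : cpl (D.S (m + 1)), Φ.symm p.1 ∈ cpl {w | (D.s (D.σ m)).symm w ∈ D.E} := by
    rintro ⟨p, hp⟩
    induction p using OnePoint.rec with
    | infty => exact infty_cpl _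
    | coe w =>
      rw [coe_cpl] at hp
      change Φ.symm (w : OnePoint W) ∈ _
      rw [c1, coe_cpl]; exact hp
  have m2 : ∀ p : cpl D.E, Φ p.1 ∈ cpl (D.S m) := by
    rintro ⟨p, hp⟩
    induction p using OnePoint.rec with
    | infty => exact infty_cpl _
    | coe w =>
      rw [coe_cpl] at hp
      change Φ (w : OnePoint W) ∈ _
      rw [c2, coe_cpl, Dat.mem_S, Equiv.symm_apply_apply]; exact hp
  let f1 : C(cpl (D.S (m + 1)), cpl {w | (D.s (D.σ m)).symm w ∈ D.E}) :=
    ⟨fun p => ⟨Φ.symm p.1, m1 p⟩, by fun_prop⟩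
  let f2 : C(cpl D.E, cpl (D.S m)) := ⟨fun p => ⟨Φ p.1, m2 p⟩, by fun_prop⟩
  have h1 : cInc (D.S_succ m) = f2.comp ((cInc (D.sub (D.σ m))).comp f1) := by
    ext p
    exact (Φ.apply_symm_apply p.1).symm
  rw [h1]
  exact (ContinuousMap.Homotopic.refl f2).comp ((hn (D.σ m)).comp (ContinuousMap.Homotopic.refl f1))

lemma Dat.emb (D : Dat W) {X : Type} [MetricSpace X] (e : OnePoint W ≃ₜ X) (j : ℕ) :
    IsOpenEmbedding (fun z : W => e (D.P j z : W)) :=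
  e.isOpenEmbedding.comp (OnePoint.isOpenEmbedding_coe.comp (D.Ph j).isOpenEmbedding)

lemma Est.llc {D : Dat W} {X : Type} [MetricSpace X] {e : OnePoint W ≃ₜ X} {c δ L : ℝ}
    (h : Est D e c δ L)
    (hn : ∀ b, ContinuousMap.Homotopic (cInc (D.sub b))
      (ContinuousMap.const _ ⟨OnePoint.infty, infty_cpl D.E⟩)) :
    LinearlyLocallyContractible X := by
  obtain ⟨M, hM1, hM⟩ := h.inf_up
  have hc := h.c0
  have hδ := h.d0
  have hL := h.L1
  obtain ⟨a, ha⟩ : ∃ a, a = c * δ := ⟨_, rfl⟩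
  have ha0 : 0 < a := ha ▸ mul_pos hc hδ
  obtain ⟨dm, hdm⟩ : ∃ dm, dm = Metric.diam (Set.univ : Set X) := ⟨_, rfl⟩
  have hd0 : 0 ≤ dm := hdm ▸ Metric.diam_nonneg
  obtain ⟨K, hK⟩ : ∃ K, K = 1 + M / a := ⟨_, rfl⟩
  have hK1 : 1 ≤ K := by rw [hK]; have : 0 < M / a := by positivity
                         linarith
  obtain ⟨C, hC⟩ : ∃ C, C = L / c + 2 * K * dm / a + 4 * L * K / a + M / a + 1 := ⟨_, rfl⟩
  have t1 : 0 ≤ L / c := by positivity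
  have t2 : 0 ≤ 2 * K * dm / a := by positivity
  have t3 : 0 ≤ 4 * L * K / a := by positivity
  have t4 : 0 ≤ M / a := by positivity
  have hC1 : 1 ≤ C := by rw [hC]; linarith
  refine ⟨C, hC1, ?_⟩
  intro x r hr hrd
  rw [← hdm, lt_div_iff₀ (by linarith)] at hrd
  have hsub : Metric.ball x r ⊆ Metric.ball x (C * r) := Metric.ball_subset_ball (by nlinarith)
  refine ⟨hsub, ?_⟩
  -- the large radius case
  have large : dist x (e OnePoint.infty) ≤ M / a * r → ∃ y : Metric.ball x (C * r),
      ContinuousMap.Homotopic ⟨Set.inclusion hsub, continuous_inclusion hsub⟩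
        (ContinuousMap.const _ y) := by
    intro hx
    have hR : 2 * (K * r) / a ≤ 1 := by
      rw [div_le_one ha0]
      have h1 : 2 * K * dm / a * r ≤ C * r := by
        apply mul_le_mul_of_nonneg_right _ hr.le; rw [hC]; linarith
      have h2 : 2 * K * dm / a * r = 2 * (K * r) * dm / a := by ring
      have h3 : 2 * (K * r) * dm / a < dm := by linarith
      rw [div_lt_iff₀ ha0] at h3
      by_contra hcon
      push Not at hcon
      nlinarith
    obtain ⟨m, hm1, hm2⟩ := exists_nat_pow_near_of_lt_one (x := 2 * (K * r) / a) (y := 1 / 2)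
      (by positivity) hR (by norm_num) (by norm_num)
    have k1 : ∀ p : Metric.ball x r, e.symm p.1 ∈ cpl (D.S (m + 1)) := by
      rintro ⟨p, hp⟩ w hw hh
      have h1 := h.inf_lo hw
      dsimp only at hh
      rw [← hh, e.apply_symm_apply] at h1
      rw [Metric.mem_ball] at hp
      have h2 : dist p (e OnePoint.infty) < K * r := by
        have := dist_triangle p x (e OnePoint.infty)
        rw [hK]; linarith
      rw [div_le_iff₀ ha0] at hm2
      rw [pow_succ, ← ha] at h1
      nlinarith
    have k2 : ∀ p : cpl (D.S m), e p.1 ∈ Metric.ball x (C * r) := by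
      rintro ⟨p, hp⟩
      have h1 : dist (e p) (e OnePoint.infty) ≤ L * (1 / 2) ^ m := by
        induction p using OnePoint.rec with
        | infty => rw [dist_self]; positivity
        | coe w => exact h.inf m w (coe_cpl.1 hp)
      rw [Metric.mem_ball]
      have h2 := dist_triangle_right (e p) x (e OnePoint.infty)
      rw [pow_succ] at hm1
      have h3 : L * (1 / 2) ^ m < 4 * L * K / a * r := by
        have : L * ((1 / 2) ^ m * (1 / 2)) < L * (2 * (K * r) / a) :=
          mul_lt_mul_of_pos_left hm1 (by linarith)
        have e1 : 4 * L * K / a * r = 2 * (L * (2 * (K * r) / a)) := by ring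
        rw [e1]; linarith
      have h4 : (4 * L * K / a + M / a) * r ≤ C * r := by
        apply mul_le_mul_of_nonneg_right _ hr.le; rw [hC]; linarith
      linarith
    let f1 : C(Metric.ball x r, cpl (D.S (m + 1))) := ⟨fun p => ⟨e.symm p.1, k1 p⟩, by fun_prop⟩
    let f2 : C(cpl (D.S m), Metric.ball x (C * r)) := ⟨fun p => ⟨e p.1, k2 p⟩, by fun_prop⟩
    have hf : (⟨Set.inclusion hsub, continuous_inclusion hsub⟩ : C(_, _)) =
        f2.comp ((cInc (D.S_succ m)).comp f1) := by
      ext p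
      exact (e.apply_symm_apply p.1).symm
    refine ⟨f2 ⟨OnePoint.infty, infty_cpl _⟩, ?_⟩
    rw [hf]
    exact (ContinuousMap.Homotopic.refl f2).comp
      ((D.level_null hn m).comp (ContinuousMap.Homotopic.refl f1))
  obtain ⟨p, rfl⟩ := e.surjective x
  induction p using OnePoint.rec with
  | infty => exact large (by rw [dist_self]; positivity)
  | coe w =>
    obtain ⟨j, z, hz, rfl, -⟩ := D.exists_Z w
    have hj : (0 : ℝ) < (1 / 2) ^ j := by positivity
    rcases lt_or_ge r (a * (1 / 2) ^ j) with hrs | hrs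
    · obtain ⟨ρ, hρ⟩ : ∃ ρ, ρ = r / (c * (1 / 2) ^ j) := ⟨_, rfl⟩
      have hρ0 : 0 < ρ := by rw [hρ]; positivity
      have hρr : c * (1 / 2) ^ j * ρ = r := by rw [hρ]; field_simp
      have hρδ : ρ ≤ δ := by
        rw [hρ, div_le_iff₀ (by positivity)]; rw [ha] at hrs; linarith
      have hemb := D.emb e j
      have k1 : ∀ p : Metric.ball (e (D.P j z : W)) r,
          ∃ z' : Metric.ball z ρ, p.1 = e (D.P j z'.1 : W) := by
        rintro ⟨p, hp⟩
        by_contra hcon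
        push Not at hcon
        have := h.far j z hz ρ hρδ p (fun z' hz' => hcon ⟨z', hz'⟩)
        rw [hρr, dist_comm] at this
        exact absurd (Metric.mem_ball.1 hp) (not_lt.2 this)
      choose g hg using k1
      have hgc : Continuous g := by
        rw [continuous_induced_rng]
        have : Continuous ((fun z : W => e (D.P j z : W)) ∘ (Subtype.val ∘ g)) := by
          have e1 : ((fun z : W => e (D.P j z : W)) ∘ (Subtype.val ∘ g)) = Subtype.val := by
            funext p; exact (hg p).symm
          rw [e1]; exact continuous_subtype_val
        exact hemb.isEmbedding.continuous_iff.2 this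
      have k2 : ∀ z' : Metric.ball z ρ,
          e (D.P j z'.1 : W) ∈ Metric.ball (e (D.P j z : W)) (C * r) := by
        rintro ⟨z', hz'⟩
        rw [Metric.mem_ball]
        have h1 := h.up j z hz z' (Metric.ball_subset_ball hρδ hz') z (Metric.mem_ball_self hδ)
        rw [Metric.mem_ball] at hz'
        have h2 : L * (1 / 2) ^ j * dist z' z < L * (1 / 2) ^ j * ρ :=
          mul_lt_mul_of_pos_left hz' (by positivity)
        have h3 : L * (1 / 2) ^ j * ρ = L / c * r := by rw [← hρr]; field_simp
        have h4 : L / c * r ≤ C * r := by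
          apply mul_le_mul_of_nonneg_right _ hr.le; rw [hC]; linarith
        dsimp only; linarith
      let f1 : C(Metric.ball (e (D.P j z : W)) r, Metric.ball z ρ) := ⟨g, hgc⟩
      let f2 : C(Metric.ball z ρ, Metric.ball (e (D.P j z : W)) (C * r)) :=
        ⟨fun z' => ⟨e (D.P j z'.1 : W), k2 z'⟩,
          (hemb.continuous.comp continuous_subtype_val).subtype_mk _⟩
      have hcs : ContractibleSpace (Metric.ball z ρ) :=
        (convex_ball z ρ).contractibleSpace ⟨z, Metric.mem_ball_self hρ0⟩
      obtain ⟨y, hy⟩ := (contractible_iff_id_nullhomotopic (Metric.ball z ρ)).1 hcs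
      have hf : (⟨Set.inclusion hsub, continuous_inclusion hsub⟩ : C(_, _)) =
          f2.comp ((ContinuousMap.id _).comp f1) := by
        ext p
        exact hg p
      refine ⟨f2 y, ?_⟩
      rw [hf]
      exact (ContinuousMap.Homotopic.refl f2).comp (hy.comp (ContinuousMap.Homotopic.refl f1))
    · apply large
      have h1 := hM j z hz
      have h2 : M * (1 / 2) ^ j ≤ M / a * r := by
        rw [div_mul_eq_mul_div, le_div_iff₀ ha0]; nlinarith
      linarith

end llc

end partA2

section partA3
open Topology Filter Real OnePoint MeasureTheory
open scoped ENNReal NNReal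

section ahl

lemma haus_lo {W X : Type} [MetricSpace W] [MetricSpace X] [MeasurableSpace W] [BorelSpace W]
    [MeasurableSpace X] [BorelSpace X] {f : W → X} {s : Set W} {K : ℝ≥0} {d : ℝ} (hd : 0 ≤ d)
    (h : ∀ x ∈ s, ∀ y ∈ s, dist x y ≤ K * dist (f x) (f y)) :
    μH[d] s ≤ (K : ℝ≥0∞) ^ d * μH[d] (f '' s) := by
  rcases s.eq_empty_or_nonempty with rfl | ⟨w0, hw0⟩
  · simp
  have : Nonempty W := ⟨w0⟩
  have hinj : Set.InjOn f s := by
    intro x hx y hy hxy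
    have := h x hx y hy
    rw [hxy, dist_self, mul_zero] at this
    exact dist_le_zero.1 this
  have hl : LipschitzOnWith K (Function.invFunOn f s) (f '' s) := by
    apply LipschitzOnWith.of_dist_le_mul
    rintro _ ⟨x, hx, rfl⟩ _ ⟨y, hy, rfl⟩
    rw [hinj.leftInvOn_invFunOn hx, hinj.leftInvOn_invFunOn hy]
    exact h x hx y hy
  have h2 := hl.hausdorffMeasure_image_le hd
  rwa [hinj.leftInvOn_invFunOn.image_image] at h2

variable {W : Type} [NormedAddCommGroup W] [NormedSpace ℝ W] [FiniteDimensional ℝ W]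
  {D : Dat W} {X : Type} [MetricSpace X] {e : OnePoint W ≃ₜ X} {c δ L : ℝ}

lemma haus_ball [MeasurableSpace W] [BorelSpace W] : ∃ k0 : ℝ, 0 < k0 ∧
    ∀ (z : W) (ρ : ℝ), 0 < ρ → (μH[(Module.finrank ℝ W : ℕ)] : Measure W) (Metric.ball z ρ) =
      ENNReal.ofReal (ρ ^ Module.finrank ℝ W * k0) := by
  have : ProperSpace W := FiniteDimensional.proper_real W
  have h1 : (μH[(Module.finrank ℝ W : ℕ)] : Measure W) (Metric.ball 0 1) ≠ ⊤ :=
    (Metric.isBounded_ball.measure_lt_top).ne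
  refine ⟨((μH[(Module.finrank ℝ W : ℕ)] : Measure W) (Metric.ball 0 1)).toReal,
    ENNReal.toReal_pos (Metric.measure_ball_pos _ _ one_pos).ne' h1, ?_⟩
  intro z ρ hρ
  rw [Measure.addHaar_ball_of_pos _ _ hρ, ENNReal.ofReal_mul (by positivity),
    ENNReal.ofReal_toReal h1]

lemma coe_rpow_ofReal {a b : ℝ} (ha : 0 ≤ a) (n : ℕ) :
    ((a.toNNReal : ℝ≥0) : ℝ≥0∞) ^ (n : ℝ) * ENNReal.ofReal b = ENNReal.ofReal (a ^ n * b) := by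
  rw [ENNReal.rpow_natCast, ENNReal.ofReal_mul (by positivity), ENNReal.ofReal_pow ha]
  rfl

lemma Est.chart_up [MeasurableSpace X] [BorelSpace X] (h : Est D e c δ L) :
    ∃ k0 : ℝ, 0 < k0 ∧ ∀ j, ∀ z ∈ D.Z j, ∀ ρ, 0 < ρ → ρ ≤ δ →
    (μH[(Module.finrank ℝ W : ℕ)] : Measure X)
      ((fun z : W => e (D.P j z : W)) '' Metric.ball z ρ) ≤
      ENNReal.ofReal ((L * (1 / 2) ^ j * ρ) ^ Module.finrank ℝ W * k0) ∧
    ENNReal.ofReal ((c * (1 / 2) ^ j * ρ) ^ Module.finrank ℝ W * k0) ≤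
      (μH[(Module.finrank ℝ W : ℕ)] : Measure X)
      ((fun z : W => e (D.P j z : W)) '' Metric.ball z ρ) := by
  letI : MeasurableSpace W := borel W
  haveI : BorelSpace W := ⟨rfl⟩
  obtain ⟨k0, hk, hb⟩ := haus_ball (W := W)
  have hL := h.L1
  have hc := h.c0
  refine ⟨k0, hk, ?_⟩
  intro j z hz ρ hρ hρδ
  constructor
  · have hl : LipschitzOnWith (L * (1 / 2) ^ j).toNNReal (fun z : W => e (D.P j z : W))
        (Metric.ball z ρ) := by
      apply LipschitzOnWith.of_dist_le_mul
      intro x hx y hy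
      rw [Real.coe_toNNReal _ (by positivity)]
      exact h.up j z hz x (Metric.ball_subset_ball hρδ hx) y (Metric.ball_subset_ball hρδ hy)
    refine (hl.hausdorffMeasure_image_le (Nat.cast_nonneg _)).trans ?_
    rw [hb z ρ hρ, coe_rpow_ofReal (by positivity)]
    apply le_of_eq
    congr 1
    rw [mul_pow _ ρ]; ring
  · have hl := haus_lo (f := fun z : W => e (D.P j z : W)) (s := Metric.ball z ρ)
      (K := (c * (1 / 2) ^ j)⁻¹.toNNReal) (d := (Module.finrank ℝ W : ℕ)) (Nat.cast_nonneg _) (by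
        intro x hx y hy
        rw [Real.coe_toNNReal _ (by positivity), inv_mul_eq_div, le_div_iff₀ (by positivity),
          mul_comm]
        exact h.lo j z hz x (Metric.ball_subset_ball hρδ hx) y (Metric.ball_subset_ball hρδ hy))
    rw [hb z ρ hρ] at hl
    have e1 : ENNReal.ofReal ((c * (1 / 2) ^ j * ρ) ^ Module.finrank ℝ W * k0) =
        ENNReal.ofReal ((c * (1 / 2) ^ j) ^ Module.finrank ℝ W) *
          ENNReal.ofReal (ρ ^ Module.finrank ℝ W * k0) := by
      rw [← ENNReal.ofReal_mul (by positivity), mul_pow _ ρ]; congr 1; ring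
    rw [e1]
    refine (mul_le_mul_right hl _).trans ?_
    rw [← mul_assoc, ENNReal.rpow_natCast]
    have e2 : ENNReal.ofReal ((c * (1 / 2) ^ j) ^ Module.finrank ℝ W) *
        (((c * (1 / 2) ^ j)⁻¹.toNNReal : ℝ≥0) : ℝ≥0∞) ^ Module.finrank ℝ W = 1 := by
      change _ * (ENNReal.ofReal (c * (1 / 2) ^ j)⁻¹) ^ _ = 1
      rw [← ENNReal.ofReal_pow (by positivity), ← ENNReal.ofReal_mul (by positivity), ← mul_pow,
        mul_inv_cancel₀ (by positivity)]
      simp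
    rw [e2, one_mul]

lemma Est.shell [MeasurableSpace X] [BorelSpace X] (h : Est D e c δ L) :
    ∃ N : ℝ, 0 < N ∧ ∀ j, (μH[(Module.finrank ℝ W : ℕ)] : Measure X)
      ((fun z : W => e (D.P j z : W)) '' D.Z j) ≤
      ENNReal.ofReal (N * ((1 / 2) ^ j) ^ Module.finrank ℝ W) := by
  obtain ⟨k0, hk, hch⟩ := h.chart_up
  have hδ := h.d0
  have hL := h.L1
  obtain ⟨t, -, ht, hcov⟩ := D.Ec.finite_cover_balls (half_pos hδ)
  lift t to Finset W using ht
  refine ⟨(t.card + 1) * ((L * δ) ^ Module.finrank ℝ W * k0), by positivity, ?_⟩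
  intro j
  have hsub : (fun z : W => e (D.P j z : W)) '' D.Z j ⊆
      ⋃ x ∈ t, (fun z : W => e (D.P j z : W)) '' (D.Z j ∩ Metric.ball x (δ / 2)) := by
    rintro _ ⟨z, hz, rfl⟩
    obtain ⟨x, hx, hzx⟩ := Set.mem_iUnion₂.1 (hcov hz.1)
    exact Set.mem_iUnion₂.2 ⟨x, hx, z, ⟨hz, hzx⟩, rfl⟩
  refine (measure_mono hsub).trans ((measure_biUnion_finset_le _ _).trans ?_)
  have hone : ∀ x ∈ t, (μH[(Module.finrank ℝ W : ℕ)] : Measure X)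
      ((fun z : W => e (D.P j z : W)) '' (D.Z j ∩ Metric.ball x (δ / 2))) ≤
      ENNReal.ofReal ((L * (1 / 2) ^ j * δ) ^ Module.finrank ℝ W * k0) := by
    intro x hx
    rcases (D.Z j ∩ Metric.ball x (δ / 2)).eq_empty_or_nonempty with h0 | ⟨z, hz, hzx⟩
    · rw [h0]; simp
    refine le_trans (measure_mono (Set.image_mono ?_)) (hch j z hz δ hδ le_rfl).1
    rintro y ⟨-, hy⟩
    rw [Metric.mem_ball] at *
    have := dist_triangle_right y z x
    linarith
  refine (Finset.sum_le_sum hone).trans ?_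
  rw [Finset.sum_const, ← ENNReal.ofReal_nsmul, nsmul_eq_mul]
  apply ENNReal.ofReal_le_ofReal
  have e1 : (L * (1 / 2) ^ j * δ) ^ Module.finrank ℝ W * k0 =
      (L * δ) ^ Module.finrank ℝ W * k0 * ((1 / 2) ^ j) ^ Module.finrank ℝ W := by
    rw [mul_pow, mul_pow, mul_pow]; ring
  rw [e1]
  have : 0 ≤ (L * δ) ^ Module.finrank ℝ W * k0 * ((1 / 2) ^ j) ^ Module.finrank ℝ W := by positivity
  nlinarith

lemma Est.inf_ball_up [MeasurableSpace X] [BorelSpace X] (h : Est D e c δ L)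
    (hn : 0 < Module.finrank ℝ W) :
    ∃ N : ℝ, 0 < N ∧ ∀ R, 0 < R → (μH[(Module.finrank ℝ W : ℕ)] : Measure X)
      (Metric.ball (e OnePoint.infty) R) ≤ ENNReal.ofReal (N * R ^ Module.finrank ℝ W) := by
  obtain ⟨N, hN, hsh⟩ := h.shell
  have hc := h.c0
  have hδ := h.d0
  refine ⟨2 * N * (1 / (c * δ)) ^ Module.finrank ℝ W, by positivity, ?_⟩
  intro R hR
  have hQ : 0 < R / (c * δ) := by positivity
  obtain ⟨l0, hl0, hmin⟩ : ∃ l0, ((1 : ℝ) / 2) ^ l0 < R / (c * δ) ∧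
      ∀ l, ((1 : ℝ) / 2) ^ l < R / (c * δ) → l0 ≤ l := by
    classical
    have hex := exists_pow_lt_of_lt_one hQ (by norm_num : (1 : ℝ) / 2 < 1)
    exact ⟨Nat.find hex, Nat.find_spec hex, fun l hl => Nat.find_min' hex hl⟩
  have hsub : Metric.ball (e OnePoint.infty) R ⊆
      {e OnePoint.infty} ∪ ⋃ i : ℕ, (fun z : W => e (D.P (l0 + i) z : W)) '' D.Z (l0 + i) := by
    intro p hp
    obtain ⟨q, rfl⟩ := e.surjective p
    induction q using OnePoint.rec with
    | infty => left; rfl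
    | coe w =>
      right
      obtain ⟨j, z, hz, rfl, -⟩ := D.exists_Z w
      have h1 := h.inf_lo (j := j) (x := D.P j z) (by
        rw [Dat.mem_S, Equiv.symm_apply_apply]; exact hz.1)
      rw [Metric.mem_ball] at hp
      have h2 : ((1 : ℝ) / 2) ^ j < R / (c * δ) := by
        rw [lt_div_iff₀ (by positivity)]; linarith
      have h3 := hmin j h2
      obtain ⟨i, rfl⟩ := Nat.exists_eq_add_of_le h3
      exact Set.mem_iUnion.2 ⟨i, z, hz, rfl⟩
  haveI := Measure.noAtoms_hausdorff X (d := (Module.finrank ℝ W : ℕ)) (by exact_mod_cast hn)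
  refine (measure_mono hsub).trans ((measure_union_le _ _).trans ?_)
  rw [measure_singleton, zero_add]
  refine (measure_iUnion_le _).trans ?_
  have hterm : ∀ i : ℕ, (μH[(Module.finrank ℝ W : ℕ)] : Measure X)
      ((fun z : W => e (D.P (l0 + i) z : W)) '' D.Z (l0 + i)) ≤
      ENNReal.ofReal (N * (R / (c * δ)) ^ Module.finrank ℝ W * (1 / 2) ^ i) := by
    intro i
    refine (hsh (l0 + i)).trans (ENNReal.ofReal_le_ofReal ?_)
    rw [pow_add, mul_pow, mul_assoc]
    apply mul_le_mul_of_nonneg_left _ hN.le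
    apply mul_le_mul
    · exact pow_le_pow_left₀ (by positivity) hl0.le _
    · exact pow_le_of_le_one (by positivity) (pow_le_one₀ (by norm_num) (by norm_num)) hn.ne'
    · positivity
    · positivity
  refine (ENNReal.tsum_le_tsum hterm).trans ?_
  rw [← ENNReal.ofReal_tsum_of_nonneg (fun i => by positivity)
    (summable_geometric_two.mul_left _), tsum_mul_left, tsum_geometric_two]
  apply ENNReal.ofReal_le_ofReal
  apply le_of_eq
  rw [div_eq_mul_one_div R, mul_pow]; ring

lemma Est.ahlfors [Nontrivial W] (h : Est D e c δ L) (hn : 0 < Module.finrank ℝ W) :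
    AhlforsRegular X (Module.finrank ℝ W) := by
  letI : MeasurableSpace X := borel X
  haveI : BorelSpace X := ⟨rfl⟩
  obtain ⟨n, hnn⟩ : ∃ n, n = Module.finrank ℝ W := ⟨_, rfl⟩
  obtain ⟨μ, hμ⟩ : ∃ μ : Measure X, μ = μH[(Module.finrank ℝ W : ℕ)] := ⟨_, rfl⟩
  obtain ⟨k0, hk, hch⟩ := h.chart_up
  obtain ⟨N, hN, hinf⟩ := h.inf_ball_up hn
  obtain ⟨M, hM1, hM⟩ := h.inf_up
  have hc := h.c0
  have hδ := h.d0
  have hL := h.L1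
  rw [← hμ, ← hnn] at hch hinf
  obtain ⟨dm, hdm⟩ : ∃ dm, dm = Metric.diam (Set.univ : Set X) := ⟨_, rfl⟩
  have hd0 : 0 ≤ dm := hdm ▸ Metric.diam_nonneg
  obtain ⟨T, hT⟩ : ∃ T, T = dm + 2 * M + L := ⟨_, rfl⟩
  have hT0 : 0 < T := by rw [hT]; linarith
  obtain ⟨a, ha⟩ : ∃ a, a = c * δ := ⟨_, rfl⟩
  have ha0 : 0 < a := ha ▸ mul_pos hc hδ
  -- lower bounds
  have claim1 : ∀ j, ∀ z ∈ D.Z j, ∀ r, 0 < r → r ≤ L * δ * (1 / 2) ^ j →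
      ENNReal.ofReal ((c / L * r) ^ n * k0) ≤ μ (Metric.ball (e (D.P j z : W)) r) := by
    intro j z hz r hr hrj
    have hρ : 0 < r / (L * (1 / 2) ^ j) := by positivity
    have hρδ : r / (L * (1 / 2) ^ j) ≤ δ := by rw [div_le_iff₀ (by positivity)]; linarith
    have h1 := (hch j z hz _ hρ hρδ).2
    have e1 : c * (1 / 2) ^ j * (r / (L * (1 / 2) ^ j)) = c / L * r := by field_simp
    rw [e1] at h1
    refine h1.trans (measure_mono ?_)
    rintro _ ⟨y, hy, rfl⟩
    have h2 := h.up j z hz y (Metric.ball_subset_ball hρδ hy) z (Metric.mem_ball_self hδ)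
    rw [Metric.mem_ball] at hy ⊢
    rw [lt_div_iff₀ (by positivity)] at hy
    dsimp only
    linarith
  obtain ⟨θ, hθ⟩ : ∃ θ, θ = c / L * (L * δ / T) := ⟨_, rfl⟩
  have hθ0 : 0 < θ := by rw [hθ]; positivity
  have claim2 : ∀ j, ∀ z ∈ D.Z j, ∀ r, 0 < r → r ≤ T * (1 / 2) ^ j →
      ENNReal.ofReal ((θ * r) ^ n * k0) ≤ μ (Metric.ball (e (D.P j z : W)) r) := by
    intro j z hz r hr hrj
    have h1 := claim1 j z hz (L * δ / T * r) (by positivity) (by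
      have e1 : L * δ * (1 / 2) ^ j = L * δ / T * (T * (1 / 2) ^ j) := by field_simp
      rw [e1]; apply mul_le_mul_of_nonneg_left hrj; positivity)
    rw [← mul_assoc, ← hθ] at h1
    refine h1.trans (measure_mono (Metric.ball_subset_ball ?_))
    have : L * δ / T ≤ 1 := by
      rw [div_le_one hT0, hT]; nlinarith [h.d1]
    nlinarith
  have claim3 : ∀ r, 0 < r → r ≤ dm →
      ENNReal.ofReal ((θ * (r / 2)) ^ n * k0) ≤ μ (Metric.ball (e OnePoint.infty) r) := by
    intro r hr hrd
    obtain ⟨l, hl1, hl2⟩ := exists_nat_pow_near_of_lt_one (x := r / T) (y := 1 / 2)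
      (by positivity) (by rw [div_le_one hT0, hT]; linarith) (by norm_num) (by norm_num)
    obtain ⟨z, hz⟩ := D.Z_nonempty (l + 1)
    have h1 := hM _ z hz
    have h2 : M * (1 / 2) ^ (l + 1) ≤ r / 2 := by
      rw [lt_div_iff₀ hT0] at hl1
      have : (1 / 2) ^ (l + 1) * (2 * M) ≤ (1 / 2) ^ (l + 1) * T :=
        mul_le_mul_of_nonneg_left (by rw [hT]; linarith) (by positivity)
      linarith
    refine (claim2 (l + 1) z hz (r / 2) (by positivity) ?_).trans (measure_mono ?_)
    · rw [div_le_iff₀ hT0] at hl2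
      rw [pow_succ]; linarith
    · apply Metric.ball_subset_ball'
      linarith
  have claim4 : ∀ x : X, ∀ r, 0 < r → r ≤ dm →
      ENNReal.ofReal ((θ * (r / 4)) ^ n * k0) ≤ μ (Metric.ball x r) := by
    intro x r hr hrd
    have mon : ∀ u, r / 4 ≤ u → ENNReal.ofReal ((θ * (r / 4)) ^ n * k0) ≤
        ENNReal.ofReal ((θ * u) ^ n * k0) := by
      intro u hu
      apply ENNReal.ofReal_le_ofReal
      gcongr
    obtain ⟨q, rfl⟩ := e.surjective x
    induction q using OnePoint.rec with
    | infty => exact (mon (r / 2) (by linarith)).trans (claim3 r hr hrd)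
    | coe w =>
      obtain ⟨j, z, hz, rfl, -⟩ := D.exists_Z w
      rcases le_or_gt r (2 * M * (1 / 2) ^ j) with hs | hs
      · refine (mon r (by linarith)).trans (claim2 j z hz r hr (hs.trans ?_))
        apply mul_le_mul_of_nonneg_right _ (by positivity)
        rw [hT]; linarith
      · have h1 := hM _ z hz
        refine le_trans ?_ ((claim3 (r / 2) (by positivity) (by linarith)).trans
          (measure_mono (Metric.ball_subset_ball' (x := e OnePoint.infty) ?_)))
        · rw [show r / 2 / 2 = r / 4 by ring]
        · rw [dist_comm]; linarith
  -- upper bounds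
  obtain ⟨K, hK⟩ : ∃ K, K = 1 + M / a := ⟨_, rfl⟩
  have hMa : 0 < M / a := by positivity
  have claim5 : ∀ x : X, ∀ r, 0 < r →
      μ (Metric.ball x r) ≤ ENNReal.ofReal (((L / c) ^ n * k0 + N * K ^ n) * r ^ n) := by
    intro x r hr
    have large : dist x (e OnePoint.infty) ≤ M / a * r →
        μ (Metric.ball x r) ≤ ENNReal.ofReal (((L / c) ^ n * k0 + N * K ^ n) * r ^ n) := by
      intro hx
      have hK0 : 0 < K := by rw [hK]; linarith
      refine (measure_mono (Metric.ball_subset_ball' (y := e OnePoint.infty) (ε₂ := K * r) ?_)).trans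
        ((hinf _ (by positivity)).trans (ENNReal.ofReal_le_ofReal ?_))
      · rw [hK]; linarith
      · rw [mul_pow, add_mul, mul_assoc N]
        have : 0 ≤ (L / c) ^ n * k0 * r ^ n := by positivity
        linarith
    obtain ⟨q, rfl⟩ := e.surjective x
    induction q using OnePoint.rec with
    | infty => exact large (by rw [dist_self]; positivity)
    | coe w =>
      obtain ⟨j, z, hz, rfl, -⟩ := D.exists_Z w
      rcases lt_or_ge r (a * (1 / 2) ^ j) with hrs | hrs
      · obtain ⟨ρ, hρ⟩ : ∃ ρ, ρ = r / (c * (1 / 2) ^ j) := ⟨_, rfl⟩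
        have hρ0 : 0 < ρ := by rw [hρ]; positivity
        have hρr : c * (1 / 2) ^ j * ρ = r := by rw [hρ]; field_simp
        have hρδ : ρ ≤ δ := by
          rw [hρ, div_le_iff₀ (by positivity)]; rw [ha] at hrs; linarith
        have k1 : Metric.ball (e (D.P j z : W)) r ⊆
            (fun z : W => e (D.P j z : W)) '' Metric.ball z ρ := by
          intro p hp
          by_contra hcon
          have := h.far j z hz ρ hρδ p (fun z' hz' hh => hcon ⟨z', hz', hh.symm⟩)
          rw [hρr, dist_comm] at this
          exact absurd (Metric.mem_ball.1 hp) (not_lt.2 this)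
        refine (measure_mono k1).trans ((hch j z hz ρ hρ0 hρδ).1.trans
          (ENNReal.ofReal_le_ofReal ?_))
        have e1 : L * (1 / 2) ^ j * ρ = L / c * r := by rw [← hρr]; field_simp
        have hK0 : 0 < K := by rw [hK]; linarith
        rw [e1, mul_pow, add_mul]
        have : 0 ≤ N * K ^ n * r ^ n := by positivity
        linarith
      · apply large
        have h1 := hM j z hz
        have h2 : M * (1 / 2) ^ j ≤ M / a * r := by
          rw [div_mul_eq_mul_div, le_div_iff₀ ha0]; nlinarith
        linarith
  have hK0 : 0 < K := by rw [hK]; linarith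
  obtain ⟨U, hU⟩ : ∃ U, U = (L / c) ^ n * k0 + N * K ^ n := ⟨_, rfl⟩
  have hU0 : 0 < U := by rw [hU]; positivity
  obtain ⟨V, hV⟩ : ∃ V, V = (θ / 4) ^ n * k0 := ⟨_, rfl⟩
  have hV0 : 0 < V := by rw [hV]; positivity
  have hVi : 0 < V⁻¹ := by positivity
  refine ⟨1 + U + V⁻¹, by linarith, ?_⟩
  intro x r hr hrd
  have hmeas : hausdorffM X (Module.finrank ℝ W : ℕ) (Metric.ball x r) = μ (Metric.ball x r) := by
    rw [hμ]; rfl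
  rw [hmeas, ← hnn]
  rw [← hdm] at hrd
  have hrn : 0 ≤ r ^ n := by positivity
  constructor
  · refine le_trans (ENNReal.ofReal_le_ofReal ?_) (claim4 x r hr hrd)
    have e1 : (θ * (r / 4)) ^ n * k0 = V * r ^ n := by
      rw [hV, show θ * (r / 4) = θ / 4 * r by ring, mul_pow]; ring
    rw [e1]
    apply mul_le_mul_of_nonneg_right _ hrn
    rw [inv_le_comm₀ (by linarith) hV0]
    linarith
  · refine (claim5 x r hr).trans (ENNReal.ofReal_le_ofReal ?_)
    rw [← hU]
    apply mul_le_mul_of_nonneg_right _ hrn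
    linarith

end ahl

end partA3

section partA4
open Topology Filter Real OnePoint
open scoped ENNReal NNReal

section cut
variable {W : Type} [NormedAddCommGroup W] [NormedSpace ℝ W] [FiniteDimensional ℝ W]

lemma Dat.exists_cut (D : Dat W) : ∃ (ζ : W → ℝ) (K : Set W) (δ : ℝ), ContDiff ℝ 1 ζ ∧ IsCompact K ∧
    0 < δ ∧ (∀ w, 0 ≤ ζ w ∧ ζ w ≤ 1) ∧ (∀ w, ζ w ≠ 0 → w ∈ K) ∧
    (∀ e ∈ D.E, ∀ w ∈ Metric.ball e δ, ζ w = 1) ∧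
    (∀ b, ∀ w ∈ K, Metric.ball ((D.s b).symm w) δ ⊆ D.E) := by
  have : ProperSpace W := FiniteDimensional.proper ℝ W
  set O : Set W := ⋂ b, (D.s b).symm ⁻¹' (interior D.E) with hO
  have hOo : IsOpen O := isOpen_iInter_of_finite fun b =>
    isOpen_interior.preimage (D.tC b).continuous
  have hEO : D.E ⊆ O := fun e he => Set.mem_iInter.2 fun b => D.Ei b e he
  obtain ⟨d, hd, hdO⟩ := D.Ec.exists_cthickening_subset_open hOo hEO
  have hdis : Disjoint (Metric.thickening d D.E)ᶜ (Metric.cthickening (d / 2) D.E) := by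
    rw [Set.disjoint_left]
    intro x hx hx2
    exact hx (Metric.cthickening_subset_thickening' hd (by linarith) _ hx2)
  obtain ⟨f, f0, f1, f01⟩ := exists_contMDiffMap_zero_one_of_isClosed (n := 1) (modelWithCornersSelf ℝ W)
    (Metric.isOpen_thickening (δ := d) (E := D.E)).isClosed_compl Metric.isClosed_cthickening hdis
  have hK : IsCompact (Metric.cthickening d D.E) := D.Ec.cthickening
  have : ∀ b, ∃ δ > 0, ∀ w ∈ Metric.cthickening d D.E, Metric.ball ((D.s b).symm w) δ ⊆ D.E := by
    intro b
    have h1 : (D.s b).symm '' Metric.cthickening d D.E ⊆ interior D.E := by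
      rintro _ ⟨w, hw, rfl⟩
      exact Set.mem_iInter.1 (hdO hw) b
    obtain ⟨r, hr, hrr⟩ := (hK.image (D.tC b).continuous).exists_cthickening_subset_open
      isOpen_interior h1
    refine ⟨r, hr, fun w hw => ?_⟩
    exact (Metric.ball_subset_thickening (Set.mem_image_of_mem _ hw) r).trans
      ((Metric.thickening_subset_cthickening _ _).trans (hrr.trans interior_subset))
  choose δ hδ hδ2 using this
  refine ⟨f, Metric.cthickening d D.E, min (d / 2) (min (δ true) (δ false)), ?_, hK, ?_, ?_, ?_, ?_, ?_⟩
  · exact f.contMDiff.contDiff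
  · have := hδ true
    have := hδ false
    positivity
  · exact fun w => f01 w
  · intro w hw
    by_contra hc
    apply hw
    apply f0
    intro h; exact hc (Metric.thickening_subset_cthickening _ _ h)
  · intro e he w hw
    apply f1
    apply Metric.thickening_subset_cthickening
    exact Metric.ball_subset_thickening he _ (Metric.ball_subset_ball (min_le_left _ _) hw)
  · intro b w hw
    refine (Metric.ball_subset_ball ?_).trans (hδ2 b w hw)
    cases b
    · exact (min_le_right _ _).trans (min_le_right _ _)
    · exact (min_le_right _ _).trans (min_le_left _ _)
end cut

section good
variable {W W' W'' : Type} [NormedAddCommGroup W] [NormedSpace ℝ W]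
  [NormedAddCommGroup W'] [NormedSpace ℝ W'] [NormedAddCommGroup W''] [NormedSpace ℝ W'']

/-- families that are uniformly Lipschitz on bounded sets -/
def Good {ι : Type} (g : ι → W → W') : Prop :=
  ∀ R : ℝ, ∃ M : ℝ, 0 ≤ M ∧ ∀ i, ∀ x, ‖x‖ ≤ R → ‖g i x‖ ≤ M ∧
    ∀ y, ‖y‖ ≤ R → dist (g i x) (g i y) ≤ M * dist x y

lemma Good.comp {ι : Type} {g : ι → W' → W''} {f : ι → W → W'} (hg : Good g) (hf : Good f) :
    Good (fun i x => g i (f i x)) := by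
  intro R
  obtain ⟨M, hM, h⟩ := hf R
  obtain ⟨N, hN, k⟩ := hg M
  refine ⟨max N (N * M), le_max_of_le_left hN, fun i x hx => ⟨?_, fun y hy => ?_⟩⟩
  · exact ((k i _ (h i x hx).1).1).trans (le_max_left _ _)
  · calc _ ≤ N * dist (f i x) (f i y) := (k i _ (h i x hx).1).2 _ (h i y hy).1
      _ ≤ N * (M * dist x y) := by gcongr; exact (h i x hx).2 y hy
      _ = (N * M) * dist x y := by ring
      _ ≤ _ := by gcongr; exact le_max_right _ _

lemma Good.re {ι κ : Type} {g : ι → W → W'} (hg : Good g) (r : κ → ι) : Good (fun k => g (r k)) := by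
  intro R
  obtain ⟨M, hM, h⟩ := hg R
  exact ⟨M, hM, fun k => h (r k)⟩

lemma Good.of_cover {ι : Type} {N : ℕ} {κ : Fin N → Type} {g : ι → W → W'} (G : ∀ a, κ a → W → W')
    (hG : ∀ a, Good (G a)) (h : ∀ i, ∃ a k, g i = G a k) : Good g := by
  intro R
  choose M hM h2 using fun a => hG a R
  refine ⟨∑ a, M a, Finset.sum_nonneg fun a _ => hM a, fun i x hx => ?_⟩
  obtain ⟨a, k, hk⟩ := h i
  have hle : M a ≤ ∑ a, M a := Finset.single_le_sum (fun a _ => hM a) (Finset.mem_univ a)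
  rw [hk]
  refine ⟨(h2 a k x hx).1.trans hle, fun y hy => ((h2 a k x hx).2 y hy).trans ?_⟩
  gcongr

lemma Good.of_contDiff [FiniteDimensional ℝ W] {ι : Type} {g : W → W'} (hg : ContDiff ℝ 1 g) :
    Good (fun _ : ι => g) := by
  have : ProperSpace W := FiniteDimensional.proper ℝ W
  intro R
  have hc := isCompact_closedBall (0 : W) R
  obtain ⟨K, hK⟩ := (hg.locallyLipschitz.locallyLipschitzOn
    (s := Metric.closedBall (0 : W) R)).exists_lipschitzOnWith_of_compact hc
  obtain ⟨B, hB⟩ := hc.exists_bound_of_continuousOn hg.continuous.continuousOn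
  refine ⟨max (max B K) 0, le_max_right _ _, fun _ x hx => ⟨?_, fun y hy => ?_⟩⟩
  · exact (hB x (by simpa using hx)).trans ((le_max_left _ _).trans (le_max_left _ _))
  · refine (hK.dist_le_mul x (by simpa using hx) y (by simpa using hy)).trans ?_
    gcongr
    exact (le_max_right _ _).trans (le_max_left _ _)

lemma Good.of_bool [FiniteDimensional ℝ W] {g : Bool → W → W'} (hg : ∀ b, ContDiff ℝ 1 (g b)) :
    Good g := by
  refine Good.of_cover (N := 2) (κ := fun _ => Unit) (fun a _ => g (a = 0)) ?_ ?_
  · intro a; exact Good.of_contDiff (hg _)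
  · intro b
    cases b
    · exact ⟨1, (), by simp⟩
    · exact ⟨0, (), by simp⟩

lemma Good.smul {ι : Type} {a : ι → W → ℝ} {g : ι → W → W'} (ha : Good a) (hg : Good g) :
    Good (fun i x => a i x • g i x) := by
  intro R
  obtain ⟨M, hM, h⟩ := ha R
  obtain ⟨N, hN, k⟩ := hg R
  refine ⟨M * N + M * N, by positivity, fun i x hx => ⟨?_, fun y hy => ?_⟩⟩
  · rw [norm_smul]
    have := mul_le_mul (h i x hx).1 (k i x hx).1 (norm_nonneg _) hM
    nlinarith [mul_nonneg hM hN]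
  · rw [dist_eq_norm]
    have e1 : a i x • g i x - a i y • g i y = a i x • (g i x - g i y) + (a i x - a i y) • g i y := by
      module
    rw [e1]
    refine (norm_add_le _ _).trans ?_
    rw [norm_smul, norm_smul, ← dist_eq_norm, ← dist_eq_norm]
    have h1 := mul_le_mul (h i x hx).1 ((k i x hx).2 y hy) dist_nonneg hM
    have h2 := mul_le_mul ((h i x hx).2 y hy) (k i y hy).1 (norm_nonneg _)
      (mul_nonneg hM dist_nonneg)
    linarith

end good

section tt
variable {W : Type} [NormedAddCommGroup W] [NormedSpace ℝ W] [FiniteDimensional ℝ W]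

lemma Dat.good_A (D : Dat W) (m : ℕ) : Good (fun (j : ℕ) (w : W) => (D.P j).symm (D.P (j + m) w)) := by
  induction m with
  | zero =>
    have : Good (fun (_ : ℕ) (w : W) => w) := Good.of_contDiff contDiff_id
    simpa using this
  | succ m ih =>
    exact ih.comp ((Good.of_bool D.sC).re (fun j => D.σ (j + m)))

lemma Dat.good_B (D : Dat W) (m : ℕ) : Good (fun (j : ℕ) (w : W) => (D.P (j + m)).symm (D.P j w)) := by
  induction m with
  | zero =>
    have : Good (fun (_ : ℕ) (w : W) => w) := Good.of_contDiff contDiff_id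
    simpa using this
  | succ m ih =>
    exact ((Good.of_bool D.tC).re (fun j => D.σ (j + m))).comp ih

lemma Dat.good_T (D : Dat W) {ι : Type} (i j : ι → ℕ) (h1 : ∀ a, i a ≤ j a + 3)
    (h2 : ∀ a, j a ≤ i a + 3) : Good (fun (a : ι) (w : W) => (D.P (i a)).symm (D.P (j a) w)) := by
  refine Good.of_cover (N := 4) (κ := fun _ => ℕ × Bool)
    (fun a k => if k.2 then fun w => (D.P k.1).symm (D.P (k.1 + a) w) else
      fun w => (D.P (k.1 + a)).symm (D.P k.1 w)) ?_ ?_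
  · intro a
    refine Good.of_cover (N := 2) (κ := fun _ => ℕ) (fun b k => if b = 0 then
      fun w => (D.P k).symm (D.P (k + a) w) else fun w => (D.P (k + a)).symm (D.P k w)) ?_ ?_
    · intro b
      by_cases hb : b = 0
      · simpa [hb] using D.good_A a
      · simpa [hb] using D.good_B a
    · rintro ⟨k, b⟩
      cases b
      · exact ⟨1, k, by simp⟩
      · exact ⟨0, k, by simp⟩
  · intro a
    rcases le_total (i a) (j a) with h | h
    · refine ⟨⟨j a - i a, by have := h2 a; omega⟩, (i a, true), ?_⟩
      simp [Nat.add_sub_cancel' h]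
    · refine ⟨⟨i a - j a, by have := h1 a; omega⟩, (j a, false), ?_⟩
      simp [Nat.add_sub_cancel' h]
end tt

end partA4

section partA5
open Topology Filter Real OnePoint
open scoped ENNReal NNReal

section cuts
variable {W : Type} [NormedAddCommGroup W] [NormedSpace ℝ W] [FiniteDimensional ℝ W]

/-- cutoff data -/
structure Cut (D : Dat W) where
  ζ : W → ℝ
  K : Set W
  δ : ℝ
  d : ℝ
  ζC : ContDiff ℝ 1 ζ
  Kc : IsCompact K
  d0 : 0 < d
  d1 : d ≤ 1
  dδ : d ≤ δ
  ζ01 : ∀ w, 0 ≤ ζ w ∧ ζ w ≤ 1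
  ζK : ∀ w, ζ w ≠ 0 → w ∈ K
  ζE : ∀ e ∈ D.E, ∀ w ∈ Metric.ball e δ, ζ w = 1
  KE : ∀ b, ∀ w ∈ K, Metric.ball ((D.s b).symm w) δ ⊆ D.E
  sd : ∀ b, ∀ z ∈ D.E, ∀ w ∈ Metric.ball z d, dist (D.s b z) (D.s b w) < δ

lemma Dat.bdd (D : Dat W) : ∃ R, 0 ≤ R ∧ ∀ z ∈ D.E, ∀ w ∈ Metric.ball z 1, ‖w‖ ≤ R := by
  obtain ⟨R, hR⟩ := D.Ec.isBounded.exists_norm_le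
  refine ⟨|R| + 1, by positivity, fun z hz w hw => ?_⟩
  have h1 := hR z hz
  have h2 : ‖w - z‖ < 1 := by simpa [dist_eq_norm] using hw
  have h3 := norm_add_le (w - z) z
  rw [sub_add_cancel] at h3
  have := le_abs_self R
  linarith

lemma Dat.cut_nonempty (D : Dat W) : Nonempty (Cut D) := by
  obtain ⟨ζ, K, δ, h1, h2, h3, h4, h5, h6, h7⟩ := D.exists_cut
  obtain ⟨R, hR, hR2⟩ := D.bdd
  obtain ⟨M, hM, hM2⟩ := Good.of_bool D.sC R
  have hp : 0 < δ / (M + 1) := by positivity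
  refine ⟨⟨ζ, K, δ, min (min δ 1) (δ / (M + 1)), h1, h2, by positivity,
    (min_le_left _ _).trans (min_le_right _ _), (min_le_left _ _).trans (min_le_left _ _),
    h4, h5, h6, h7, ?_⟩⟩
  intro b z hz w hw
  have hz1 : ‖z‖ ≤ R := hR2 z hz z (by simp)
  have hw1 : ‖w‖ ≤ R := hR2 z hz w
    (Metric.ball_subset_ball ((min_le_left _ _).trans (min_le_right _ _)) hw)
  have h := (hM2 b z hz1).2 w hw1
  have h8 : dist z w < δ / (M + 1) := by
    rw [dist_comm]
    exact lt_of_lt_of_le (Metric.mem_ball.1 hw) (min_le_right _ _)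
  rw [lt_div_iff₀ (by positivity)] at h8
  have : 0 ≤ dist z w := dist_nonneg
  nlinarith

namespace Cut
variable {D : Dat W} (C : Cut D)

lemma δ0 : 0 < C.δ := C.d0.trans_le C.dδ

def ze (i : ℕ) (x : W) : ℝ := C.ζ ((D.P i).symm x)
def zs : ℕ → W → ℝ
  | 0, _ => 0
  | 1, _ => 0
  | i + 2, x => C.ze i x
def chi (i : ℕ) (x : W) : ℝ := C.ze i x * (1 - C.zs i x)

lemma ze_contDiff (i : ℕ) : ContDiff ℝ 1 (C.ze i) := C.ζC.comp (D.P_symm_contDiff i)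

lemma zs_contDiff (i : ℕ) : ContDiff ℝ 1 (C.zs i) := by
  match i with
  | 0 => exact contDiff_const
  | 1 => exact contDiff_const
  | i + 2 => exact C.ze_contDiff i

lemma chi_contDiff (i : ℕ) : ContDiff ℝ 1 (C.chi i) :=
  (C.ze_contDiff i).mul (contDiff_const.sub (C.zs_contDiff i))

lemma zs01 (i : ℕ) (x : W) : 0 ≤ C.zs i x ∧ C.zs i x ≤ 1 := by
  match i with
  | 0 => simp [zs]
  | 1 => simp [zs]
  | i + 2 => exact C.ζ01 _

lemma chi01 (i : ℕ) (x : W) : 0 ≤ C.chi i x ∧ C.chi i x ≤ 1 := by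
  have h1 := C.zs01 i x
  have h2 : 0 ≤ C.ze i x ∧ C.ze i x ≤ 1 := C.ζ01 _
  unfold chi
  constructor
  · exact mul_nonneg h2.1 (by linarith)
  · nlinarith

lemma ze_one {i : ℕ} {x : W} (h : x ∈ D.S i) : C.ze i x = 1 :=
  C.ζE _ h _ (Metric.mem_ball_self C.δ0)

lemma ze_ball {i : ℕ} {x : W} (h : C.ze i x ≠ 0) : Metric.ball ((D.P (i + 1)).symm x) C.δ ⊆ D.E :=
  C.KE _ _ (C.ζK _ h)

lemma ze_S {i : ℕ} {x : W} (h : C.ze i x ≠ 0) : x ∈ D.S (i + 1) :=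
  C.ze_ball h (Metric.mem_ball_self C.δ0)

lemma near1' {i : ℕ} {z z' : W} (hz : z ∈ D.Z (i + 2)) (hz' : z' ∈ Metric.ball z C.d) :
    C.ze i (D.P (i + 2) z') = 0 := by
  by_contra h
  have h1 := C.ze_ball h
  rw [show i + 2 = (i + 1) + 1 from rfl, D.P_succ, Equiv.symm_apply_apply] at h1
  refine hz.2 (i + 1) rfl ?_
  rw [D.mem_S, show i + 2 = (i + 1) + 1 from rfl, D.P_succ, Equiv.symm_apply_apply]
  exact h1 (C.sd _ z hz.1 z' hz')

lemma near1 {i j : ℕ} {z z' : W} (hz : z ∈ D.Z j) (hz' : z' ∈ Metric.ball z C.d) (h : i + 2 ≤ j) :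
    C.ze i (D.P j z') = 0 := by
  obtain ⟨l, rfl⟩ : ∃ l, j = l + 2 := ⟨j - 2, by omega⟩
  rcases Nat.lt_or_ge i l with hl | hl
  · by_contra hc
    have h1 := D.S_mono hl (C.ze_S hc)
    have h2 := C.ze_one h1
    rw [C.near1' hz hz'] at h2
    exact zero_ne_one h2
  · obtain rfl : i = l := by omega
    exact C.near1' hz hz'

lemma near2 {j : ℕ} {z z' : W} (hz : z ∈ D.Z j) (hz' : z' ∈ Metric.ball z C.d) :
    C.ze j (D.P j z') = 1 := by
  unfold ze
  rw [Equiv.symm_apply_apply]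
  exact C.ζE z hz.1 _ (Metric.ball_subset_ball C.dδ hz')

lemma near3 {i j : ℕ} {z z' : W} (hz : z ∈ D.Z j) (hz' : z' ∈ Metric.ball z C.d) (h : j + 1 ≤ i) :
    C.ze i (D.P j z') = 1 := by
  have : C.ze j (D.P j z') ≠ 0 := by rw [C.near2 hz hz']; exact one_ne_zero
  exact C.ze_one (D.S_mono h (C.ze_S this))

lemma chi_one {j : ℕ} {z z' : W} (hz : z ∈ D.Z j) (hz' : z' ∈ Metric.ball z C.d) :
    C.chi j (D.P j z') = 1 := by
  unfold chi
  rw [C.near2 hz hz']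
  match j with
  | 0 => simp [zs]
  | 1 => simp [zs]
  | i + 2 => simp only [zs]; rw [C.near1 hz hz' le_rfl]; simp

lemma chi_supp {i j : ℕ} {z z' : W} (hz : z ∈ D.Z j) (hz' : z' ∈ Metric.ball z C.d)
    (h : C.chi i (D.P j z') ≠ 0) : j ≤ i + 1 ∧ i ≤ j + 2 := by
  unfold chi at h
  constructor
  · by_contra hc
    rw [C.near1 hz hz' (by omega)] at h
    simp at h
  · by_contra hc
    obtain ⟨l, rfl⟩ : ∃ l, i = l + 2 := ⟨i - 2, by omega⟩
    simp only [zs] at h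
    rw [C.near3 hz hz' (i := l) (by omega)] at h
    simp at h

lemma zs_good : Good (fun (p : {p : ℕ × ℕ // p.2 ≤ p.1 + 1 ∧ p.1 ≤ p.2 + 2}) (w : W) =>
    C.zs p.1.1 (D.P p.1.2 w)) := by
  have hT := D.good_T (ι := {p : ℕ × ℕ // p.2 ≤ p.1 + 3 ∧ p.1 ≤ p.2 + 3})
    (fun p => p.1.1) (fun p => p.1.2) (fun p => p.2.2) (fun p => p.2.1)
  have hz := (Good.of_contDiff (ι := {p : ℕ × ℕ // p.2 ≤ p.1 + 3 ∧ p.1 ≤ p.2 + 3}) C.ζC).comp hT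
  intro R
  obtain ⟨M, hM, h⟩ := hz R
  refine ⟨M, hM, ?_⟩
  rintro ⟨⟨i, j⟩, hp⟩ x hx
  simp only at hp ⊢
  match i with
  | 0 => exact ⟨by simpa [zs] using hM, fun y _ => by simp only [zs, dist_self]; positivity⟩
  | 1 => exact ⟨by simpa [zs] using hM, fun y _ => by simp only [zs, dist_self]; positivity⟩
  | i + 2 => exact h ⟨(i, j), by simp only; omega⟩ x hx

lemma chi_good : Good (fun (p : {p : ℕ × ℕ // p.2 ≤ p.1 + 1 ∧ p.1 ≤ p.2 + 2}) (w : W) =>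
    C.chi p.1.1 (D.P p.1.2 w)) := by
  have hT := D.good_T (ι := {p : ℕ × ℕ // p.2 ≤ p.1 + 1 ∧ p.1 ≤ p.2 + 2})
    (fun p => p.1.1) (fun p => p.1.2) (fun p => by have := p.2; omega) (fun p => by have := p.2; omega)
  have h1 := (Good.of_contDiff (ι := {p : ℕ × ℕ // p.2 ≤ p.1 + 1 ∧ p.1 ≤ p.2 + 2}) C.ζC).comp hT
  have h2 := (Good.of_contDiff (ι := {p : ℕ × ℕ // p.2 ≤ p.1 + 1 ∧ p.1 ≤ p.2 + 2})
    ((contDiff_const.sub contDiff_id : ContDiff ℝ 1 (fun t : ℝ => (1 : ℝ) - t)))).comp C.zs_good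
  exact h1.smul h2

variable {V : Type} [NormedAddCommGroup V] [InnerProductSpace ℝ V] (Λ : (ℝ × W) ≃L[ℝ] V)

def vv (i : ℕ) (x : W) : V := C.chi i x • Λ (1, (D.P i).symm x)

lemma vv_contDiff (i : ℕ) : ContDiff ℝ 1 (C.vv Λ i) :=
  (C.chi_contDiff i).smul (Λ.contDiff.comp (contDiff_const.prodMk (D.P_symm_contDiff i)))

lemma vv_bdd : ∃ M, 0 ≤ M ∧ ∀ i x, ‖C.vv Λ i x‖ ≤ M := by
  obtain ⟨R, hR⟩ := C.Kc.exists_bound_of_continuousOn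
    (f := fun w => Λ ((1 : ℝ), w)) (by fun_prop)
  refine ⟨max R 0, le_max_right _ _, fun i x => ?_⟩
  by_cases h : C.chi i x = 0
  · simp [vv, h]
  · have h1 : C.ze i x ≠ 0 := fun h' => h (by simp [chi, h'])
    have h2 := hR _ (C.ζK _ h1)
    have h3 := C.chi01 i x
    rw [vv, norm_smul, Real.norm_eq_abs, abs_of_nonneg h3.1]
    refine le_trans ?_ (le_max_left _ _)
    have := norm_nonneg (Λ ((1 : ℝ), (D.P i).symm x))
    nlinarith

lemma vv_lip : ∃ M, 0 ≤ M ∧ ∀ i j, ∀ z ∈ D.Z j, ∀ z' ∈ Metric.ball z C.d, ∀ z'' ∈ Metric.ball z C.d,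
    ‖C.vv Λ i (D.P j z') - C.vv Λ i (D.P j z'')‖ ≤ M * dist z' z'' := by
  obtain ⟨R, hR, hR2⟩ := D.bdd
  have hT := D.good_T (ι := {p : ℕ × ℕ // p.2 ≤ p.1 + 1 ∧ p.1 ≤ p.2 + 2})
    (fun p => p.1.1) (fun p => p.1.2) (fun p => by have := p.2; omega) (fun p => by have := p.2; omega)
  have h1 := (Good.of_contDiff (ι := {p : ℕ × ℕ // p.2 ≤ p.1 + 1 ∧ p.1 ≤ p.2 + 2})
    (Λ.contDiff.comp (contDiff_const.prodMk contDiff_id) :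
      ContDiff ℝ 1 (fun w : W => Λ ((1 : ℝ), w)))).comp hT
  obtain ⟨M, hM, h⟩ := (C.chi_good.smul h1) R
  refine ⟨M, hM, fun i j z hz z' hz' z'' hz'' => ?_⟩
  by_cases hij : j ≤ i + 1 ∧ i ≤ j + 2
  · rw [← dist_eq_norm]
    exact (h ⟨(i, j), hij⟩ z' (hR2 z hz.1 _ (Metric.ball_subset_ball C.d1 hz'))).2 z''
      (hR2 z hz.1 _ (Metric.ball_subset_ball C.d1 hz''))
  · have e1 : C.chi i (D.P j z') = 0 := by
      by_contra hc; exact hij (C.chi_supp hz hz' hc)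
    have e2 : C.chi i (D.P j z'') = 0 := by
      by_contra hc; exact hij (C.chi_supp hz hz'' hc)
    simp only [vv, e1, e2, zero_smul, sub_self, norm_zero]
    positivity

lemma vv_zero {i j : ℕ} {z z' : W} (hz : z ∈ D.Z j) (hz' : z' ∈ Metric.ball z C.d)
    (h : i ∉ Finset.Icc (j - 1) (j + 2)) : C.vv Λ i (D.P j z') = 0 := by
  rw [Finset.mem_Icc] at h
  have : C.chi i (D.P j z') = 0 := by
    by_contra hc
    have := C.chi_supp hz hz' hc
    omega
  simp [vv, this]

lemma vv_one {j : ℕ} {z z' : W} (hz : z ∈ D.Z j) (hz' : z' ∈ Metric.ball z C.d) :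
    C.vv Λ j (D.P j z') = Λ (1, z') := by
  simp [vv, C.chi_one hz hz']

/-- the embedding into a Hilbert space -/
lemma exists_F (x : W) : ∃ f : lp (fun _ : ℕ => V) 2, ∀ i, f i = ((1 : ℝ) / 2) ^ i • C.vv Λ i x := by
  obtain ⟨j, z, hz, rfl, -⟩ := D.exists_Z x
  refine ⟨∑ i ∈ Finset.Icc (j - 1) (j + 2), lp.single 2 i (((1 : ℝ) / 2) ^ i • C.vv Λ i (D.P j z)), ?_⟩
  intro i
  rw [lp.coeFn_sum, Finset.sum_apply]
  by_cases hi : i ∈ Finset.Icc (j - 1) (j + 2)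
  · rw [Finset.sum_eq_single i]
    · exact lp.single_apply_self ..
    · intro b _ hb
      exact lp.single_apply_ne _ _ _ hb.symm
    · exact fun h => absurd hi h
  · rw [C.vv_zero Λ hz (Metric.mem_ball_self C.d0) hi, smul_zero]
    refine Finset.sum_eq_zero fun b hb => ?_
    exact lp.single_apply_ne _ _ _ (fun h => hi (h ▸ hb))

noncomputable def F (x : W) : lp (fun _ : ℕ => V) 2 := Classical.choose (C.exists_F Λ x)

lemma F_apply (x : W) (i : ℕ) : C.F Λ x i = ((1 : ℝ) / 2) ^ i • C.vv Λ i x :=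
  Classical.choose_spec (C.exists_F Λ x) i

lemma F_sum {j : ℕ} {z z' : W} (hz : z ∈ D.Z j) (hz' : z' ∈ Metric.ball z C.d) :
    C.F Λ (D.P j z') = ∑ i ∈ Finset.Icc (j - 1) (j + 2),
      lp.singleContinuousLinearMap ℝ (fun _ : ℕ => V) 2 i
        (((1 : ℝ) / 2) ^ i • C.vv Λ i (D.P j z')) := by
  ext1
  funext i
  rw [F_apply, lp.coeFn_sum, Finset.sum_apply]
  simp only [lp.singleContinuousLinearMap_apply]
  by_cases hi : i ∈ Finset.Icc (j - 1) (j + 2)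
  · rw [Finset.sum_eq_single i]
    · rw [lp.single_apply_self]
    · intro b _ hb
      exact lp.single_apply_ne _ _ _ hb.symm
    · exact fun h => absurd hi h
  · rw [C.vv_zero Λ hz hz' hi, smul_zero]
    symm
    refine Finset.sum_eq_zero fun b hb => ?_
    exact lp.single_apply_ne _ _ _ (fun h => hi (h ▸ hb))

lemma half_le {i j : ℕ} (h : i ∈ Finset.Icc (j - 1) (j + 2)) : ((1 : ℝ) / 2) ^ i ≤ 2 * (1 / 2) ^ j := by
  rw [Finset.mem_Icc] at h
  have : ((1 : ℝ) / 2) ^ (i + 1) ≤ (1 / 2) ^ j :=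
    pow_le_pow_of_le_one (by norm_num) (by norm_num) (by omega)
  rw [pow_succ] at this
  linarith

lemma card_le (j : ℕ) : ((Finset.Icc (j - 1) (j + 2)).card : ℝ) ≤ 4 := by
  rw [Nat.card_Icc]
  have : j + 2 + 1 - (j - 1) ≤ 4 := by omega
  exact_mod_cast this

lemma F_up : ∃ M, 0 ≤ M ∧ ∀ j, ∀ z ∈ D.Z j, ∀ z' ∈ Metric.ball z C.d, ∀ z'' ∈ Metric.ball z C.d,
    ‖C.F Λ (D.P j z') - C.F Λ (D.P j z'')‖ ≤ M * (1 / 2) ^ j * dist z' z'' := by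
  obtain ⟨M, hM, h⟩ := C.vv_lip Λ
  refine ⟨8 * M, by positivity, fun j z hz z' hz' z'' hz'' => ?_⟩
  rw [C.F_sum Λ hz hz', C.F_sum Λ hz hz'', ← Finset.sum_sub_distrib]
  have hb : ∀ i ∈ Finset.Icc (j - 1) (j + 2),
      ‖lp.singleContinuousLinearMap ℝ (fun _ : ℕ => V) 2 i (((1 : ℝ) / 2) ^ i • C.vv Λ i (D.P j z'))
        - lp.singleContinuousLinearMap ℝ (fun _ : ℕ => V) 2 i
          (((1 : ℝ) / 2) ^ i • C.vv Λ i (D.P j z''))‖ ≤ 2 * (1 / 2) ^ j * (M * dist z' z'') := by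
    intro i hi
    rw [← map_sub, lp.singleContinuousLinearMap_apply, lp.norm_single (by norm_num), ← smul_sub,
      norm_smul, norm_pow, Real.norm_eq_abs, abs_of_pos (by norm_num : (0 : ℝ) < 1 / 2)]
    exact mul_le_mul (half_le hi) (h i j z hz z' hz' z'' hz'') (norm_nonneg _) (by positivity)
  refine (norm_sum_le_of_le _ hb).trans ?_
  rw [Finset.sum_const, nsmul_eq_mul]
  have := mul_le_mul_of_nonneg_right (card_le j)
    (by positivity : 0 ≤ 2 * (1 / 2 : ℝ) ^ j * (M * dist z' z''))
  linarith

lemma F_bd : ∃ M, 0 ≤ M ∧ ∀ j, ∀ x ∉ D.S j, ‖C.F Λ x‖ ≤ M * (1 / 2) ^ j := by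
  obtain ⟨M, hM, h⟩ := C.vv_bdd Λ
  refine ⟨8 * M, by positivity, fun j x hx => ?_⟩
  obtain ⟨l, z, hz, rfl, -⟩ := D.exists_Z x
  have hjl : j < l := by
    by_contra hc
    apply hx
    apply D.S_mono (not_lt.1 hc)
    rw [D.mem_S, Equiv.symm_apply_apply]; exact hz.1
  rw [C.F_sum Λ hz (Metric.mem_ball_self C.d0)]
  have hb : ∀ i ∈ Finset.Icc (l - 1) (l + 2),
      ‖lp.singleContinuousLinearMap ℝ (fun _ : ℕ => V) 2 i (((1 : ℝ) / 2) ^ i • C.vv Λ i (D.P l z))‖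
        ≤ 2 * (1 / 2) ^ l * M := by
    intro i hi
    rw [lp.singleContinuousLinearMap_apply, lp.norm_single (by norm_num),
      norm_smul, norm_pow, Real.norm_eq_abs, abs_of_pos (by norm_num : (0 : ℝ) < 1 / 2)]
    exact mul_le_mul (half_le hi) (h _ _) (norm_nonneg _) (by positivity)
  refine (norm_sum_le_of_le _ hb).trans ?_
  rw [Finset.sum_const, nsmul_eq_mul]
  have := mul_le_mul_of_nonneg_right (card_le l)
    (by positivity : 0 ≤ 2 * (1 / 2 : ℝ) ^ l * M)
  have h2 : ((1 : ℝ) / 2) ^ l ≤ (1 / 2) ^ j :=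
    pow_le_pow_of_le_one (by norm_num) (by norm_num) hjl.le
  have := mul_le_mul_of_nonneg_left h2 hM
  linarith

end Cut
end cuts

end partA5

section partA6
open Topology Filter Real OnePoint
open scoped ENNReal NNReal

section alm
variable {W : Type} [NormedAddCommGroup W] [NormedSpace ℝ W] [FiniteDimensional ℝ W]
  {H : Type} [NormedAddCommGroup H] [InnerProductSpace ℝ H]

lemma exists_iso (A : W →L[ℝ] H) (hA : Function.Injective A) :
    ∃ G : W ≃L[ℝ] EuclideanSpace ℝ (Fin (Module.finrank ℝ W)), ∀ v, ‖G v‖ = ‖A v‖ := by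
  let l : W ≃ₗ[ℝ] LinearMap.range (A : W →ₗ[ℝ] H) := LinearEquiv.ofInjective (A : W →ₗ[ℝ] H) hA
  have hr : Module.finrank ℝ (LinearMap.range (A : W →ₗ[ℝ] H)) = Module.finrank ℝ W :=
    l.symm.finrank_eq
  let b := (stdOrthonormalBasis ℝ (LinearMap.range (A : W →ₗ[ℝ] H))).reindex (finCongr hr)
  refine ⟨(l.trans b.repr.toLinearEquiv).toContinuousLinearEquiv, fun v => ?_⟩
  change ‖b.repr (l v)‖ = _
  rw [LinearIsometryEquiv.norm_map]
  rfl

lemma almost {X : Set H} {F : W → H} {A : W →L[ℝ] H} {w : W} (hA : HasStrictFDerivAt F A w)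
    (hi : Function.Injective A) (e : OnePoint W ≃ₜ X)
    (he : ∀ w : W, (e (w : OnePoint W) : H) = F w) :
    AlmostSmoothAt X (Module.finrank ℝ W) (e w) := by
  intro ε hε
  obtain ⟨G, hG⟩ := exists_iso A hi
  obtain ⟨m, hm, hm2⟩ := (A : W →ₗ[ℝ] H).exists_antilipschitzWith (LinearMap.ker_eq_bot.2 hi)
  have hmp : (0 : ℝ) < m := hm
  have hm3 : ∀ v, ‖v‖ ≤ m * ‖A v‖ := fun v => by
    have := hm2.le_mul_dist v 0
    simpa [dist_eq_norm] using this
  set τ := ε / (1 + ε) with hτ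
  have hτp : 0 < τ := by positivity
  have h1 : (1 + ε) * (1 - τ) = 1 := by rw [hτ]; field_simp; ring
  have h2 : τ ≤ ε := by rw [hτ]; exact div_le_self hε.le (by linarith)
  have hlo := hA.isLittleO.def (div_pos hτp hmp)
  rw [nhds_prod_eq] at hlo
  obtain ⟨N', hN', hN2⟩ := (Filter.eventually_prod_self_iff
    (r := fun x y => ‖F x - F y - A (x - y)‖ ≤ τ / m * ‖x - y‖)).1 hlo
  obtain ⟨N, hNN', hNo, hwN⟩ := _root_.mem_nhds_iff.1 hN'
  have key : ∀ x ∈ N, ∀ y ∈ N, ‖F x - F y - A (x - y)‖ ≤ τ * ‖A (x - y)‖ := by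
    intro x hx y hy
    have := hN2 x (hNN' hx) y (hNN' hy)
    refine this.trans ?_
    calc τ / m * ‖x - y‖ ≤ τ / m * (m * ‖A (x - y)‖) := by gcongr; exact hm3 _
      _ = _ := by field_simp
  have hφ : Function.Injective (fun w : W => e (w : OnePoint W)) :=
    e.injective.comp OnePoint.coe_injective
  refine ⟨(fun w : W => e (w : OnePoint W)) '' N, ?_, ⟨w, hwN, rfl⟩, G '' N, G.toHomeomorph.isOpenMap N hNo,
    (Equiv.Set.image _ N hφ).symm.trans (Equiv.Set.image G N G.injective), ?_⟩
  · exact (e.isOpenMap.comp OnePoint.isOpenEmbedding_coe.isOpenMap) N hNo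
  · intro a b
    obtain ⟨⟨x, hx⟩, rfl⟩ := (Equiv.Set.image _ N hφ).surjective a
    obtain ⟨⟨y, hy⟩, rfl⟩ := (Equiv.Set.image _ N hφ).surjective b
    simp only [Equiv.trans_apply, Equiv.symm_apply_apply]
    have d1 : dist (Equiv.Set.image (fun w : W => e (w : OnePoint W)) N hφ ⟨x, hx⟩)
        (Equiv.Set.image (fun w : W => e (w : OnePoint W)) N hφ ⟨y, hy⟩) = ‖F x - F y‖ := by
      rw [← he, ← he, ← dist_eq_norm]; rfl
    have d2 : dist (Equiv.Set.image G N G.injective ⟨x, hx⟩ :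
        EuclideanSpace ℝ (Fin (Module.finrank ℝ W)))
        (Equiv.Set.image G N G.injective ⟨y, hy⟩) = ‖A (x - y)‖ := by
      rw [← hG, map_sub, ← dist_eq_norm]; rfl
    rw [d1, d2]
    have k := key x hx y hy
    have t1 := norm_sub_norm_le (F x - F y) (A (x - y))
    have t2 := norm_sub_norm_le (A (x - y)) (F x - F y)
    rw [norm_sub_rev (A (x - y))] at t2
    have hn := norm_nonneg (A (x - y))
    constructor
    · rw [inv_mul_le_iff₀ (by linarith)]
      nlinarith
    · nlinarith
end alm

section constr
variable {W : Type} [NormedAddCommGroup W] [NormedSpace ℝ W] [FiniteDimensional ℝ W]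
  {D : Dat W} (C : Cut D)
  {V : Type} [NormedAddCommGroup V] [InnerProductSpace ℝ V] (Λ : (ℝ × W) ≃L[ℝ] V)

namespace Cut

lemma exists_kap : ∃ κ, 0 < κ ∧ ∀ u : ℝ × W, κ * ‖u‖ ≤ ‖Λ u‖ := by
  refine ⟨(‖(Λ.symm : V →L[ℝ] ℝ × W)‖ + 1)⁻¹, by positivity, fun u => ?_⟩
  rw [inv_mul_le_iff₀ (by positivity)]
  have := (Λ.symm : V →L[ℝ] ℝ × W).le_opNorm (Λ u)
  simp only [ContinuousLinearEquiv.coe_coe, ContinuousLinearEquiv.symm_apply_apply] at this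
  have := norm_nonneg (Λ u)
  linarith

lemma F_comp (x y : W) (j : ℕ) :
    (1 / 2 : ℝ) ^ j * ‖C.vv Λ j x - C.vv Λ j y‖ ≤ ‖C.F Λ x - C.F Λ y‖ := by
  have := lp.norm_apply_le_norm two_ne_zero (C.F Λ x - C.F Λ y) j
  rw [lp.coeFn_sub, Pi.sub_apply, F_apply, F_apply, ← smul_sub, norm_smul, norm_pow,
    Real.norm_eq_abs, abs_of_pos (by norm_num : (0 : ℝ) < 1 / 2)] at this
  exact this

lemma F_comp0 (x : W) (j : ℕ) : (1 / 2 : ℝ) ^ j * ‖C.vv Λ j x‖ ≤ ‖C.F Λ x‖ := by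
  have := lp.norm_apply_le_norm two_ne_zero (C.F Λ x) j
  rw [F_apply, norm_smul, norm_pow,
    Real.norm_eq_abs, abs_of_pos (by norm_num : (0 : ℝ) < 1 / 2)] at this
  exact this

lemma F_lo : ∃ c, 0 < c ∧
    (∀ j, ∀ z ∈ D.Z j, ∀ z' ∈ Metric.ball z C.d, ∀ z'' ∈ Metric.ball z C.d,
      c * (1 / 2) ^ j * dist z' z'' ≤ ‖C.F Λ (D.P j z') - C.F Λ (D.P j z'')‖) ∧
    (∀ j, ∀ z ∈ D.Z j, ∀ ρ ≤ C.d, c * (1 / 2) ^ j * ρ ≤ ‖C.F Λ (D.P j z)‖) ∧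
    (∀ j, ∀ z ∈ D.Z j, ∀ ρ ≤ C.d, ∀ z' : W, ρ ≤ dist z z' →
      c * (1 / 2) ^ j * ρ ≤ ‖C.F Λ (D.P j z) - C.F Λ (D.P j z')‖) := by
  obtain ⟨κ, hκ, hκ2⟩ := exists_kap Λ
  obtain ⟨R', hR'⟩ := C.Kc.isBounded.exists_norm_le
  obtain ⟨R, hR, hRK⟩ : ∃ R, 0 ≤ R ∧ ∀ w ∈ C.K, ‖w‖ ≤ R :=
    ⟨max R' 0, le_max_right _ _, fun w hw => (hR' w hw).trans (le_max_left _ _)⟩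
  have hd1 := C.d1
  have main : ∀ (j : ℕ) (u : ℝ × W) (v : V) (ρ : ℝ), v = Λ u → ρ ≤ (1 + R) * ‖u‖ →
      κ / (1 + R) * (1 / 2) ^ j * ρ ≤ (1 / 2) ^ j * ‖v‖ := by
    rintro j u v ρ rfl hρ
    have h1 := hκ2 u
    have h2 : κ / (1 + R) * ρ ≤ κ * ‖u‖ := by
      rw [div_mul_eq_mul_div, div_le_iff₀ (by positivity)]
      nlinarith
    have := mul_le_mul_of_nonneg_left (h2.trans h1) (by positivity : (0 : ℝ) ≤ (1 / 2) ^ j)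
    linarith
  refine ⟨κ / (1 + R), by positivity, ?_, ?_, ?_⟩
  · intro j z hz z' hz' z'' hz''
    refine (main j ((0 : ℝ), z' - z'') _ _ ?_ ?_).trans (C.F_comp Λ _ _ j)
    · rw [C.vv_one Λ hz hz', C.vv_one Λ hz hz'', ← map_sub]; simp
    · rw [dist_eq_norm]
      have : ‖z' - z''‖ ≤ ‖((0 : ℝ), z' - z'')‖ := norm_snd_le ((0 : ℝ), z' - z'')
      nlinarith [norm_nonneg ((0 : ℝ), z' - z'')]
  · intro j z hz ρ hρ
    refine (main j ((1 : ℝ), z) _ _ ?_ ?_).trans (C.F_comp0 Λ _ j)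
    · rw [C.vv_one Λ hz (Metric.mem_ball_self C.d0)]
    · have : ‖(1 : ℝ)‖ ≤ ‖((1 : ℝ), z)‖ := norm_fst_le ((1 : ℝ), z)
      rw [norm_one] at this
      nlinarith
  · intro j z hz ρ hρ z' hz'
    set t := C.chi j (D.P j z') with ht
    refine (main j ((1 : ℝ) - t, z - t • z') _ _ ?_ ?_).trans (C.F_comp Λ _ _ j)
    · rw [C.vv_one Λ hz (Metric.mem_ball_self C.d0), vv, Equiv.symm_apply_apply, ← _root_.map_smul, ← map_sub,
        ← ht]
      simp
    · have h1 : ‖1 - t‖ ≤ ‖((1 : ℝ) - t, z - t • z')‖ := norm_fst_le ((1 : ℝ) - t, z - t • z')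
      have h2 : ‖z - t • z'‖ ≤ ‖((1 : ℝ) - t, z - t • z')‖ := norm_snd_le ((1 : ℝ) - t, z - t • z')
      by_cases h0 : t = 0
      · have h4 : (1 : ℝ) ≤ ‖((1 : ℝ) - t, z - t • z')‖ := by
          rw [h0, sub_zero, norm_one] at h1; rw [h0, sub_zero]; exact h1
        nlinarith
      · have hK : ‖z'‖ ≤ R := by
          apply hRK
          apply C.ζK
          intro h'
          apply h0
          rw [ht, chi, ze, Equiv.symm_apply_apply, h', zero_mul]
        have e1 : z - z' = (z - t • z') - (1 - t) • z' := by module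
        have h3 : ‖z - z'‖ ≤ ‖z - t • z'‖ + ‖1 - t‖ * ‖z'‖ := by
          rw [← norm_smul, e1]; exact norm_sub_le _ _
        rw [dist_eq_norm] at hz'
        have := mul_le_mul h1 hK (norm_nonneg _) (norm_nonneg _)
        linarith

lemma nhd (j : ℕ) (z : W) : ∀ᶠ x in 𝓝 (D.P j z), (D.P j).symm x ∈ Metric.ball z C.d := by
  have : ContinuousAt (D.P j).symm (D.P j z) := (D.P_symm_contDiff j).continuous.continuousAt
  apply this
  rw [Equiv.symm_apply_apply]
  exact Metric.ball_mem_nhds _ C.d0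

lemma F_contDiffAt (x : W) : ContDiffAt ℝ 1 (C.F Λ) x := by
  obtain ⟨j, z, hz, rfl, -⟩ := D.exists_Z x
  have h1 : ContDiff ℝ 1 (fun x => ∑ i ∈ Finset.Icc (j - 1) (j + 2),
      lp.singleContinuousLinearMap ℝ (fun _ : ℕ => V) 2 i (((1 : ℝ) / 2) ^ i • C.vv Λ i x)) := by
    refine ContDiff.sum fun i _ => ?_
    exact (ContinuousLinearMap.contDiff _).comp (contDiff_const.smul (C.vv_contDiff Λ i))
  refine h1.contDiffAt.congr_of_eventuallyEq ?_
  filter_upwards [C.nhd j z] with x hx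
  have := C.F_sum Λ hz hx
  rwa [Equiv.apply_symm_apply] at this

lemma F_strict (x : W) : ∃ A : W →L[ℝ] lp (fun _ : ℕ => V) 2,
    HasStrictFDerivAt (C.F Λ) A x ∧ Function.Injective A := by
  have hs := (C.F_contDiffAt Λ x).hasStrictFDerivAt one_ne_zero
  refine ⟨_, hs, ?_⟩
  obtain ⟨j, z, hz, rfl, -⟩ := D.exists_Z x
  let Q : lp (fun _ : ℕ => V) 2 →L[ℝ] W := (ContinuousLinearMap.snd ℝ ℝ W).comp
    ((Λ.symm : V →L[ℝ] ℝ × W).comp (((2 : ℝ) ^ j) • lp.evalCLM ℝ (fun _ : ℕ => V) 2 j))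
  have hQ : ∀ z' ∈ Metric.ball z C.d, Q (C.F Λ (D.P j z')) = z' := by
    intro z' hz'
    change (Λ.symm ((2 : ℝ) ^ j • (C.F Λ (D.P j z') j))).2 = z'
    rw [F_apply, C.vv_one Λ hz hz', smul_smul, ← mul_pow]
    simp
  have h1 : (fun x => D.P j (Q (C.F Λ x))) =ᶠ[𝓝 (D.P j z)] id := by
    filter_upwards [C.nhd j z] with x hx
    have := hQ _ hx
    rw [Equiv.apply_symm_apply] at this
    rw [this, Equiv.apply_symm_apply, id]
  have hP := ((D.P_contDiff j).differentiable one_ne_zero (Q (C.F Λ (D.P j z)))).hasFDerivAt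
  have h2 := hP.comp (D.P j z) (Q.hasFDerivAt.comp (D.P j z) hs.hasFDerivAt)
  have h3 := h2.unique (h1.symm.hasFDerivAt_iff.1 (hasFDerivAt_id _))
  intro a b hab
  have ha := congrArg (fun T : W →L[ℝ] W => T a) h3
  have hb := congrArg (fun T : W →L[ℝ] W => T b) h3
  simp only [ContinuousLinearMap.comp_apply, ContinuousLinearMap.id_apply] at ha hb
  rw [← ha, hab, hb]

noncomputable def FF (q : OnePoint W) : lp (fun _ : ℕ => V) 2 :=
  OnePoint.elim q 0 (C.F Λ)

lemma FF_infty : C.FF Λ OnePoint.infty = 0 := rfl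
lemma FF_coe (w : W) : C.FF Λ (w : OnePoint W) = C.F Λ w := rfl

lemma FF_cont : Continuous (C.FF Λ) := by
  rw [continuous_iff_continuousAt]
  intro q
  induction q using OnePoint.rec with
  | infty =>
    obtain ⟨M, hM, h⟩ := C.F_bd Λ
    rw [ContinuousAt, FF_infty, Metric.tendsto_nhds]
    intro ε hε
    obtain ⟨j, hj⟩ := exists_pow_lt_of_lt_one (by positivity : 0 < ε / (M + 1))
      (by norm_num : (1 / 2 : ℝ) < 1)
    rw [lt_div_iff₀ (by positivity)] at hj
    rw [OnePoint.nhds_infty_eq]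
    rw [Filter.eventually_sup]
    constructor
    · rw [Filter.eventually_map, Filter.Eventually, Filter.mem_coclosedCompact_iff]
      refine (D.S_compact j).of_isClosed_subset isClosed_closure
        ((D.S_compact j).isClosed.closure_subset_iff.2 fun x hx => ?_)
      by_contra hx2
      apply hx
      have := h j x hx2
      simp only [Set.mem_setOf_eq, FF_coe, dist_zero_right]
      have h0 : (0 : ℝ) < (1 / 2) ^ j := by positivity
      nlinarith
    · simpa [FF_infty] using hε
  | coe w =>
    rw [OnePoint.continuousAt_coe]
    exact (C.F_contDiffAt Λ w).continuousAt

lemma FF_inj : Function.Injective (C.FF Λ) := by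
  obtain ⟨c, hc, h1, h2, h3⟩ := C.F_lo Λ
  have hd := C.d0
  have i1 : ∀ x : W, C.FF Λ x ≠ C.FF Λ OnePoint.infty := by
    intro x
    obtain ⟨j, z, hz, rfl, -⟩ := D.exists_Z x
    have := h2 j z hz _ le_rfl
    rw [FF_coe, FF_infty]
    intro h
    rw [h, norm_zero] at this
    have : 0 < c * (1 / 2) ^ j * C.d := by positivity
    linarith
  intro p q hpq
  induction p using OnePoint.rec with
  | infty =>
    induction q using OnePoint.rec with
    | infty => rfl
    | coe w => exact absurd hpq.symm (i1 w)
  | coe x =>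
    induction q using OnePoint.rec with
    | infty => exact absurd hpq (i1 x)
    | coe w =>
      obtain ⟨j, z, hz, rfl, -⟩ := D.exists_Z x
      obtain ⟨z', rfl⟩ := (D.P j).surjective w
      rw [FF_coe, FF_coe] at hpq
      by_contra hne
      have hz' : 0 < dist z z' := dist_pos.2 (fun h => hne (by rw [h]))
      have := h3 j z hz (min C.d (dist z z')) (min_le_left _ _) z' (min_le_right _ _)
      rw [hpq, sub_self, norm_zero] at this
      have : 0 < c * (1 / 2) ^ j * min C.d (dist z z') := by positivity
      linarith

end Cut

theorem Dat.exists_est (D : Dat W) : ∃ (X : Type) (_ : MetricSpace X) (e : OnePoint W ≃ₜ X) (c δ L : ℝ),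
    Est D e c δ L ∧ ∀ w : W, AlmostSmoothAt X (Module.finrank ℝ W) (e w) := by
  obtain ⟨C⟩ := D.cut_nonempty
  let V := EuclideanSpace ℝ (Fin (Module.finrank ℝ (ℝ × W)))
  have hV : Module.finrank ℝ (ℝ × W) = Module.finrank ℝ V := by simp [V]
  let Λ : (ℝ × W) ≃L[ℝ] V := ContinuousLinearEquiv.ofFinrankEq hV
  let e0 : OnePoint W ≃ Set.range (C.FF Λ) := Equiv.ofInjective _ (C.FF_inj Λ)
  have hc : Continuous e0 := (C.FF_cont Λ).subtype_mk _
  let e : OnePoint W ≃ₜ Set.range (C.FF Λ) := hc.homeoOfEquivCompactToT2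
  have he : ∀ q, (e q : lp (fun _ : ℕ => V) 2) = C.FF Λ q := fun q => rfl
  obtain ⟨c, hc, h1, h2, h3⟩ := C.F_lo Λ
  obtain ⟨M, hM, h4⟩ := C.F_up Λ
  obtain ⟨N, hN, h5⟩ := C.F_bd Λ
  refine ⟨Set.range (C.FF Λ), inferInstance, e, c, C.d, M + N + 1, ⟨hc, C.d0, C.d1, by linarith, ?_, ?_, ?_, ?_⟩, ?_⟩
  · intro j z hz z' hz' z'' hz''
    rw [Subtype.dist_eq, he, he, dist_eq_norm]
    refine (h4 j z hz z' hz' z'' hz'').trans ?_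
    gcongr
    linarith
  · intro j z hz z' hz' z'' hz''
    rw [Subtype.dist_eq, he, he, dist_eq_norm (C.FF Λ _)]
    exact h1 j z hz z' hz' z'' hz''
  · intro j z hz ρ hρ p hp
    obtain ⟨q, rfl⟩ := e.surjective p
    rw [Subtype.dist_eq, he, he, dist_eq_norm]
    induction q using OnePoint.rec with
    | infty =>
      rw [C.FF_infty, sub_zero]
      exact h2 j z hz ρ hρ
    | coe w =>
      obtain ⟨z', rfl⟩ := (D.P j).surjective w
      refine h3 j z hz ρ hρ z' ?_
      by_contra hcon
      refine hp z' ?_ rfl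
      rw [Metric.mem_ball, dist_comm]
      exact not_le.1 hcon
  · intro j x hx
    rw [Subtype.dist_eq, he, he, C.FF_infty, dist_zero_right]
    refine (h5 j x hx).trans ?_
    gcongr
    linarith
  · intro w
    obtain ⟨A, hA, hi⟩ := C.F_strict Λ w
    exact almost hA hi e (fun w => he w)
end constr

end partA6

section partB1
open Topology Filter Real OnePoint
open scoped ENNReal NNReal

section nq

lemma eta_small (η : ℝ≥0 ≃ₜ ℝ≥0) : ∃ t0 : ℝ≥0, 0 < t0 ∧ ∀ t < t0, η t < 1 := by
  have hm : StrictMono η := by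
    rcases η.continuous.strictMono_of_inj η.injective with h | h
    · exact h
    · exfalso
      obtain ⟨t, ht⟩ := η.surjective (η 0 + 1)
      have := h.antitone (zero_le : (0 : ℝ≥0) ≤ t)
      rw [ht] at this
      exact absurd this (not_le.2 (lt_add_of_pos_right _ one_pos))
  obtain ⟨t0, h0⟩ := η.surjective 1
  refine ⟨t0, ?_, fun t ht => h0 ▸ hm ht⟩
  rw [pos_iff_ne_zero]
  rintro rfl
  obtain ⟨t, ht⟩ := η.surjective 0
  have := hm.monotone (zero_le : (0 : ℝ≥0) ≤ t)
  rw [ht, h0] at this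
  exact absurd this (by simp)

lemma sph {V : Type} [NormedAddCommGroup V] [InnerProductSpace ℝ V] {a p : V} (ha : ‖a‖ = 1)
    (hp : ‖p‖ = 1) (hne : a ≠ p) {s : ℝ} (h0 : 0 ≤ s) (h1 : s ≤ 1) :
    (1 - s) • a - s • p ≠ 0 ∧
      ‖a - p‖ ≤ ‖‖(1 - s) • a - s • p‖⁻¹ • ((1 - s) • a - s • p) - p‖ := by
  have hN : (1 - s) • a - s • p ≠ 0 := by
    intro h
    rw [sub_eq_zero] at h
    have h2 := congrArg norm h
    rw [norm_smul, norm_smul, ha, hp, Real.norm_of_nonneg h0, Real.norm_of_nonneg (by linarith)] at h2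
    have h3 : s = 1 / 2 := by linarith
    subst h3
    have h4 : (1 - 1 / 2 : ℝ) = 1 / 2 := by norm_num
    rw [h4] at h
    exact hne (smul_right_injective V (by norm_num : (1 / 2 : ℝ) ≠ 0) h)
  refine ⟨hN, ?_⟩
  set N := (1 - s) • a - s • p with hNdef
  have hNp : 0 < ‖N‖ := norm_pos_iff.2 hN
  set c := inner ℝ a p with hc
  have c1 : -1 ≤ c := by
    have := neg_le_of_abs_le (abs_real_inner_le_norm a p); rw [ha, hp] at this; linarith
  have c2 : c ≤ 1 := by
    have := real_inner_le_norm a p; rw [ha, hp] at this; linarith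
  have e1 : inner ℝ N p = (1 - s) * c - s := by
    rw [hNdef, inner_sub_left, real_inner_smul_left, real_inner_smul_left,
      real_inner_self_eq_norm_sq, hp]; ring
  have e2 : inner ℝ N a = (1 - s) - s * c := by
    rw [hNdef, inner_sub_left, real_inner_smul_left, real_inner_smul_left,
      real_inner_self_eq_norm_sq, ha, real_inner_comm]; ring
  have b1 : ‖N‖ ≤ 1 := by
    have := norm_sub_le ((1 - s) • a) (s • p)
    rw [norm_smul, norm_smul, ha, hp, Real.norm_of_nonneg h0, Real.norm_of_nonneg (by linarith)] at this
    linarith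
  have b2 : (1 - s) - s * c ≤ ‖N‖ := by
    have := real_inner_le_norm N a; rw [e2, ha] at this; linarith
  have key : (1 - s) * c - s ≤ c * ‖N‖ := by
    rcases le_total 0 c with h | h
    · have := mul_le_mul_of_nonneg_left b2 h
      nlinarith [mul_nonneg h0 (by nlinarith : 0 ≤ 1 - c ^ 2)]
    · have := mul_le_mul_of_nonpos_left b1 h
      nlinarith [mul_nonneg h0 (by linarith : 0 ≤ c + 1)]
  have hu : ‖‖N‖⁻¹ • N‖ = 1 := by
    rw [norm_smul, norm_inv, norm_norm, inv_mul_cancel₀ hNp.ne']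
  have key2 : inner ℝ (‖N‖⁻¹ • N) p ≤ c := by
    rw [real_inner_smul_left, e1, inv_mul_le_iff₀ hNp]; linarith
  have q1 := norm_sub_sq_real a p
  have q2 := norm_sub_sq_real (‖N‖⁻¹ • N) p
  rw [ha, hp] at q1
  rw [hu, hp] at q2
  exact le_of_sq_le_sq (by nlinarith) (norm_nonneg _)

/-- perfect squares -/
noncomputable def sig (j : ℕ) : Bool := by
  classical exact decide (IsSquare j)

lemma sig_inf (j : ℕ) : ∃ i, j ≤ i ∧ sig i = true :=
  ⟨j * j, Nat.le_mul_self j, by simp [sig]⟩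

lemma sig_run (m i : ℕ) (hi : i < m) : sig (m * m + 1 + i) = false := by
  simp only [sig, decide_eq_false_iff_not]
  rintro ⟨r, hr⟩
  rcases Nat.lt_or_ge m r with h | h
  · nlinarith
  · nlinarith

variable {k : ℕ}

/-- the concrete data -/
noncomputable def DD (k : ℕ) : Dat (WW k) where
  s := sE k
  σ := sig
  E := EE k
  sC b := by
    cases b
    · exact psi_contDiff
    · exact contDiff_const.smul contDiff_id
  tC b := by
    cases b
    · exact phi_contDiff
    · exact contDiff_const.smul contDiff_id
  Ec := EE_compact
  En := ⟨_, gam_EE 0⟩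
  Ei b e he := by
    cases b
    · exact EO_sub (phi_EE he)
    · exact EO_sub (tau_EE he)
  exh w := exhaust (u := fun j => (Psi (sE k) sig j).symm w) sig_inf (fun j => rfl)

lemma DD_run (j m : ℕ) (h : ∀ i < m, sig (j + i) = false) (x : WW k) :
    ((DD k).P (j + m)).symm x = phi^[m] (((DD k).P j).symm x) := by
  induction m with
  | zero => rfl
  | succ m ih =>
    rw [Function.iterate_succ_apply', ← ih fun i hi => h i (by omega), ← add_assoc, Dat.P_succ_symm]
    change (sE k (sig (j + m))).symm _ = _
    rw [h m (by omega)]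
    rfl

lemma gam_per : gam k (-1) = gam k 1 := by
  simp [gam]

theorem non_qs {X : Type} [MetricSpace X] {e : OnePoint (WW k) ≃ₜ X} {c δ L : ℝ}
    (h : Est (DD k) e c δ L) {n : ℕ} (f : X ≃ₜ EucSphere n) : ¬ IsQuasisymmetric f := by
  rintro ⟨η, hη⟩
  obtain ⟨t0, ht0, hηt⟩ := eta_small η
  set ε : ℝ := min t0 1 with hε
  have hεp : 0 < ε := lt_min (by exact_mod_cast ht0) one_pos
  have hc := h.c0
  have hδ := h.d0
  have hL : 0 < L := by linarith [h.L1]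
  obtain ⟨m, hm⟩ := exists_pow_lt_of_lt_one (by positivity : 0 < ε * (c * δ) / L)
    (by norm_num : (1 / 2 : ℝ) < 1)
  rw [lt_div_iff₀ hL] at hm
  set j := m * m + 1 with hj
  set p : EuclideanSpace ℝ (Fin (n + 1)) := (f (e OnePoint.infty)).1 with hp
  have np : ‖p‖ = 1 := mem_sphere_zero_iff_norm.1 (f (e OnePoint.infty)).2
  let q : ℝ → EuclideanSpace ℝ (Fin (n + 1)) := fun t =>
    (f (e ((DD k).P j (gam k t) : WW k))).1
  have nq : ∀ t, ‖q t‖ = 1 := fun t =>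
    mem_sphere_zero_iff_norm.1 (f (e ((DD k).P j (gam k t) : WW k))).2
  have hqp : ∀ t, q t ≠ p := fun t hh =>
    OnePoint.coe_ne_infty _ (e.injective (f.injective (Subtype.ext hh)))
  have cq : Continuous q := by
    have := (((DD k).P_contDiff j).continuous).comp (gam_cont (k := k))
    exact continuous_subtype_val.comp (f.continuous.comp (e.continuous.comp
      (OnePoint.continuous_coe.comp this)))
  let cl : ℝ → ℝ := fun s => max 0 (min s 1)
  have cl0 : ∀ s, 0 ≤ cl s := fun s => le_max_left _ _
  have cl1 : ∀ s, cl s ≤ 1 := fun s => max_le zero_le_one (min_le_right _ _)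
  have ccl : Continuous cl := by fun_prop
  let N : ℝ × ℝ → EuclideanSpace ℝ (Fin (n + 1)) := fun d => (1 - cl d.2) • q d.1 - cl d.2 • p
  have cN : Continuous N := by fun_prop
  have hN : ∀ d, N d ≠ 0 ∧ ‖q d.1 - p‖ ≤ ‖‖N d‖⁻¹ • N d - p‖ := fun d =>
    sph (nq d.1) np (hqp d.1) (cl0 d.2) (cl1 d.2)
  let U : ℝ × ℝ → EucSphere n := fun d => ⟨‖N d‖⁻¹ • N d, by
    rw [mem_sphere_zero_iff_norm, norm_smul, norm_inv, norm_norm,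
      inv_mul_cancel₀ (norm_ne_zero_iff.2 (hN d).1)]⟩
  have cU : Continuous U := by
    refine Continuous.subtype_mk ?_ _
    exact (cN.norm.inv₀ fun d => norm_ne_zero_iff.2 (hN d).1).smul cN
  have hUd : ∀ d, ‖q d.1 - p‖ ≤ dist (U d) (f (e OnePoint.infty)) := fun d => by
    rw [Subtype.dist_eq, dist_eq_norm]; exact (hN d).2
  have hUp : ∀ d, U d ≠ f (e OnePoint.infty) := by
    intro d hd
    have := hUd d
    rw [hd, dist_self] at this
    exact hqp d.1 (sub_eq_zero.1 (norm_le_zero_iff.1 this))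
  let T : ℝ × ℝ → OnePoint (WW k) := fun d => e.symm (f.symm (U d))
  have cT : Continuous T := e.symm.continuous.comp (f.symm.continuous.comp cU)
  have hT : ∀ d, ∃ w : WW k, (w : OnePoint (WW k)) = T d := by
    intro d
    rw [← OnePoint.ne_infty_iff_exists]
    intro hh
    apply hUp d
    rw [← hh]
    simp [T]
  choose w hw using hT
  have cw : Continuous w := by
    rw [OnePoint.isOpenEmbedding_coe.isInducing.continuous_iff]
    exact cT.congr fun d => (hw d).symm
  have hfw : ∀ d, f (e (w d : OnePoint (WW k))) = U d := fun d => by rw [hw]; simp [T]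
  have hdist : ∀ d, ε * (c * δ * (1 / 2) ^ j) ≤ dist (e (w d : OnePoint (WW k))) (e OnePoint.infty) := by
    intro d
    set z : X := e ((DD k).P j (gam k d.1) : WW k) with hz
    have hzl : c * δ * (1 / 2) ^ j ≤ dist z (e OnePoint.infty) := h.inf_lo (by
      rw [Dat.mem_S, Equiv.symm_apply_apply]; exact gam_EE _)
    have hzp : 0 < dist z (e OnePoint.infty) := lt_of_lt_of_le (by positivity) hzl
    refine (mul_le_mul_of_nonneg_left hzl hεp.le).trans ?_
    by_cases hyz : e (w d : OnePoint (WW k)) = z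
    · rw [hyz]
      have : ε ≤ 1 := min_le_right _ _
      nlinarith
    have hxy : e OnePoint.infty ≠ e (w d : OnePoint (WW k)) := fun hh => OnePoint.infty_ne_coe _ (e.injective hh)
    have hxz : e OnePoint.infty ≠ z := fun hh => OnePoint.infty_ne_coe _ (e.injective hh)
    have hq := hη (e OnePoint.infty) _ z hxy hxz hyz
    by_contra hcon
    rw [not_le] at hcon
    have hlt : nndist (e OnePoint.infty) (e (w d : OnePoint (WW k))) / nndist (e OnePoint.infty) z < t0 := by
      rw [← NNReal.coe_lt_coe, NNReal.coe_div, coe_nndist, coe_nndist, dist_comm (e OnePoint.infty),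
        dist_comm (e OnePoint.infty), div_lt_iff₀ hzp]
      refine hcon.trans_le ?_
      gcongr
      exact min_le_left _ _
    have h1 := hηt _ hlt
    have h2 : 1 ≤ nndist (f (e OnePoint.infty)) (f (e (w d : OnePoint (WW k)))) / nndist (f (e OnePoint.infty)) (f z) := by
      rw [← NNReal.coe_le_coe, NNReal.coe_div, coe_nndist, coe_nndist, NNReal.coe_one,
        dist_comm (f (e OnePoint.infty)), dist_comm (f (e OnePoint.infty)), one_le_div, hfw]
      · have := hUd d
        rwa [← dist_eq_norm] at this
      · exact dist_pos.2 fun hh => hxz (f.injective hh.symm)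
    exact absurd (h2.trans hq) (not_le.2 h1)
  have hmem : ∀ d, w d ∈ (DD k).S (j + m) := by
    intro d
    by_contra hcon
    have h1 := h.inf _ _ hcon
    have h2 := hdist d
    rw [pow_add] at h1
    have : (0 : ℝ) < (1 / 2) ^ j := by positivity
    nlinarith
  have hU0 : ∀ t, U (t, 0) = f (e ((DD k).P j (gam k t) : WW k)) := by
    intro t
    apply Subtype.ext
    have : N (t, 0) = q t := by simp [N, cl]
    change ‖N (t, 0)‖⁻¹ • N (t, 0) = q t
    rw [this, nq]; simp
  have hwU : ∀ d d', U d = U d' → w d = w d' := by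
    intro d d' hh
    apply OnePoint.coe_injective
    rw [hw, hw]
    simp only [T, hh]
  refine noNull m (fun d => ((DD k).P j).symm (w d))
    (((DD k).P_symm_contDiff j).continuous.comp cw) ?_ ?_ ?_ ?_
  · intro d
    rw [← DD_run j m (fun i hi => sig_run m i hi)]
    exact hmem d
  · intro t
    have : w (t, 0) = (DD k).P j (gam k t) := by
      apply OnePoint.coe_injective
      rw [hw]
      simp only [T, hU0, Homeomorph.symm_apply_apply]
    simp only [this, Equiv.symm_apply_apply]
  · intro t
    rw [hwU (t, 1) (0, 1)]
    apply Subtype.ext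
    have : N (t, 1) = N (0, 1) := by simp [N, cl]
    simp only [U, this]
  · intro s
    rw [hwU (-1, s) (1, s)]
    apply Subtype.ext
    have : N (-1, s) = N (1, s) := by simp only [N, q, gam_per]
    simp only [U, this]

theorem mainthm (n : ℕ) (hn : 3 ≤ n) :
    ∃ (X : Type) (_ : MetricSpace X) (_ : X ≃ₜ EucSphere n) (x₀ : X),
      AhlforsRegular X n ∧ LinearlyLocallyContractible X ∧
      (∀ x : X, x ≠ x₀ → AlmostSmoothAt X n x) ∧
      ¬ ∃ f : X ≃ₜ EucSphere n, IsQuasisymmetric f := by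
  obtain ⟨k, rfl⟩ : ∃ k, n = k + 3 := ⟨n - 3, by omega⟩
  have hfr : Module.finrank ℝ (WW k) = k + 3 := by
    simp [WW]; omega
  obtain ⟨X, hX, e, c, δ, L, h, hA⟩ := (DD k).exists_est
  have hnt : Nontrivial (WW k) := Module.nontrivial_of_finrank_pos (R := ℝ) (by omega)
  refine ⟨X, hX, e.symm.trans (onePointEquivSphereOfFinrankEq (by rw [hfr]; simp)), e OnePoint.infty, ?_, ?_, ?_, ?_⟩
  · rw [← hfr]; exact h.ahlfors (by omega)
  · exact h.llc null_b
  · intro x hx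
    obtain ⟨q, rfl⟩ := e.surjective x
    induction q using OnePoint.rec with
    | infty => exact absurd rfl hx
    | coe w => rw [← hfr]; exact hA w
  · rintro ⟨f, hf⟩
    exact non_qs h f hf
end nq

end partB1

/-- **Theorem 1.1 (quasisymmetric form).** For each `n ≥ 3` there is a metric sphere
`(X, d)` homeomorphic to the Euclidean `n`-sphere, Ahlfors `n`-regular, linearly locally
contractible, and almost smooth away from a single point `x₀` (in the local
`(1+ε)`-bilipschitz sense), which admits no quasisymmetric parametrization by the
Euclidean sphere. -/
theorem qs_nonparametrizable_almost_smooth_sphere_one_point (n : ℕ) (hn : 3 ≤ n) :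
    ∃ (X : Type) (_ : MetricSpace X) (_ : X ≃ₜ EucSphere n) (x₀ : X),
      AhlforsRegular X n ∧
      LinearlyLocallyContractible X ∧
      (∀ x : X, x ≠ x₀ → AlmostSmoothAt X n x) ∧
      ¬ ∃ f : X ≃ₜ EucSphere n, IsQuasisymmetric f := by
  exact mainthm n hn
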